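/- arXiv:0810.4996 — 7 statements merged into one kernel-verified Lean document; each statement's English description precedes it below -/
import Mathlib

section
/- Let T_s : ℝ × ℝ^m → ℝ × ℝ^m be the translation T_s(t, x) = (t + s, x). For every real s ≥ 0 and all convex bodies Δ₀, …, Δ_m ⊂ ℝ × ℝ^m, MS(T_s Δ₀, Δ₁, …, Δ_m) = MS(Δ₀, Δ₁, …, Δ_m) + (s/(m+1)) · MV(B₁, …, B_m), where B_j ⊂ ℝ^m is the image of Δ_j under the projection (t, a) ↦ a. -/
open MeasureTheory

/-- The shadow volume of a convex body `B ⊂ ℝ × ℝ^m`. -/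
noncomputable def shadowVolume (m : ℕ) (B : Set (ℝ × (Fin m → ℝ))) : ℝ :=
  ∫ a in Prod.snd '' B, sSup {t : ℝ | (t, a) ∈ B}

/-- The image of a convex body `Δ ⊂ ℝ × ℝ^m` under the translation `T_s(t, x) = (t + s, x)`. -/
noncomputable def translateBody (m : ℕ) (s : ℝ) (Δ : ConvexBody (ℝ × (Fin m → ℝ))) :
    ConvexBody (ℝ × (Fin m → ℝ)) where
  carrier := (fun p : ℝ × (Fin m → ℝ) => (p.1 + s, p.2)) '' (Δ : Set (ℝ × (Fin m → ℝ)))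
  convex' := by
    have h : (fun p : ℝ × (Fin m → ℝ) => (p.1 + s, p.2))
        = fun p : ℝ × (Fin m → ℝ) => ((s, 0) : ℝ × (Fin m → ℝ)) + p := by
      funext p
      simp [Prod.ext_iff, add_comm]
    rw [h]
    exact Δ.convex.translate _
  isCompact' := Δ.isCompact.image (by fun_prop)
  nonempty' := Δ.nonempty.image _

/-- The image of a convex body `Δ ⊂ ℝ × ℝ^m` under the projection `(t, a) ↦ a`. -/
noncomputable def projBody (m : ℕ) (Δ : ConvexBody (ℝ × (Fin m → ℝ))) :
    ConvexBody (Fin m → ℝ) where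
  carrier := Prod.snd '' (Δ : Set (ℝ × (Fin m → ℝ)))
  convex' := Δ.convex.linear_image (LinearMap.snd ℝ ℝ (Fin m → ℝ))
  isCompact' := Δ.isCompact.image continuous_snd
  nonempty' := Δ.nonempty.image _

namespace MultilinearMap

open Finset

/-- The polarization identity: a symmetric multilinear map is determined by its diagonal. -/
theorem sum_powerset_neg_one_pow_card_smul_map_sum {R ι M G : Type*} [Semiring R]
    [AddCommMonoid M] [Module R M] [AddCommGroup G] [Module R G] [Fintype ι] [DecidableEq ι]
    (f : MultilinearMap R (fun _ : ι => M) G)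
    (hf : ∀ (x : ι → M) (σ : Equiv.Perm ι), f (x ∘ σ) = f x) (x : ι → M) :
    ∑ t ∈ (univ : Finset ι).powerset, (-1 : ℤ) ^ #t • f (fun _ => ∑ i ∈ t, x i)
      = (Fintype.card ι).factorial • (-1 : ℤ) ^ Fintype.card ι • f x := by
  have expand (t : Finset ι) : f (fun _ => ∑ i ∈ t, x i)
      = ∑ r : ι → ι, if ∀ j, r j ∈ t then f (x ∘ r) else 0 := by
    rw [f.map_sum_finset (fun _ i => x i) (fun _ => t), ← Finset.sum_filter]
    refine Finset.sum_congr ?_ fun _ _ => rfl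
    ext r
    simp [Fintype.mem_piFinset]
  have coeff (r : ι → ι) :
      ∑ t ∈ (univ : Finset ι).powerset,
          (-1 : ℤ) ^ #t • (if ∀ j, r j ∈ t then f (x ∘ r) else 0)
        = if Function.Bijective r then (-1 : ℤ) ^ Fintype.card ι • f x else 0 := by
    split_ifs with hr
    · rw [Finset.sum_eq_single univ]
      · simpa using congrArg ((-1 : ℤ) ^ Fintype.card ι • ·) (hf x (Equiv.ofBijective r hr))
      · intro t _ ht
        rw [if_neg, smul_zero]
        intro h
        refine ht (eq_univ_of_forall fun i => ?_)
        obtain ⟨j, rfl⟩ := hr.surjective i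
        exact h j
      · simp
    · have hs : ¬ Function.Surjective r := fun h => hr (Finite.surjective_iff_bijective.mp h)
      obtain ⟨i, hi⟩ := not_forall.mp hs
      have hi' : ∀ j, r j ≠ i := fun j hj => hi ⟨j, hj⟩
      rw [← Finset.insert_erase (mem_univ i), Finset.sum_powerset_insert (notMem_erase i _),
        ← Finset.sum_add_distrib]
      refine Finset.sum_eq_zero fun t ht => ?_
      have hit : i ∉ t := fun h => notMem_erase i _ (mem_powerset.mp ht h)
      simp only [card_insert_of_notMem hit, pow_succ, mem_insert, hi', false_or]
      split_ifs <;> simp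
  simp_rw [expand, Finset.smul_sum]
  rw [Finset.sum_comm]
  simp_rw [coeff]
  rw [← Finset.sum_filter, Finset.sum_const]
  congr 1
  rw [← Fintype.card_perm, ← Fintype.card_subtype]
  exact Fintype.card_congr ⟨fun r => Equiv.ofBijective r.1 r.2, fun σ => ⟨σ, σ.bijective⟩,
    fun _ => rfl, fun σ => by ext; rfl⟩

/-- A function which is additive in every argument, as a multilinear map over `ℕ`. -/
def ofAdd {ι M G : Type*} [DecidableEq ι] [AddCommMonoid M] [AddCommGroup G] (f : (ι → M) → G)
    (hf : ∀ (x : ι → M) (i : ι) (a b : M), f (Function.update x i (a + b))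
      = f (Function.update x i a) + f (Function.update x i b)) :
    MultilinearMap ℕ (fun _ : ι => M) G where
  toFun := f
  map_update_add' {_} x i a b := by
    convert hf x i a b
  map_update_smul' {_} x i c a := by
    have h := (AddMonoidHom.mk' (fun a => f (Function.update x i a))
      (by convert hf x i)).map_nsmul c a
    exact h

end MultilinearMap

section

variable {m : ℕ}

theorem isGreatest_sSup_fiber (B : ConvexBody (ℝ × (Fin m → ℝ))) {a : Fin m → ℝ}
    (ha : a ∈ projBody m B) :
    IsGreatest {t : ℝ | (t, a) ∈ (B : Set (ℝ × (Fin m → ℝ)))}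
      (sSup {t : ℝ | (t, a) ∈ (B : Set (ℝ × (Fin m → ℝ)))}) := by
  have hc : IsCompact {t : ℝ | (t, a) ∈ (B : Set (ℝ × (Fin m → ℝ)))} := by
    refine (B.isCompact.image continuous_fst).of_isClosed_subset
      (B.isClosed.preimage (by fun_prop : Continuous fun t : ℝ => (t, a))) ?_
    exact fun t ht => ⟨(t, a), ht, rfl⟩
  obtain ⟨p, hp, rfl⟩ := ha
  exact hc.isGreatest_sSup ⟨p.1, hp⟩

theorem measurable_sSup_fiber (B : ConvexBody (ℝ × (Fin m → ℝ))) :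
    Measurable fun a : Fin m → ℝ => sSup {t : ℝ | (t, a) ∈ (B : Set (ℝ × (Fin m → ℝ)))} := by
  have hP : MeasurableSet (projBody m B : Set (Fin m → ℝ)) := (projBody m B).isClosed.measurableSet
  refine measurable_of_restrict_of_restrict_compl hP (measurable_of_Ici fun c => ?_) ?_
  · have hK : MeasurableSet (Prod.snd '' ((B : Set (ℝ × (Fin m → ℝ))) ∩ {p | c ≤ p.1})) :=
      ((B.isCompact.inter_right (isClosed_le continuous_const continuous_fst)).image
        continuous_snd).isClosed.measurableSet
    convert measurable_subtype_coe hK using 1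
    ext ⟨a, ha⟩
    have hg := isGreatest_sSup_fiber B ha
    constructor
    · exact fun h => ⟨(_, a), ⟨hg.1, h⟩, rfl⟩
    · rintro ⟨⟨t, _⟩, ⟨hp, hc⟩, rfl⟩
      exact le_trans hc (hg.2 hp)
  · convert (measurable_const : Measurable fun _ => (0 : ℝ)) using 1
    ext ⟨a, ha⟩
    have : {t : ℝ | (t, a) ∈ (B : Set (ℝ × (Fin m → ℝ)))} = ∅ :=
      Set.eq_empty_of_forall_notMem fun t ht => ha ⟨(t, a), ht, rfl⟩
    simp only [Set.domRestrict_apply, this, Real.sSup_empty]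

theorem integrableOn_sSup_fiber (B : ConvexBody (ℝ × (Fin m → ℝ))) :
    IntegrableOn (fun a : Fin m → ℝ => sSup {t : ℝ | (t, a) ∈ (B : Set (ℝ × (Fin m → ℝ)))})
      (projBody m B) := by
  obtain ⟨C, hC⟩ := B.isBounded.exists_norm_le
  refine Measure.integrableOn_of_bounded (M := C) (projBody m B).isCompact.measure_lt_top.ne
    (measurable_sSup_fiber B).aestronglyMeasurable ?_
  refine ae_restrict_of_forall_mem (projBody m B).isClosed.measurableSet fun a ha => ?_
  exact (norm_fst_le (_, a)).trans (hC _ (isGreatest_sSup_fiber B ha).1)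

theorem projBody_translateBody (s : ℝ) (B : ConvexBody (ℝ × (Fin m → ℝ))) :
    projBody m (translateBody m s B) = projBody m B := by
  refine ConvexBody.ext ?_
  change Prod.snd '' ((fun p : ℝ × (Fin m → ℝ) => (p.1 + s, p.2)) '' (B : Set _)) = Prod.snd '' _
  rw [Set.image_image]

theorem shadowVolume_translateBody (s : ℝ) (B : ConvexBody (ℝ × (Fin m → ℝ))) :
    shadowVolume m (translateBody m s B)
      = shadowVolume m B + s * (volume (projBody m B : Set (Fin m → ℝ))).toReal := by
  have hP : MeasurableSet (projBody m B : Set (Fin m → ℝ)) := (projBody m B).isClosed.measurableSet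
  have fiber {a : Fin m → ℝ} (ha : a ∈ projBody m B) :
      sSup {t : ℝ | (t, a) ∈ (translateBody m s B : Set (ℝ × (Fin m → ℝ)))}
        = sSup {t : ℝ | (t, a) ∈ (B : Set (ℝ × (Fin m → ℝ)))} + s := by
    have hg := isGreatest_sSup_fiber B ha
    refine IsGreatest.csSup_eq ⟨⟨(_, a), hg.1, rfl⟩, ?_⟩
    rintro _ ⟨⟨t, b⟩, hp, h⟩
    obtain ⟨rfl, rfl⟩ := Prod.mk.inj h
    have : t ≤ _ := hg.2 hp
    gcongr
  calc shadowVolume m (translateBody m s B)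
      = ∫ a in projBody m (translateBody m s B),
          sSup {t : ℝ | (t, a) ∈ (translateBody m s B : Set (ℝ × (Fin m → ℝ)))} := rfl
    _ = ∫ a in projBody m B, (sSup {t : ℝ | (t, a) ∈ (B : Set (ℝ × (Fin m → ℝ)))} + s) := by
      rw [projBody_translateBody]
      exact setIntegral_congr_fun hP fun a ha => fiber ha
    _ = (∫ a in projBody m B, sSup {t : ℝ | (t, a) ∈ (B : Set (ℝ × (Fin m → ℝ)))})
          + ∫ _ in (projBody m B : Set (Fin m → ℝ)), s :=
      integral_add (integrableOn_sSup_fiber B)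
        (integrableOn_const (projBody m B).isCompact.measure_lt_top.ne)
    _ = _ := by
      rw [setIntegral_const, smul_eq_mul, mul_comm]
      rfl

open scoped Pointwise in
/-- The vertical translation by `s` is the Minkowski sum with the point `(s, 0)`. -/
theorem translateBody_eq_add (s : ℝ) (B : ConvexBody (ℝ × (Fin m → ℝ))) :
    translateBody m s B = translateBody m s 0 + B := by
  refine ConvexBody.ext ?_
  change (fun p : ℝ × (Fin m → ℝ) => (p.1 + s, p.2)) '' (B : Set _)
    = (fun p : ℝ × (Fin m → ℝ) => (p.1 + s, p.2)) '' {0}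
      + (B : Set (ℝ × (Fin m → ℝ)))
  simp [Set.image_singleton, Prod.add_def, add_comm]

theorem projBody_zero : projBody m 0 = 0 :=
  ConvexBody.ext (Set.image_singleton (f := Prod.snd) (a := (0 : ℝ × (Fin m → ℝ))))

theorem projBody_add (K L : ConvexBody (ℝ × (Fin m → ℝ))) :
    projBody m (K + L) = projBody m K + projBody m L :=
  ConvexBody.ext (Set.image_add (AddMonoidHom.snd ℝ (Fin m → ℝ)))

theorem projBody_sum {ι : Type*} (t : Finset ι) (K : ι → ConvexBody (ℝ × (Fin m → ℝ))) :
    projBody m (∑ i ∈ t, K i) = ∑ i ∈ t, projBody m (K i) :=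
  Finset.sum_hom_rel (r := fun L P => projBody m L = P) projBody_zero
    fun i L _ h => (projBody_add (K i) L).trans (congrArg (projBody m (K i) + ·) h)

end

/-- For `s ≥ 0`,
`MS(T_s Δ₀, Δ₁, …, Δ_m) = MS(Δ₀, …, Δ_m) + (s/(m+1)) · MV(B₁, …, B_m)`,
where `B_j` is the projection of `Δ_j` to `ℝ^m`. -/
theorem mixed_shadow_volume_translate (m : ℕ)
    (MS : (Fin (m + 1) → ConvexBody (ℝ × (Fin m → ℝ))) → ℝ)
    (MS_symm : ∀ (Δ : Fin (m + 1) → ConvexBody (ℝ × (Fin m → ℝ)))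
      (σ : Equiv.Perm (Fin (m + 1))), MS (Δ ∘ σ) = MS Δ)
    (MS_add : ∀ (Δ : Fin (m + 1) → ConvexBody (ℝ × (Fin m → ℝ))) (i : Fin (m + 1))
      (K K' : ConvexBody (ℝ × (Fin m → ℝ))),
      MS (Function.update Δ i (K + K'))
        = MS (Function.update Δ i K) + MS (Function.update Δ i K'))
    (MS_diag : ∀ B : ConvexBody (ℝ × (Fin m → ℝ)),
      MS (fun _ => B) = shadowVolume m (B : Set (ℝ × (Fin m → ℝ))))
    (MV : (Fin m → ConvexBody (Fin m → ℝ)) → ℝ)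
    (MV_symm : ∀ (P : Fin m → ConvexBody (Fin m → ℝ)) (σ : Equiv.Perm (Fin m)),
      MV (P ∘ σ) = MV P)
    (MV_add : ∀ (P : Fin m → ConvexBody (Fin m → ℝ)) (i : Fin m)
      (K K' : ConvexBody (Fin m → ℝ)),
      MV (Function.update P i (K + K'))
        = MV (Function.update P i K) + MV (Function.update P i K'))
    (MV_diag : ∀ P : ConvexBody (Fin m → ℝ),
      MV (fun _ => P) = (volume (P : Set (Fin m → ℝ))).toReal)
    (s : ℝ) (hs : 0 ≤ s) (Δ : Fin (m + 1) → ConvexBody (ℝ × (Fin m → ℝ))) :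
    MS (Function.update Δ 0 (translateBody m s (Δ 0)))
      = MS Δ + (s / (m + 1)) * MV (fun j : Fin m => projBody m (Δ j.succ)) := by
  let S := translateBody m s 0
  let x : Fin (m + 1) → ConvexBody (ℝ × (Fin m → ℝ)) := Function.update Δ 0 S
  have hadd : MS (Function.update Δ 0 (translateBody m s (Δ 0))) = MS x + MS Δ := by
    rw [translateBody_eq_add, MS_add, Function.update_eq_self]
  suffices h : (m + 1 : ℝ) * MS x = s * MV fun j : Fin m => projBody m (Δ j.succ) by
    have hm : (m + 1 : ℝ) ≠ 0 := by positivity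
    rw [hadd, add_comm, div_mul_eq_mul_div, ← h, mul_div_cancel_left₀ _ hm]
  have polMS := (MultilinearMap.ofAdd MS MS_add).sum_powerset_neg_one_pow_card_smul_map_sum
    MS_symm x
  have polMV := (MultilinearMap.ofAdd MV MV_add).sum_powerset_neg_one_pow_card_smul_map_sum
    MV_symm fun j => projBody m (Δ j.succ)
  change ∑ t ∈ Finset.univ.powerset, (-1 : ℤ) ^ t.card • MS (fun _ => ∑ i ∈ t, x i)
    = (Fintype.card (Fin (m + 1))).factorial
      • (-1 : ℤ) ^ Fintype.card (Fin (m + 1)) • MS x at polMS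
  change ∑ t ∈ (Finset.univ : Finset (Fin m)).powerset,
    (-1 : ℤ) ^ t.card • MV (fun _ => ∑ i ∈ t, projBody m (Δ i.succ))
      = (Fintype.card (Fin m)).factorial • (-1 : ℤ) ^ Fintype.card (Fin m)
        • MV (fun j => projBody m (Δ j.succ)) at polMV
  have pair (t : Finset (Fin m)) :
      MS (fun _ => ∑ i ∈ insert 0 (t.map (Fin.succEmb m)), x i)
        = MS (fun _ => ∑ i ∈ t.map (Fin.succEmb m), x i)
          + s * MV (fun _ => ∑ i ∈ t, projBody m (Δ i.succ)) := by
    have hproj : ∑ i ∈ t, projBody m (Δ i.succ) = projBody m (∑ i ∈ t, Δ i.succ) :=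
      (projBody_sum t _).symm
    have hsum : ∑ i ∈ t.map (Fin.succEmb m), x i = ∑ i ∈ t, Δ i.succ := by
      simp [x, Function.update_of_ne]
    have hx : x 0 = S := Function.update_self ..
    rw [Finset.sum_insert (by simp), hsum, hx, ← translateBody_eq_add, MS_diag, MS_diag, hproj,
      MV_diag, shadowVolume_translateBody]
  have hpow : (Finset.univ : Finset (Fin (m + 1))).powerset
      = (insert 0 (Finset.univ.map (Fin.succEmb m))).powerset := by
    congr 1
    ext i
    cases i using Fin.cases <;> simp
  have hmap : (Finset.univ.map (Fin.succEmb m)).powerset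
      = Finset.univ.powerset.map (Finset.mapEmbedding (Fin.succEmb m)).toEmbedding := by
    ext t
    simp [Finset.subset_map_iff, eq_comm]
  rw [hpow, Finset.sum_powerset_insert (by simp), ← Finset.sum_add_distrib,
    hmap, Finset.sum_map] at polMS
  have hterm (t : Finset (Fin m)) :
      (-1 : ℤ) ^ (t.map (Fin.succEmb m)).card • MS (fun _ => ∑ i ∈ t.map (Fin.succEmb m), x i)
        + (-1 : ℤ) ^ (insert 0 (t.map (Fin.succEmb m))).card
          • MS (fun _ => ∑ i ∈ insert 0 (t.map (Fin.succEmb m)), x i)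
      = -s * ((-1 : ℤ) ^ t.card • MV (fun _ => ∑ i ∈ t, projBody m (Δ i.succ))) := by
    rw [pair, Finset.card_insert_of_notMem (by simp), Finset.card_map]
    simp only [zsmul_eq_mul]
    push_cast
    ring
  have key := polMS.symm.trans (Finset.sum_congr rfl fun t _ => hterm t)
  rw [← Finset.mul_sum, polMV] at key
  simp only [Fintype.card_fin, zsmul_eq_mul, nsmul_eq_mul, Nat.factorial_succ] at key
  push_cast at key
  have hne : (-1 : ℝ) ^ (m + 1) * (m.factorial : ℝ) ≠ 0 := by positivity
  apply mul_left_cancel₀ hne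
  linear_combination key
end

section
/- Let Δ⁰₀, …, Δ⁰_m and Δ¹₀, …, Δ¹_m be convex bodies in ℝ × ℝ^m such that for every j = 0, …, m one has Δ⁰_j ⊆ Δ¹_j and the images of Δ⁰_j and Δ¹_j under the projection (t, a) ↦ a ∈ ℝ^m coincide. Then MS(Δ⁰₀, …, Δ⁰_m) ≤ MS(Δ¹₀, …, Δ¹_m). (Monotonicity of the mixed shadow volume.) -/
open MeasureTheory

theorem MultilinearMap.sum_neg_one_pow_card_compl_smul_map_sum {R ι M N : Type*} [Semiring R]
    [AddCommMonoid M] [AddCommGroup N] [Module R M] [Module R N] [Fintype ι] [DecidableEq ι]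
    (F : MultilinearMap R (fun _ : ι => M) N) (A : ι → M) :
    ∑ s : Finset ι, (-1 : ℤ) ^ sᶜ.card • F (fun _ => ∑ i ∈ s, A i)
      = ∑ σ : Equiv.Perm ι, F (A ∘ σ) := by
  have h1 : ∀ s : Finset ι, F (fun _ => ∑ i ∈ s, A i)
      = ∑ r : ι → ι, if Finset.univ.image r ⊆ s then F (A ∘ r) else 0 := by
    intro s
    rw [F.map_sum_finset (fun _ i => A i) (fun _ => s), ← Finset.sum_filter]
    refine Finset.sum_congr ?_ fun r _ => rfl
    ext r
    simp [Fintype.mem_piFinset, Finset.image_subset_iff]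
  have h2 : ∀ r : ι → ι,
      ∑ s : Finset ι, (-1 : ℤ) ^ sᶜ.card • (if Finset.univ.image r ⊆ s then F (A ∘ r) else 0)
        = if Function.Bijective r then F (A ∘ r) else 0 := by
    intro r
    have h3 : ∑ s : Finset ι, (if Finset.univ.image r ⊆ s then (-1 : ℤ) ^ sᶜ.card else 0)
        = if (Finset.univ.image r)ᶜ = ∅ then 1 else 0 := by
      rw [← Finset.sum_powerset_neg_one_pow_card, ← Finset.sum_filter]
      refine Finset.sum_nbij' (fun s => sᶜ) (fun s => sᶜ) ?_ ?_ ?_ ?_ ?_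
      · intro s; simp
      · intro s; simp [Finset.subset_compl_comm]
      all_goals simp
    have h4 : ((Finset.univ.image r)ᶜ = ∅) ↔ Function.Bijective r := by
      rw [← Finite.surjective_iff_bijective, Finset.compl_eq_empty_iff,
        Finset.eq_univ_iff_forall]
      simp [Function.Surjective]
    simp only [h4] at h3
    calc _ = (∑ s : Finset ι, (if Finset.univ.image r ⊆ s then (-1 : ℤ) ^ sᶜ.card else 0))
          • F (A ∘ r) := by
          rw [Finset.sum_smul]
          exact Finset.sum_congr rfl fun s _ => by split_ifs <;> simp
      _ = _ := by rw [h3]; split_ifs <;> simp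
  simp_rw [h1, Finset.smul_sum]
  rw [Finset.sum_comm]
  simp_rw [h2]
  rw [← Finset.sum_filter]
  symm
  refine Finset.sum_bij (fun σ _ => (σ : ι → ι)) ?_ ?_ ?_ ?_
  · intro σ _; simp
  · intro σ _ τ _ h; exact DFunLike.coe_injective h
  · intro r hr
    exact ⟨Equiv.ofBijective r (by simpa using hr), Finset.mem_univ _, rfl⟩
  · intro σ _; rfl

/-- A function that is additive in each argument, as a multilinear map over `ℕ`. -/
def MultilinearMap.ofMapUpdateAdd {ι M N : Type*} [dec : DecidableEq ι] [AddCommMonoid M]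
    [AddCommGroup N] (F : (ι → M) → N)
    (hF : ∀ (v : ι → M) (i : ι) (x y : M), F (Function.update v i (x + y))
      = F (Function.update v i x) + F (Function.update v i y)) :
    MultilinearMap ℕ (fun _ : ι => M) N where
  toFun := F
  map_update_add' := by
    intro inst v i x y
    convert hF v i x y
  map_update_smul' := by
    intro inst v i c x
    obtain rfl : inst = dec := Subsingleton.elim _ _
    have h0 : F (Function.update v i 0) = 0 := by simpa using hF v i 0 0
    let φ : M →+ N := ⟨⟨fun x => F (Function.update v i x), h0⟩, hF v i⟩
    exact map_nsmul φ c x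

theorem Finset.sum_finset_fin_succ_of_zero_mem {M : Type*} [AddCommMonoid M] {m : ℕ}
    {G : Finset (Fin (m + 1)) → M} (hG : ∀ s, 0 ∉ s → G s = 0) :
    ∑ s, G s = ∑ s : Finset (Fin m), G (insert 0 (s.map (Fin.succEmb m))) := by
  symm
  refine Finset.sum_of_injOn (fun s => insert 0 (s.map (Fin.succEmb m))) ?_ ?_ ?_ ?_
  · intro s _ t _ h
    ext i
    simpa using congrArg (Fin.succ i ∈ ·) h
  · simp
  · intro s _ hs
    refine hG s fun h0 => hs ⟨s.preimage Fin.succ (Fin.succ_injective m).injOn, by simp, ?_⟩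
    ext i
    refine Fin.cases ?_ (fun i => ?_) i
    · simpa using h0
    · simp
  · intro s _
    rfl

namespace Matrix

variable {n : Type*} [Fintype n] [DecidableEq n]

/-- The determinant whose `j`-th row is the `j`-th row of the `j`-th matrix. -/
noncomputable def detDiagRows (n : Type*) [Fintype n] [DecidableEq n] :
    MultilinearMap ℝ (fun _ : n => Matrix n n ℝ) ℝ :=
  (detRowAlternating (R := ℝ) (n := n)).toMultilinearMap.compLinearMap
    fun j => (LinearMap.proj j : (n → n → ℝ) →ₗ[ℝ] n → ℝ)

theorem detDiagRows_apply (A : n → Matrix n n ℝ) :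
    detDiagRows n A = det (of fun j => A j j) := rfl

theorem detDiagRows_const (A : Matrix n n ℝ) : detDiagRows n (fun _ => A) = det A := rfl

theorem sum_detDiagRows_comp_perm_vecMulVec (v : n → n → ℝ) :
    ∑ σ : Equiv.Perm n, detDiagRows n ((fun i => vecMulVec (v i) (v i)) ∘ σ) = det (of v) ^ 2 := by
  have h : ∀ σ : Equiv.Perm n, detDiagRows n ((fun i => vecMulVec (v i) (v i)) ∘ σ)
      = (Equiv.Perm.sign σ * ∏ j, of v (σ j) j) * det (of v) := by
    intro σ
    rw [detDiagRows_apply]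
    have : (of fun j => ((fun i => vecMulVec (v i) (v i)) ∘ σ) j j)
        = of fun j => v (σ j) j • (of v).submatrix σ id j := by
      ext j k; simp [vecMulVec_apply]
    rw [this]
    have := det_mul_column (fun j => v (σ j) j) ((of v).submatrix σ id)
    simp only [Pi.smul_def, smul_eq_mul]
    rw [this, det_permute]
    simp only [of_apply]
    ring
  simp_rw [h]
  rw [← Finset.sum_mul, ← det_apply', sq]

open scoped MatrixOrder Matrix.Norms.L2Operator in
theorem sum_detDiagRows_comp_perm_nonneg {A : n → Matrix n n ℝ} (hA : ∀ i, (A i).PosSemidef) :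
    0 ≤ ∑ σ : Equiv.Perm n, detDiagRows n (A ∘ σ) := by
  have h : ∀ i, ∃ v : n → n → ℝ, A i = ∑ k, vecMulVec (v k) (v k) := by
    intro i
    obtain ⟨B, hB⟩ := CStarAlgebra.nonneg_iff_eq_star_mul_self.mp (hA i).nonneg
    refine ⟨B, ?_⟩
    ext a b
    simp [hB, mul_apply, vecMulVec_apply, Matrix.sum_apply]
  choose v hv using h
  have h1 : ∀ σ : Equiv.Perm n, detDiagRows n (A ∘ σ)
      = ∑ r : n → n, detDiagRows n ((fun i => vecMulVec (v i (r i)) (v i (r i))) ∘ σ) := by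
    intro σ
    have : A ∘ σ = fun j => ∑ k, vecMulVec (v (σ j) k) (v (σ j) k) := by
      ext1 j; exact hv _
    rw [this, MultilinearMap.map_sum]
    symm
    refine Fintype.sum_equiv (Equiv.arrowCongr σ.symm (Equiv.refl n)) _ _ fun r => ?_
    congr 1
  simp_rw [h1]
  rw [Finset.sum_comm]
  refine Finset.sum_nonneg fun r _ => ?_
  rw [sum_detDiagRows_comp_perm_vecMulVec fun i => v i (r i)]
  exact sq_nonneg _

theorem sum_neg_one_pow_card_compl_mul_det_sum_nonneg {A : n → Matrix n n ℝ}
    (hA : ∀ i, (A i).PosSemidef) :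
    0 ≤ ∑ s : Finset n, (-1 : ℝ) ^ sᶜ.card * det (∑ i ∈ s, A i) := by
  have := sum_detDiagRows_comp_perm_nonneg hA
  rw [← MultilinearMap.sum_neg_one_pow_card_compl_smul_map_sum] at this
  refine this.trans_eq (Finset.sum_congr rfl fun s _ => ?_)
  rw [detDiagRows_const]
  simp

theorem PosSemidef.det_le_det_add {A B : Matrix n n ℝ} (hA : A.PosSemidef) (hB : B.PosSemidef) :
    det A ≤ det (A + B) := by
  have hconst : ∀ C : Matrix n n ℝ, ∑ σ : Equiv.Perm n, detDiagRows n ((fun _ => C) ∘ σ)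
      = Fintype.card (Equiv.Perm n) * det C := by
    intro C
    have : ∀ σ : Equiv.Perm n, (fun _ : n => C) ∘ σ = fun _ => C := fun σ => rfl
    simp [this, detDiagRows_const]
  have key : Fintype.card (Equiv.Perm n) * det A ≤ Fintype.card (Equiv.Perm n) * det (A + B) := by
    rw [← hconst, ← hconst]
    have h : ∀ σ : Equiv.Perm n, detDiagRows n ((fun _ => A + B) ∘ σ)
        = ∑ s : Finset n, detDiagRows n ((s.piecewise (fun _ => A) (fun _ => B)) ∘ σ) := by
      intro σ
      have h2 : (fun _ : n => A + B) ∘ σ = (fun _ : n => A) + fun _ => B := rfl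
      rw [h2, MultilinearMap.map_add_univ]
      symm
      refine Fintype.sum_equiv (Equiv.finsetCongr σ.symm) _ _ fun s => ?_
      congr 1
      ext1 j
      simp [Finset.piecewise]
    simp_rw [h]
    rw [Finset.sum_comm (t := Finset.univ (α := Finset n))]
    refine (le_of_eq ?_).trans (Finset.single_le_sum (f := fun s : Finset n =>
      ∑ σ : Equiv.Perm n, detDiagRows n ((s.piecewise (fun _ => A) (fun _ => B)) ∘ σ))
      (fun s _ => ?_) (Finset.mem_univ Finset.univ))
    · simp
    · refine sum_detDiagRows_comp_perm_nonneg fun i => ?_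
      by_cases hi : i ∈ s <;> simp [hi, hA, hB]
  exact le_of_mul_le_mul_left key (by exact_mod_cast Fintype.card_pos)

end Matrix

section SmoothConvex

open Set Filter Topology Matrix

variable {ι : Type*} [Fintype ι] [DecidableEq ι]

/-- The vector of partial derivatives of a function on `ι → ℝ`. -/
noncomputable def partialDerivs (f : (ι → ℝ) → ℝ) (x : ι → ℝ) : ι → ℝ :=
  fun i => fderiv ℝ f x (Pi.single i 1)

/-- The matrix of second partial derivatives of a function on `ι → ℝ`. -/
noncomputable def hessianMatrix (f : (ι → ℝ) → ℝ) (x : ι → ℝ) : Matrix ι ι ℝ :=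
  LinearMap.toMatrix' (fderiv ℝ (partialDerivs f) x).toLinearMap

theorem fderiv_eq_partialDerivs_dotProduct (f : (ι → ℝ) → ℝ) (x v : ι → ℝ) :
    fderiv ℝ f x v = partialDerivs f x ⬝ᵥ v := by
  conv_lhs => rw [pi_eq_sum_univ' v]
  simp [partialDerivs, dotProduct, mul_comm]

theorem ContDiff.partialDerivs {f : (ι → ℝ) → ℝ} (hf : ContDiff ℝ 2 f) :
    ContDiff ℝ 1 (partialDerivs f) := by
  rw [contDiff_pi]
  intro i
  exact (hf.fderiv_right (m := 1) (by norm_num)).clm_apply contDiff_const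

theorem partialDerivs_add {f g : (ι → ℝ) → ℝ} (hf : Differentiable ℝ f) (hg : Differentiable ℝ g) :
    partialDerivs (f + g) = partialDerivs f + partialDerivs g := by
  ext x i
  simp [partialDerivs, fderiv_add (hf x) (hg x)]

theorem hessianMatrix_add {f g : (ι → ℝ) → ℝ} (hf : ContDiff ℝ 2 f) (hg : ContDiff ℝ 2 g)
    (x : ι → ℝ) : hessianMatrix (f + g) x = hessianMatrix f x + hessianMatrix g x := by
  rw [hessianMatrix, partialDerivs_add (hf.differentiable (by norm_num))
    (hg.differentiable (by norm_num)), fderiv_add (hf.partialDerivs.differentiable (by norm_num) x)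
    (hg.partialDerivs.differentiable (by norm_num) x)]
  ext i j
  simp [hessianMatrix, LinearMap.toMatrix'_apply]

theorem hessianMatrix_zero (x : ι → ℝ) :
    hessianMatrix (0 : (ι → ℝ) → ℝ) x = 0 := by
  have h : partialDerivs (0 : (ι → ℝ) → ℝ) = 0 := by
    ext x i
    simp [partialDerivs]
  ext i j
  simp [hessianMatrix, h, LinearMap.toMatrix'_apply]

theorem hessianMatrix_sum {κ : Type*} (s : Finset κ) {f : κ → (ι → ℝ) → ℝ}
    (hf : ∀ i, ContDiff ℝ 2 (f i)) (x : ι → ℝ) :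
    hessianMatrix (∑ i ∈ s, f i) x = ∑ i ∈ s, hessianMatrix (f i) x := by
  classical
  induction s using Finset.induction_on with
  | empty => simp [hessianMatrix_zero]
  | insert i s hi ih =>
    rw [Finset.sum_insert hi, Finset.sum_insert hi, hessianMatrix_add (hf i) _ x, ih]
    have : (∑ i ∈ s, f i) = fun y => ∑ i ∈ s, f i y := by ext y; simp
    rw [this]
    exact ContDiff.sum fun i _ => hf i

theorem ConvexOn.add_partialDerivs_dotProduct_le {f : (ι → ℝ) → ℝ} (hc : ConvexOn ℝ univ f)
    (hf : Differentiable ℝ f) (x y : ι → ℝ) : f x + partialDerivs f x ⬝ᵥ (y - x) ≤ f y := by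
  have hc' : ConvexOn ℝ univ (f ∘ AffineMap.lineMap (k := ℝ) x y) := by
    simpa using hc.comp_affineMap (AffineMap.lineMap (k := ℝ) x y)
  have hd : HasDerivAt (f ∘ AffineMap.lineMap (k := ℝ) x y) (partialDerivs f x ⬝ᵥ (y - x)) 0 := by
    rw [← fderiv_eq_partialDerivs_dotProduct]
    have h1 : HasDerivAt (AffineMap.lineMap (k := ℝ) x y) (y - x) 0 := AffineMap.hasDerivAt_lineMap
    have h2 : HasFDerivAt f (fderiv ℝ f x) (AffineMap.lineMap (k := ℝ) x y 0) := by
      simpa using (hf x).hasFDerivAt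
    exact h2.comp_hasDerivAt 0 h1
  have := hc'.le_slope_of_hasDerivAt (mem_univ 0) (mem_univ 1) one_pos hd
  simp only [slope_def_field, Function.comp_apply, AffineMap.lineMap_apply_one,
    AffineMap.lineMap_apply_zero, sub_zero, div_one] at this
  linarith

theorem ConvexOn.partialDerivs_eq_iff {f : (ι → ℝ) → ℝ} (hc : ConvexOn ℝ univ f)
    (hf : Differentiable ℝ f) (x a : ι → ℝ) :
    partialDerivs f x = a ↔ ∀ y, f x - a ⬝ᵥ x ≤ f y - a ⬝ᵥ y := by
  constructor
  · rintro rfl y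
    have := hc.add_partialDerivs_dotProduct_le hf x y
    rw [dotProduct_sub] at this
    linarith
  · intro h
    let l : (ι → ℝ) →L[ℝ] ℝ := (dotProductBilin ℝ ℝ a).toContinuousLinearMap
    have hl : ∀ y, l y = a ⬝ᵥ y := fun y => rfl
    have hmin : IsLocalMin (fun y => f y - l y) x := Filter.Eventually.of_forall h
    have h0 := hmin.fderiv_eq_zero
    rw [fderiv_fun_sub (hf x) l.differentiableAt, l.fderiv, sub_eq_zero] at h0
    ext i
    simp [partialDerivs, h0, hl]

theorem ConvexOn.hessianMatrix_posSemidef {f : (ι → ℝ) → ℝ} (hc : ConvexOn ℝ univ f)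
    (hf : ContDiff ℝ 2 f) (x : ι → ℝ) : (hessianMatrix f x).PosSemidef := by
  have hfd : Differentiable ℝ f := hf.differentiable (by norm_num)
  have hgd : Differentiable ℝ (_root_.partialDerivs f) :=
    hf.partialDerivs.differentiable (by norm_num)
  have hmul : ∀ v, hessianMatrix f x *ᵥ v = fderiv ℝ (_root_.partialDerivs f) x v := by
    intro v
    rw [hessianMatrix, ← Matrix.toLin'_apply, Matrix.toLin'_toMatrix']
    rfl
  refine Matrix.PosSemidef.of_dotProduct_mulVec_nonneg ?_ ?_
  · have hsymm : IsSymmSndFDerivAt ℝ f x := hf.contDiffAt.isSymmSndFDerivAt (by simp)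
    have hd : DifferentiableAt ℝ (fderiv ℝ f) x :=
      (hf.fderiv_right (m := 1) (by norm_num)).differentiable (by norm_num) x
    have hent : ∀ i j, hessianMatrix f x i j
        = fderiv ℝ (fderiv ℝ f) x (Pi.single j 1) (Pi.single i 1) := by
      intro i j
      rw [hessianMatrix, LinearMap.toMatrix'_apply]
      let Φ : ((ι → ℝ) →L[ℝ] ℝ) →L[ℝ] (ι → ℝ) :=
        ContinuousLinearMap.pi fun i => ContinuousLinearMap.apply ℝ ℝ (Pi.single i 1)
      have h1 : HasFDerivAt (_root_.partialDerivs f) (Φ ∘L fderiv ℝ (fderiv ℝ f) x) x :=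
        Φ.hasFDerivAt.comp x hd.hasFDerivAt
      rw [h1.fderiv]
      rfl
    ext i j
    rw [Matrix.conjTranspose_apply, hent, hent]
    exact hsymm _ _
  · intro v
    rw [hmul, star_trivial]
    have hd : HasDerivAt (fun t : ℝ => v ⬝ᵥ _root_.partialDerivs f (x + t • v))
        (v ⬝ᵥ fderiv ℝ (_root_.partialDerivs f) x v) 0 := by
      let l : (ι → ℝ) →L[ℝ] ℝ := (dotProductBilin ℝ ℝ v).toContinuousLinearMap
      have h1 : HasDerivAt (fun t : ℝ => x + t • v) v 0 := by
        simpa using ((hasDerivAt_id (0 : ℝ)).smul_const v).const_add x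
      have h2 : HasFDerivAt (_root_.partialDerivs f) (fderiv ℝ (_root_.partialDerivs f) x)
          (x + (0 : ℝ) • v) := by simpa using (hgd x).hasFDerivAt
      have h3 : HasDerivAt (fun t : ℝ => _root_.partialDerivs f (x + t • v))
          (fderiv ℝ (_root_.partialDerivs f) x v) 0 := by
        have h4 := h2.comp_hasDerivAt 0 h1
        exact h4
      exact l.hasFDerivAt.comp_hasDerivAt 0 h3
    rw [← hd.deriv]
    refine Monotone.deriv_nonneg ?_
    intro s t hst
    rcases hst.eq_or_lt with rfl | hst
    · rfl
    have h1 := hc.add_partialDerivs_dotProduct_le hfd (x + s • v) (x + t • v)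
    have h2 := hc.add_partialDerivs_dotProduct_le hfd (x + t • v) (x + s • v)
    have h3 : x + t • v - (x + s • v) = (t - s) • v := by module
    have h4 : x + s • v - (x + t • v) = -((t - s) • v) := by module
    rw [h3, dotProduct_smul, dotProduct_comm] at h1
    rw [h4, dotProduct_neg, dotProduct_smul, dotProduct_comm] at h2
    simp only [smul_eq_mul] at h1 h2
    have : (t - s) * (v ⬝ᵥ _root_.partialDerivs f (x + s • v)) ≤
      (t - s) * (v ⬝ᵥ _root_.partialDerivs f (x + t • v)) := by linarith
    exact le_of_mul_le_mul_left this (by linarith)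

theorem det_fderiv_partialDerivs (f : (ι → ℝ) → ℝ) (x : ι → ℝ) :
    (fderiv ℝ (partialDerivs f) x).det = (hessianMatrix f x).det := by
  rw [hessianMatrix, LinearMap.det_toMatrix', ContinuousLinearMap.det]

theorem ConvexOn.injOn_partialDerivs {f : (ι → ℝ) → ℝ} (hc : ConvexOn ℝ univ f)
    (hf : ContDiff ℝ 2 f) : InjOn (partialDerivs f) {x | (hessianMatrix f x).det ≠ 0} := by
  intro x hx y _ hxy
  by_contra hne
  refine hx ?_
  have hfd : Differentiable ℝ f := hf.differentiable (by norm_num)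
  set a := _root_.partialDerivs f x with ha
  have hmx := (hc.partialDerivs_eq_iff hfd x a).1 rfl
  have hmy := (hc.partialDerivs_eq_iff hfd y a).1 hxy.symm
  have hseg : ∀ t ∈ Icc (0 : ℝ) 1, _root_.partialDerivs f (x + t • (y - x)) = a := by
    intro t ht
    rw [hc.partialDerivs_eq_iff hfd]
    intro z
    have h1 := hc.2 (mem_univ x) (mem_univ y) (sub_nonneg.2 ht.2) ht.1 (by ring)
    have h2 : (1 - t) • x + t • y = x + t • (y - x) := by module
    rw [h2] at h1
    have h3 : a ⬝ᵥ (x + t • (y - x)) = (1 - t) * (a ⬝ᵥ x) + t * (a ⬝ᵥ y) := by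
      rw [dotProduct_add, dotProduct_smul, dotProduct_sub, smul_eq_mul]; ring
    have h4 := hmx z
    have h5 := hmy z
    simp only [smul_eq_mul] at h1
    rw [h3]
    nlinarith [mul_le_mul_of_nonneg_left h4 (sub_nonneg.2 ht.2), mul_le_mul_of_nonneg_left h5 ht.1]
  have hd : HasDerivWithinAt (fun t : ℝ => _root_.partialDerivs f (x + t • (y - x)))
      (fderiv ℝ (_root_.partialDerivs f) x (y - x)) (Icc 0 1) 0 := by
    have h1 : HasDerivAt (fun t : ℝ => x + t • (y - x)) (y - x) 0 := by
      simpa using ((hasDerivAt_id (0 : ℝ)).smul_const (y - x)).const_add x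
    have h2 : HasFDerivAt (_root_.partialDerivs f) (fderiv ℝ (_root_.partialDerivs f) x)
        (x + (0 : ℝ) • (y - x)) := by
      simpa using (hf.partialDerivs.differentiable (by norm_num) x).hasFDerivAt
    exact (h2.comp_hasDerivAt 0 h1).hasDerivWithinAt
  have hd' : HasDerivWithinAt (fun t : ℝ => _root_.partialDerivs f (x + t • (y - x))) 0
      (Icc 0 1) 0 :=
    (hasDerivWithinAt_const (0 : ℝ) (Icc 0 1) a).congr hseg (hseg 0 (by simp))
  have h0 := (uniqueDiffOn_Icc_zero_one 0 (by simp)).eq_deriv _ hd hd'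
  by_contra hdet
  rw [← det_fderiv_partialDerivs] at hdet
  have hinj := ((LinearMap.equivOfDetNeZero
    (fderiv ℝ (_root_.partialDerivs f) x).toLinearMap hdet)).injective
  have : y - x = 0 := hinj (by simpa using h0)
  exact hne (sub_eq_zero.1 this).symm

end SmoothConvex

section ChangeOfVariables

open Set Filter Topology Matrix

variable {ι : Type*} [Fintype ι] [DecidableEq ι]

/-- `f` lies within a bounded distance of the support function of `D`. -/
structure IsNearSupportFunction (f : (ι → ℝ) → ℝ) (D : Set (ι → ℝ)) (C : ℝ) : Prop where
  dotProduct_le : ∀ a ∈ D, ∀ x, a ⬝ᵥ x ≤ f x + C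
  exists_le_dotProduct : ∀ x, ∃ a ∈ D, f x - C ≤ a ⬝ᵥ x

theorem IsNearSupportFunction.partialDerivs_mem {f : (ι → ℝ) → ℝ} {D : Set (ι → ℝ)} {C : ℝ}
    (h : IsNearSupportFunction f D C) (hc : ConvexOn ℝ univ f) (hf : Differentiable ℝ f)
    (hD : Convex ℝ D) (hDc : IsClosed D) (x : ι → ℝ) : partialDerivs f x ∈ D := by
  by_contra hx
  obtain ⟨l, u, hl, hu⟩ := geometric_hahn_banach_closed_point hD hDc hx
  set b := partialDerivs f x
  let v : ι → ℝ := fun i => l (Pi.single i 1)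
  have hlv : ∀ a, l a = a ⬝ᵥ v := by
    intro a
    conv_lhs => rw [pi_eq_sum_univ' a]
    simp [v, dotProduct]
  rw [hlv] at hu
  have key : ∀ s : ℝ, 0 ≤ s → s * (b ⬝ᵥ v - u) ≤ 2 * C := by
    intro s hs
    have h1 := hc.add_partialDerivs_dotProduct_le hf x (x + s • v)
    obtain ⟨a, ha, hax⟩ := h.exists_le_dotProduct (x + s • v)
    have h2 := h.dotProduct_le a ha x
    have h3 := hl a ha
    rw [hlv] at h3
    rw [add_sub_cancel_left, dotProduct_smul, smul_eq_mul] at h1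
    rw [dotProduct_add, dotProduct_smul, smul_eq_mul] at hax
    have h4 := mul_le_mul_of_nonneg_left h3.le hs
    rw [mul_sub]
    linarith
  have hpos : 0 < b ⬝ᵥ v - u := by linarith
  have h0 := key ((2 * |C| + 1) / (b ⬝ᵥ v - u)) (by positivity)
  rw [div_mul_cancel₀ _ hpos.ne'] at h0
  linarith [le_abs_self C]

theorem IsNearSupportFunction.exists_partialDerivs_eq {f : (ι → ℝ) → ℝ} {D : Set (ι → ℝ)} {C : ℝ}
    (h : IsNearSupportFunction f D C) (hc : ConvexOn ℝ univ f) (hf : Differentiable ℝ f)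
    {a : ι → ℝ} (ha : a ∈ interior D) : ∃ x, partialDerivs f x = a := by
  obtain ⟨r, hr, hball⟩ := Metric.isOpen_iff.1 isOpen_interior a ha
  have hcoer : ∀ x : ι → ℝ, r / 2 * ‖x‖ - C ≤ f x - a ⬝ᵥ x := by
    intro x
    by_cases hx : x = 0
    · have := h.dotProduct_le a (interior_subset ha) x
      simp only [hx, norm_zero, mul_zero, dotProduct_zero] at this ⊢
      linarith
    have hn : 0 < ‖x‖ := norm_pos_iff.2 hx
    have hb : a + (r / 2 / ‖x‖) • x ∈ D := by
      refine interior_subset (hball ?_)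
      rw [Metric.mem_ball, dist_eq_norm, add_sub_cancel_left, norm_smul, Real.norm_eq_abs,
        abs_of_pos (by positivity), div_mul_cancel₀ _ hn.ne']
      linarith
    have h1 := h.dotProduct_le _ hb x
    have h2 : ‖x‖ ^ 2 ≤ x ⬝ᵥ x := by
      rw [← Real.le_sqrt' hn,
        pi_norm_le_iff_of_nonneg (Real.sqrt_nonneg _)]
      intro i
      refine Real.le_sqrt_of_sq_le ?_
      rw [Real.norm_eq_abs, sq_abs, sq]
      exact Finset.single_le_sum (f := fun i => x i * x i) (fun j _ => mul_self_nonneg _)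
        (Finset.mem_univ i)
    rw [add_dotProduct, smul_dotProduct, smul_eq_mul] at h1
    have h3 : r / 2 * ‖x‖ ≤ r / 2 / ‖x‖ * (x ⬝ᵥ x) := by
      calc r / 2 * ‖x‖ = r / 2 / ‖x‖ * ‖x‖ ^ 2 := by field_simp
        _ ≤ _ := by gcongr
    linarith
  have hlim : Tendsto (fun x : ι → ℝ => f x - a ⬝ᵥ x) (cocompact (ι → ℝ)) atTop := by
    refine tendsto_atTop_mono hcoer ?_
    exact tendsto_atTop_add_const_right _ _
      ((tendsto_norm_cocompact_atTop (E := ι → ℝ)).const_mul_atTop (by positivity))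
  obtain ⟨x, hx⟩ := Continuous.exists_forall_le (f := fun x : ι → ℝ => f x - a ⬝ᵥ x)
    (hf.continuous.sub (continuous_const.dotProduct continuous_id)) hlim
  exact ⟨x, (hc.partialDerivs_eq_iff hf x a).2 hx⟩

theorem measurableSet_det_hessianMatrix_ne_zero {f : (ι → ℝ) → ℝ} (hf : ContDiff ℝ 2 f) :
    MeasurableSet {x | (hessianMatrix f x).det ≠ 0} := by
  have h : Continuous fun x => (hessianMatrix f x).det := by
    simp_rw [← det_fderiv_partialDerivs]
    exact ContinuousLinearMap.continuous_det.comp (hf.partialDerivs.continuous_fderiv (by norm_num))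
  exact (isOpen_ne_fun h continuous_const).measurableSet

theorem IsNearSupportFunction.image_partialDerivs_ae_eq {f : (ι → ℝ) → ℝ} {D : Set (ι → ℝ)} {C : ℝ}
    (h : IsNearSupportFunction f D C) (hc : ConvexOn ℝ univ f) (hf : ContDiff ℝ 2 f)
    (hD : Convex ℝ D) (hDc : IsClosed D) :
    partialDerivs f '' {x | (hessianMatrix f x).det ≠ 0} =ᵐ[volume] D := by
  have hfd : Differentiable ℝ f := hf.differentiable (by norm_num)
  have hgd : Differentiable ℝ (partialDerivs f) := hf.partialDerivs.differentiable (by norm_num)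
  have hnull := addHaar_image_eq_zero_of_det_fderivWithin_eq_zero volume
    (s := {x | (hessianMatrix f x).det = 0}) (f := partialDerivs f)
    (f' := fun x => fderiv ℝ (partialDerivs f) x)
    (fun x _ => (hgd x).hasFDerivAt.hasFDerivWithinAt)
    (fun x hx => by rw [det_fderiv_partialDerivs]; exact hx)
  refine (LE.le.eventuallyLE ?_).antisymm ?_
  · rintro _ ⟨x, -, rfl⟩
    exact h.partialDerivs_mem hc hfd hD hDc x
  · refine ae_le_set.2 (measure_mono_null ?_ (measure_union_null hnull (hD.addHaar_frontier volume)))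
    rintro a ⟨haD, ha⟩
    by_cases hai : a ∈ interior D
    · left
      obtain ⟨x, rfl⟩ := h.exists_partialDerivs_eq hc hfd hai
      exact ⟨x, by_contra fun hx => ha ⟨x, hx, rfl⟩, rfl⟩
    · right
      rw [hDc.frontier_eq]
      exact ⟨haD, hai⟩

theorem IsNearSupportFunction.setIntegral_eq {f : (ι → ℝ) → ℝ} {D : Set (ι → ℝ)} {C : ℝ}
    (h : IsNearSupportFunction f D C) (hc : ConvexOn ℝ univ f) (hf : ContDiff ℝ 2 f)
    (hD : Convex ℝ D) (hDc : IsClosed D) (Φ : (ι → ℝ) → ℝ) :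
    ∫ a in D, Φ a = ∫ x, (hessianMatrix f x).det * Φ (partialDerivs f x) := by
  have hgd : Differentiable ℝ (partialDerivs f) := hf.partialDerivs.differentiable (by norm_num)
  rw [← setIntegral_congr_set (h.image_partialDerivs_ae_eq hc hf hD hDc),
    integral_image_eq_integral_abs_det_fderiv_smul volume
      (measurableSet_det_hessianMatrix_ne_zero hf)
      (fun x _ => (hgd x).hasFDerivAt.hasFDerivWithinAt) (hc.injOn_partialDerivs hf),
    ← setIntegral_eq_integral_of_forall_compl_eq_zero (s := {x | (hessianMatrix f x).det ≠ 0})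
      (f := fun x => (hessianMatrix f x).det * Φ (partialDerivs f x))]
  · congr 1
    ext x
    rw [det_fderiv_partialDerivs, abs_of_nonneg (hc.hessianMatrix_posSemidef hf x).det_nonneg,
      smul_eq_mul]
  · intro x hx
    have : (hessianMatrix f x).det = 0 := by simpa using hx
    rw [this, zero_mul]

theorem IsNearSupportFunction.integrableOn_iff {f : (ι → ℝ) → ℝ} {D : Set (ι → ℝ)} {C : ℝ}
    (h : IsNearSupportFunction f D C) (hc : ConvexOn ℝ univ f) (hf : ContDiff ℝ 2 f)
    (hD : Convex ℝ D) (hDc : IsClosed D) (Φ : (ι → ℝ) → ℝ) :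
    IntegrableOn Φ D ↔ Integrable fun x => (hessianMatrix f x).det * Φ (partialDerivs f x) := by
  have hgd : Differentiable ℝ (partialDerivs f) := hf.partialDerivs.differentiable (by norm_num)
  rw [← integrableOn_congr_set_ae (h.image_partialDerivs_ae_eq hc hf hD hDc),
    integrableOn_image_iff_integrableOn_abs_det_fderiv_smul volume
      (measurableSet_det_hessianMatrix_ne_zero hf)
      (fun x _ => (hgd x).hasFDerivAt.hasFDerivWithinAt) (hc.injOn_partialDerivs hf),
    ← integrableOn_iff_integrable_of_support_subset
      (s := {x | (hessianMatrix f x).det ≠ 0})]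
  · refine iff_of_eq ?_
    congr 1
    ext x
    rw [det_fderiv_partialDerivs, abs_of_nonneg (hc.hessianMatrix_posSemidef hf x).det_nonneg,
      smul_eq_mul]
  · intro x hx
    exact left_ne_zero_of_mul hx

end ChangeOfVariables

open Set Convolution in
theorem ConvexOn.exists_contDiff_approx {E : Type*} [NormedAddCommGroup E] [NormedSpace ℝ E]
    [FiniteDimensional ℝ E] {f : E → ℝ} (hc : ConvexOn ℝ univ f)
    (hf : UniformContinuous f) {ε : ℝ} (hε : 0 < ε) :
    ∃ g : E → ℝ, ContDiff ℝ 2 g ∧ ConvexOn ℝ univ g ∧ ∀ x, |g x - f x| ≤ ε := by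
  borelize E
  obtain ⟨δ, hδ, hfδ⟩ := Metric.uniformContinuous_iff.1 hf ε hε
  let φ : ContDiffBump (0 : E) := ⟨δ / 2, δ, by positivity, by linarith⟩
  let μ : Measure E := Measure.addHaar
  let L := ContinuousLinearMap.lsmul ℝ ℝ (E := ℝ)
  have hfl : LocallyIntegrable f μ := hf.continuous.locallyIntegrable
  have hint : ∀ x, Integrable (fun t => φ.normed μ t * f (x - t)) μ := by
    intro x
    refine Continuous.integrable_of_hasCompactSupport ?_ ?_
    · exact φ.continuous_normed.mul (hf.continuous.comp (by fun_prop))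
    · exact φ.hasCompactSupport_normed.mul_right
  refine ⟨φ.normed μ ⋆[L, μ] f, ?_, ⟨convex_univ, ?_⟩, ?_⟩
  · exact φ.hasCompactSupport_normed.contDiff_convolution_left L φ.contDiff_normed hfl
  · intro x _ y _ a b ha hb hab
    change ∫ t, φ.normed μ t * f (a • x + b • y - t) ∂μ
      ≤ a * (∫ t, φ.normed μ t * f (x - t) ∂μ) + b * ∫ t, φ.normed μ t * f (y - t) ∂μ
    rw [← integral_const_mul, ← integral_const_mul, ← integral_add ((hint x).const_mul a)
      ((hint y).const_mul b)]
    refine integral_mono (hint _) (((hint x).const_mul a).add ((hint y).const_mul b)) fun t => ?_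
    have h1 := hc.2 (mem_univ (x - t)) (mem_univ (y - t)) ha hb hab
    have h2 : a • (x - t) + b • (y - t) = a • x + b • y - t := by
      obtain rfl : b = 1 - a := by linarith
      module
    rw [h2] at h1
    have h3 := mul_le_mul_of_nonneg_left h1 (φ.nonneg_normed (μ := μ) t)
    simp only [smul_eq_mul] at h3
    linarith
  · intro x
    rw [← Real.dist_eq]
    exact φ.dist_normed_convolution_le hf.continuous.aestronglyMeasurable fun y hy => (hfδ hy).le

namespace ConvexBody

open Set Filter Topology Matrix Pointwise

variable {m : ℕ}

/-- The image of a convex body in `ℝ × ℝ^m` in `ℝ^m`. -/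
def base (B : ConvexBody (ℝ × (Fin m → ℝ))) : Set (Fin m → ℝ) :=
  Prod.snd '' (B : Set (ℝ × (Fin m → ℝ)))

/-- The largest height at which a convex body in `ℝ × ℝ^m` meets a vertical line. -/
noncomputable def roof (B : ConvexBody (ℝ × (Fin m → ℝ))) (a : Fin m → ℝ) : ℝ :=
  sSup {t : ℝ | (t, a) ∈ B}

theorem shadowVolume_eq (B : ConvexBody (ℝ × (Fin m → ℝ))) :
    shadowVolume m (B : Set (ℝ × (Fin m → ℝ))) = ∫ a in B.base, B.roof a := rfl

theorem base_add (B B' : ConvexBody (ℝ × (Fin m → ℝ))) : (B + B').base = B.base + B'.base := by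
  rw [base, coe_add]
  exact Set.image_add (AddMonoidHom.snd ℝ (Fin m → ℝ))

theorem base_nsmul (N : ℕ) (B : ConvexBody (ℝ × (Fin m → ℝ))) :
    (N • B).base = (N : ℝ) • B.base := by
  have h : N • B = (N : NNReal) • B := (Nat.cast_smul_eq_nsmul NNReal N B).symm
  rw [h, base, coe_smul', base, Set.image_smul_comm]
  · ext; simp [Set.mem_smul_set, NNReal.smul_def]
  · intro p; rfl

theorem isCompact_base (B : ConvexBody (ℝ × (Fin m → ℝ))) : IsCompact B.base :=
  B.isCompact.image continuous_snd

theorem convex_base (B : ConvexBody (ℝ × (Fin m → ℝ))) : Convex ℝ B.base :=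
  B.convex.is_linear_image (LinearMap.snd ℝ ℝ (Fin m → ℝ)).isLinear

theorem exists_abs_fst_le (B : ConvexBody (ℝ × (Fin m → ℝ))) :
    ∃ R : ℝ, 0 ≤ R ∧ ∀ p ∈ B, |p.1| ≤ R := by
  obtain ⟨R, hR, h⟩ := B.isBounded.exists_pos_norm_le
  exact ⟨R, hR.le, fun p hp => (norm_fst_le p).trans (h p hp)⟩

theorem isCompact_setOf_mk_mem (B : ConvexBody (ℝ × (Fin m → ℝ))) (a : Fin m → ℝ) :
    IsCompact {t : ℝ | (t, a) ∈ B} := by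
  refine Metric.isCompact_of_isClosed_isBounded ?_ ?_
  · exact B.isClosed.preimage (Continuous.prodMk_left a)
  · refine (B.isBounded.image_fst).subset ?_
    intro t ht
    exact ⟨(t, a), ht, rfl⟩

theorem le_roof {B : ConvexBody (ℝ × (Fin m → ℝ))} {t : ℝ} {a : Fin m → ℝ} (h : (t, a) ∈ B) :
    t ≤ B.roof a :=
  le_csSup (B.isCompact_setOf_mk_mem a).bddAbove h

theorem roof_mem {B : ConvexBody (ℝ × (Fin m → ℝ))} {a : Fin m → ℝ} (ha : a ∈ B.base) :
    (B.roof a, a) ∈ B := by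
  obtain ⟨⟨t, _⟩, ht, rfl⟩ := ha
  exact (B.isCompact_setOf_mk_mem _).sSup_mem ⟨t, ht⟩

theorem roof_of_notMem {B : ConvexBody (ℝ × (Fin m → ℝ))} {a : Fin m → ℝ} (ha : a ∉ B.base) :
    B.roof a = 0 := by
  have : {t : ℝ | (t, a) ∈ B} = ∅ := by
    ext t
    simp only [mem_ofPred_eq, mem_empty_iff_false, iff_false]
    exact fun h => ha ⟨_, h, rfl⟩
  rw [roof, this, Real.sSup_empty]

theorem measurable_roof (B : ConvexBody (ℝ × (Fin m → ℝ))) : Measurable B.roof := by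
  refine measurable_of_Ici fun c => ?_
  have hcl : IsClosed (Prod.snd '' ((B : Set (ℝ × (Fin m → ℝ))) ∩ {p | c ≤ p.1})) :=
    ((B.isCompact.inter_right (isClosed_le continuous_const continuous_fst)).image
      continuous_snd).isClosed
  have hsup : ∀ a ∈ B.base, c ≤ B.roof a ↔
      a ∈ Prod.snd '' ((B : Set (ℝ × (Fin m → ℝ))) ∩ {p | c ≤ p.1}) := by
    intro a ha
    constructor
    · exact fun h => ⟨_, ⟨roof_mem ha, h⟩, rfl⟩
    · rintro ⟨⟨t, _⟩, ⟨h1, h2⟩, rfl⟩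
      exact le_trans h2 (le_roof h1)
  have : B.roof ⁻¹' Ici c = (Prod.snd '' ((B : Set (ℝ × (Fin m → ℝ))) ∩ {p | c ≤ p.1}))
      ∪ (B.baseᶜ ∩ {_a | c ≤ 0}) := by
    ext a
    by_cases ha : a ∈ B.base
    · simp only [mem_preimage, mem_Ici, hsup a ha, mem_union, mem_inter_iff, mem_compl_iff, ha,
        not_true_eq_false, false_and, or_false]
    · have h2 : a ∉ Prod.snd '' ((B : Set (ℝ × (Fin m → ℝ))) ∩ {p | c ≤ p.1}) :=
        fun h => ha (image_mono inter_subset_left h)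
      simp only [mem_preimage, mem_Ici, roof_of_notMem ha, mem_union, h2, mem_inter_iff,
        mem_compl_iff, ha, not_false_eq_true, true_and, false_or, mem_ofPred_eq]
  rw [this]
  exact hcl.measurableSet.union
    (B.isCompact_base.isClosed.measurableSet.compl.inter (MeasurableSet.const _))

theorem integrableOn_roof (B : ConvexBody (ℝ × (Fin m → ℝ))) : IntegrableOn B.roof B.base := by
  obtain ⟨R, -, hR⟩ := B.exists_abs_fst_le
  refine Measure.integrableOn_of_bounded (M := R) B.isCompact_base.measure_lt_top.ne
    B.measurable_roof.aestronglyMeasurable ?_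
  exact (ae_restrict_iff' B.isCompact_base.isClosed.measurableSet).2
    (Eventually.of_forall fun a ha => hR _ (roof_mem ha))

theorem exists_eq_sSup_image_add_dotProduct (B : ConvexBody (ℝ × (Fin m → ℝ))) (x : Fin m → ℝ) :
    ∃ p ∈ B, p.1 + p.2 ⬝ᵥ x = sSup ((fun p : ℝ × (Fin m → ℝ) => p.1 + p.2 ⬝ᵥ x) '' B) ∧
      ∀ q ∈ B, q.1 + q.2 ⬝ᵥ x ≤ p.1 + p.2 ⬝ᵥ x := by
  have hcont : Continuous fun p : ℝ × (Fin m → ℝ) => p.1 + p.2 ⬝ᵥ x :=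
    continuous_fst.add (continuous_snd.dotProduct continuous_const)
  obtain ⟨p, hp, h1, h2⟩ := B.isCompact.exists_sSup_image_eq_and_ge B.nonempty hcont.continuousOn
  exact ⟨p, hp, h1.symm, h2⟩

/-- The support function of a convex body in `ℝ × ℝ^m`, evaluated at the functionals
`(t, a) ↦ t + a ⬝ᵥ x`. -/
noncomputable def upperSupport : ConvexBody (ℝ × (Fin m → ℝ)) →+ ((Fin m → ℝ) → ℝ) where
  toFun B x := sSup ((fun p : ℝ × (Fin m → ℝ) => p.1 + p.2 ⬝ᵥ x) '' B)
  map_zero' := by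
    ext x
    simp
  map_add' B B' := by
    ext x
    obtain ⟨p, hp, h1, h2⟩ := B.exists_eq_sSup_image_add_dotProduct x
    obtain ⟨p', hp', h1', h2'⟩ := B'.exists_eq_sSup_image_add_dotProduct x
    obtain ⟨q, hq, h3, h4⟩ := (B + B').exists_eq_sSup_image_add_dotProduct x
    rw [Pi.add_apply, ← h1, ← h1', ← h3]
    obtain ⟨r, hr, r', hr', rfl⟩ := hq
    have h5 := h4 (p + p') (Set.add_mem_add hp hp')
    have h6 := h2 r hr
    have h7 := h2' r' hr'
    simp only [Prod.fst_add, Prod.snd_add, add_dotProduct] at h5 ⊢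
    linarith

theorem exists_eq_upperSupport (B : ConvexBody (ℝ × (Fin m → ℝ))) (x : Fin m → ℝ) :
    ∃ p ∈ B, p.1 + p.2 ⬝ᵥ x = upperSupport B x := by
  obtain ⟨p, hp, h, -⟩ := B.exists_eq_sSup_image_add_dotProduct x
  exact ⟨p, hp, h⟩

theorem le_upperSupport {B : ConvexBody (ℝ × (Fin m → ℝ))} {p : ℝ × (Fin m → ℝ)} (hp : p ∈ B)
    (x : Fin m → ℝ) : p.1 + p.2 ⬝ᵥ x ≤ upperSupport B x := by
  obtain ⟨q, hq, h1, h2⟩ := B.exists_eq_sSup_image_add_dotProduct x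
  exact (h2 p hp).trans_eq h1

theorem upperSupport_mono {B B' : ConvexBody (ℝ × (Fin m → ℝ))}
    (h : (B : Set (ℝ × (Fin m → ℝ))) ⊆ B') (x : Fin m → ℝ) :
    upperSupport B x ≤ upperSupport B' x := by
  obtain ⟨p, hp, hpx⟩ := B.exists_eq_upperSupport x
  exact hpx ▸ le_upperSupport (h hp) x

theorem convexOn_upperSupport (B : ConvexBody (ℝ × (Fin m → ℝ))) :
    ConvexOn ℝ univ (upperSupport B) := by
  refine ⟨convex_univ, fun x _ y _ a b ha hb hab => ?_⟩
  obtain ⟨p, hp, hpx⟩ := B.exists_eq_upperSupport (a • x + b • y)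
  have h1 := mul_le_mul_of_nonneg_left (le_upperSupport hp x) ha
  have h2 := mul_le_mul_of_nonneg_left (le_upperSupport hp y) hb
  rw [← hpx, dotProduct_add, dotProduct_smul, dotProduct_smul]
  simp only [smul_eq_mul]
  have h3 : p.1 = a * p.1 + b * p.1 := by rw [← add_mul, hab, one_mul]
  linarith

theorem uniformContinuous_upperSupport (B : ConvexBody (ℝ × (Fin m → ℝ))) :
    UniformContinuous (upperSupport B) := by
  obtain ⟨R, hR, h⟩ := B.isBounded.exists_pos_norm_le
  have hRm : 0 ≤ m * R := by positivity
  refine (LipschitzWith.of_le_add_mul (Real.toNNReal (m * R)) fun x y => ?_).uniformContinuous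
  rw [Real.coe_toNNReal _ hRm]
  obtain ⟨p, hp, hpx⟩ := B.exists_eq_upperSupport x
  have h1 := le_upperSupport hp y
  have h2 : p.2 ⬝ᵥ x - p.2 ⬝ᵥ y ≤ m * R * dist x y := by
    rw [← dotProduct_sub, dotProduct, dist_eq_norm]
    calc ∑ i, p.2 i * (x - y) i ≤ ∑ _i : Fin m, R * ‖x - y‖ := by
          refine Finset.sum_le_sum fun i _ => ?_
          refine (le_abs_self _).trans ?_
          rw [abs_mul]
          exact mul_le_mul (((norm_le_pi_norm p.2 i).trans (norm_snd_le p)).trans (h p hp))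
            (norm_le_pi_norm (x - y) i) (abs_nonneg _) hR.le
      _ = m * R * ‖x - y‖ := by simp [mul_assoc]
  linarith

theorem roof_le_upperSupport_sub {B : ConvexBody (ℝ × (Fin m → ℝ))} {a : Fin m → ℝ}
    (ha : a ∈ B.base) (x : Fin m → ℝ) : B.roof a ≤ upperSupport B x - a ⬝ᵥ x := by
  have := le_upperSupport (roof_mem ha) x
  simp only at this
  linarith

theorem le_roof_of_forall_le_upperSupport_sub {B : ConvexBody (ℝ × (Fin m → ℝ))} {a : Fin m → ℝ}
    (ha : a ∈ B.base) {c : ℝ} (hc : ∀ x, c ≤ upperSupport B x - a ⬝ᵥ x) : c ≤ B.roof a := by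
  by_contra! hlt
  have hca : (c, a) ∉ (B : Set (ℝ × (Fin m → ℝ))) := fun h => hlt.not_ge (le_roof h)
  obtain ⟨l, u, hl, hu⟩ := geometric_hahn_banach_closed_point B.convex B.isClosed hca
  let y : ℝ := l (1, 0)
  let v : Fin m → ℝ := fun i => l (0, Pi.single i 1)
  have hlv : ∀ t b, l (t, b) = t * y + b ⬝ᵥ v := by
    intro t b
    have h1 : (t, b) = t • ((1 : ℝ), (0 : Fin m → ℝ))
        + ∑ i, b i • ((0 : ℝ), (Pi.single i 1 : Fin m → ℝ)) := by
      ext i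
      · simp [Prod.fst_sum]
      · simp [Prod.snd_sum, Finset.sum_apply, Pi.single_apply]
    rw [h1, map_add, map_sum, map_smul]
    simp only [map_smul, smul_eq_mul]
    simp [y, v, dotProduct]
  have h1 := hl _ (roof_mem ha)
  rw [hlv] at h1 hu
  have hy : 0 < y := by
    by_contra! hy
    have := mul_le_mul_of_nonpos_right hlt.le hy
    linarith
  obtain ⟨p, hp, hpx⟩ := B.exists_eq_upperSupport (y⁻¹ • v)
  have h2 := hc (y⁻¹ • v)
  have h3 := hl p hp
  rw [← Prod.mk.eta (p := p), hlv] at h3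
  rw [← hpx, dotProduct_smul, dotProduct_smul] at h2
  simp only [smul_eq_mul] at h2
  have h4 := mul_le_mul_of_nonneg_left h2 hy.le
  have h5 : y * (p.1 + y⁻¹ * p.2 ⬝ᵥ v - y⁻¹ * a ⬝ᵥ v) = p.1 * y + p.2 ⬝ᵥ v - a ⬝ᵥ v := by
    field_simp
  linarith

theorem isNearSupportFunction_base {B : ConvexBody (ℝ × (Fin m → ℝ))} {R δ : ℝ}
    (hR : ∀ p ∈ B, |p.1| ≤ R) {f : (Fin m → ℝ) → ℝ} (hf : ∀ x, |f x - upperSupport B x| ≤ δ) :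
    IsNearSupportFunction f B.base (R + δ) where
  dotProduct_le := by
    rintro _ ⟨p, hp, rfl⟩ x
    have h1 := le_upperSupport hp x
    have h2 := abs_le.1 (hf x)
    have h3 := abs_le.1 (hR p hp)
    linarith
  exists_le_dotProduct x := by
    obtain ⟨p, hp, hpx⟩ := B.exists_eq_upperSupport x
    refine ⟨p.2, ⟨p, hp, rfl⟩, ?_⟩
    have h2 := abs_le.1 (hf x)
    have h3 := abs_le.1 (hR p hp)
    linarith

/-- A `C²` convex function that is uniformly within `δ` of the support function `upperSupport B`. -/
structure IsSmoothApprox (f : (Fin m → ℝ) → ℝ) (B : ConvexBody (ℝ × (Fin m → ℝ))) (δ : ℝ) :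
    Prop where
  contDiff : ContDiff ℝ 2 f
  convexOn : ConvexOn ℝ univ f
  abs_sub_le : ∀ x, |f x - upperSupport B x| ≤ δ

theorem exists_isSmoothApprox (B : ConvexBody (ℝ × (Fin m → ℝ))) {ε : ℝ} (hε : 0 < ε) :
    ∃ f, IsSmoothApprox f B ε := by
  obtain ⟨g, h1, h2, h3⟩ :=
    B.convexOn_upperSupport.exists_contDiff_approx B.uniformContinuous_upperSupport hε
  exact ⟨g, h1, h2, h3⟩

namespace IsSmoothApprox

variable {f f' g : (Fin m → ℝ) → ℝ} {B B' : ConvexBody (ℝ × (Fin m → ℝ))} {δ δ' : ℝ}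

theorem mono (h : IsSmoothApprox f B δ) (hδ : δ ≤ δ') : IsSmoothApprox f B δ' :=
  ⟨h.contDiff, h.convexOn, fun x => (h.abs_sub_le x).trans hδ⟩

theorem zero : IsSmoothApprox (0 : (Fin m → ℝ) → ℝ) 0 0 :=
  ⟨contDiff_const, convexOn_const 0 convex_univ, fun x => by simp⟩

theorem add (h : IsSmoothApprox f B δ) (h' : IsSmoothApprox f' B' δ') :
    IsSmoothApprox (f + f') (B + B') (δ + δ') := by
  refine ⟨h.contDiff.add h'.contDiff, h.convexOn.add h'.convexOn, fun x => ?_⟩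
  rw [map_add, Pi.add_apply, Pi.add_apply, add_sub_add_comm]
  exact (abs_add_le _ _).trans (add_le_add (h.abs_sub_le x) (h'.abs_sub_le x))

theorem sum {κ : Type*} (s : Finset κ) {f : κ → (Fin m → ℝ) → ℝ}
    {B : κ → ConvexBody (ℝ × (Fin m → ℝ))} (h : ∀ i, IsSmoothApprox (f i) (B i) δ) :
    IsSmoothApprox (∑ i ∈ s, f i) (∑ i ∈ s, B i) (s.card * δ) := by
  classical
  induction s using Finset.induction_on with
  | empty => simpa using zero
  | insert i s hi ih =>
    rw [Finset.sum_insert hi, Finset.sum_insert hi, Finset.card_insert_of_notMem hi]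
    refine ((h i).add ih).mono (le_of_eq ?_)
    push_cast
    ring

theorem isNearSupportFunction (h : IsSmoothApprox f B δ) :
    ∃ C, IsNearSupportFunction f B.base C := by
  obtain ⟨R, -, hR⟩ := B.exists_abs_fst_le
  exact ⟨_, isNearSupportFunction_base hR h.abs_sub_le⟩

theorem det_hessianMatrix_nonneg (h : IsSmoothApprox f B δ) (x : Fin m → ℝ) :
    0 ≤ (hessianMatrix f x).det :=
  (h.convexOn.hessianMatrix_posSemidef h.contDiff x).det_nonneg

theorem integrable_det_hessianMatrix (h : IsSmoothApprox f B δ) :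
    Integrable fun x => (hessianMatrix f x).det := by
  obtain ⟨C, hC⟩ := h.isNearSupportFunction
  have := (hC.integrableOn_iff h.convexOn h.contDiff B.convex_base B.isCompact_base.isClosed
    (fun _ => 1)).1 (integrableOn_const B.isCompact_base.measure_lt_top.ne)
  simpa using this

theorem integral_det_hessianMatrix (h : IsSmoothApprox f B δ) :
    ∫ x, (hessianMatrix f x).det = volume.real B.base := by
  obtain ⟨C, hC⟩ := h.isNearSupportFunction
  have := hC.setIntegral_eq h.convexOn h.contDiff B.convex_base B.isCompact_base.isClosed
    (fun _ => 1)
  simpa using this.symm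

theorem integrable_det_hessianMatrix_mul (h : IsSmoothApprox f B δ) {w : (Fin m → ℝ) → ℝ}
    (hw : Continuous w) {C : ℝ} (hC : ∀ x, |w x| ≤ C) :
    Integrable fun x => (hessianMatrix f x).det * w x :=
  h.integrable_det_hessianMatrix.mul_bdd hw.aestronglyMeasurable
    (Eventually.of_forall fun x => hC x)

theorem abs_sub_le_of_base_eq (h : IsSmoothApprox f B δ) (h' : IsSmoothApprox f' B' δ)
    (hB : B.base = B'.base) {R : ℝ} (hR : ∀ p ∈ B, |p.1| ≤ R) (hR' : ∀ p ∈ B', |p.1| ≤ R)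
    (x : Fin m → ℝ) : |f' x - f x| ≤ 2 * R + 2 * δ := by
  have key : ∀ {B B' : ConvexBody (ℝ × (Fin m → ℝ))} (_ : B.base = B'.base)
      (_ : ∀ p ∈ B, |p.1| ≤ R) (_ : ∀ p ∈ B', |p.1| ≤ R),
      upperSupport B' x ≤ upperSupport B x + 2 * R := by
    intro B B' hB hR hR'
    obtain ⟨p, hp, hpx⟩ := B'.exists_eq_upperSupport x
    obtain ⟨q, hq, hqp⟩ : p.2 ∈ B.base := hB ▸ ⟨p, hp, rfl⟩
    have h1 := le_upperSupport hq x
    rw [hqp] at h1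
    have h2 := abs_le.1 (hR q hq)
    have h3 := abs_le.1 (hR' p hp)
    linarith
  have h1 := key hB hR hR'
  have h2 := key hB.symm hR' hR
  have h3 := abs_le.1 (h.abs_sub_le x)
  have h4 := abs_le.1 (h'.abs_sub_le x)
  rw [abs_le]
  constructor <;> linarith

theorem shadowVolume_sub_le (h : IsSmoothApprox f B δ) (h' : IsSmoothApprox f' B' δ)
    (hB : B.base = B'.base) :
    shadowVolume m (B' : Set (ℝ × (Fin m → ℝ))) - shadowVolume m (B : Set (ℝ × (Fin m → ℝ)))
      ≤ ∫ x, (hessianMatrix f x).det * (f' x - f x + 2 * δ) := by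
  obtain ⟨C, hC⟩ := h.isNearSupportFunction
  have hfd : Differentiable ℝ f := h.contDiff.differentiable (by norm_num)
  obtain ⟨R, -, hR⟩ := B.exists_abs_fst_le
  obtain ⟨R', -, hR'⟩ := B'.exists_abs_fst_le
  have hint : IntegrableOn (fun a => B'.roof a - B.roof a) B.base :=
    (hB ▸ B'.integrableOn_roof).sub B.integrableOn_roof
  rw [shadowVolume_eq, shadowVolume_eq, ← hB,
    ← integral_sub (hB ▸ B'.integrableOn_roof) B.integrableOn_roof,
    hC.setIntegral_eq h.convexOn h.contDiff B.convex_base B.isCompact_base.isClosed]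
  refine integral_mono ?_ ?_ fun x => ?_
  · exact (hC.integrableOn_iff h.convexOn h.contDiff B.convex_base B.isCompact_base.isClosed
      (fun a => B'.roof a - B.roof a)).1 hint
  · refine h.integrable_det_hessianMatrix_mul (C := 2 * max R R' + 2 * δ + |2 * δ|)
      ((h'.contDiff.continuous.sub h.contDiff.continuous).add continuous_const) fun x => ?_
    exact (abs_add_le _ _).trans (add_le_add (h.abs_sub_le_of_base_eq h' hB
      (fun p hp => (hR p hp).trans (le_max_left _ _))
      (fun p hp => (hR' p hp).trans (le_max_right _ _)) x) le_rfl)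
  · refine mul_le_mul_of_nonneg_left ?_ (h.det_hessianMatrix_nonneg x)
    have hmem := hC.partialDerivs_mem h.convexOn hfd B.convex_base B.isCompact_base.isClosed x
    have h1 := roof_le_upperSupport_sub (hB ▸ hmem) x
    have h2 := (h.convexOn.partialDerivs_eq_iff hfd x _).1 rfl
    have h3 := le_roof_of_forall_le_upperSupport_sub hmem
      (c := f x - partialDerivs f x ⬝ᵥ x - δ) fun y => by
        have h4 := h2 y
        have h5 := abs_le.1 (h.abs_sub_le y)
        linarith
    have h6 := abs_le.1 (h'.abs_sub_le x)
    linarith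

/-- Increasing one summand `K` of `L + K` to `K'` without changing its base increases the shadow
volume approximately by the integral of `k' - k` against the Monge–Ampère measure of `L`. -/
theorem shadowVolume_add_sub_bounds {k k' : (Fin m → ℝ) → ℝ}
    {L K K' : ConvexBody (ℝ × (Fin m → ℝ))} {η ε R : ℝ} (hg : IsSmoothApprox g L η)
    (hk : IsSmoothApprox k K ε) (hk' : IsSmoothApprox k' K' ε) (hδ : η + ε ≤ δ) (hη : 0 ≤ η)
    (hε : 0 ≤ ε) (hsub : (K : Set (ℝ × (Fin m → ℝ))) ⊆ K') (hbase : K.base = K'.base)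
    (hR : ∀ p ∈ K', |p.1| ≤ R) :
    |(shadowVolume m ((L + K' : ConvexBody _) : Set (ℝ × (Fin m → ℝ)))
        - shadowVolume m ((L + K : ConvexBody _) : Set (ℝ × (Fin m → ℝ))))
      - ∫ x, (hessianMatrix g x).det * (k' x - k x + 2 * δ)|
      ≤ 4 * δ * volume.real (L + K).base
        + (2 * R + 4 * δ) * (volume.real (L + K).base - volume.real L.base) := by
  have hbase' : (L + K).base = (L + K').base := by rw [base_add, base_add, hbase]
  have hf := (hg.add hk).mono hδ
  have hf' := (hg.add hk').mono hδ
  have hu := hk.abs_sub_le_of_base_eq hk' hbase (fun p hp => hR p (hsub hp)) hR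
  have hR0 : 0 ≤ R := by
    obtain ⟨p, hp⟩ := K'.nonempty
    exact (abs_nonneg _).trans (hR p hp)
  have hw0 : ∀ x, 0 ≤ k' x - k x + 2 * δ := fun x => by
    have h1 := upperSupport_mono hsub x
    have h2 := abs_le.1 (hk.abs_sub_le x)
    have h3 := abs_le.1 (hk'.abs_sub_le x)
    linarith
  have hwC : ∀ x, k' x - k x + 2 * δ ≤ 2 * R + 4 * δ := fun x => by
    have h1 := abs_le.1 (hu x)
    linarith
  have hw : Continuous fun x => k' x - k x + 2 * δ :=
    (hk'.contDiff.continuous.sub hk.contDiff.continuous).add continuous_const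
  have hwa : ∀ x, |k' x - k x + 2 * δ| ≤ 2 * R + 4 * δ := fun x => by
    rw [abs_of_nonneg (hw0 x)]; exact hwC x
  have hdet : ∀ {l : (Fin m → ℝ) → ℝ} {M : ConvexBody (ℝ × (Fin m → ℝ))},
      IsSmoothApprox l M ε → ∀ x, (hessianMatrix g x).det ≤ (hessianMatrix (g + l) x).det := by
    intro l M hl x
    rw [hessianMatrix_add hg.contDiff hl.contDiff]
    exact (hg.convexOn.hessianMatrix_posSemidef hg.contDiff x).det_le_det_add
      (hl.convexOn.hessianMatrix_posSemidef hl.contDiff x)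
  have hgw := hg.integrable_det_hessianMatrix_mul hw hwa
  have hV : volume.real L.base ≤ volume.real (L + K).base := by
    rw [← hg.integral_det_hessianMatrix, ← hf.integral_det_hessianMatrix]
    exact integral_mono hg.integrable_det_hessianMatrix hf.integrable_det_hessianMatrix (hdet hk)
  have hupper : shadowVolume m ((L + K' : ConvexBody _) : Set (ℝ × (Fin m → ℝ)))
        - shadowVolume m ((L + K : ConvexBody _) : Set (ℝ × (Fin m → ℝ)))
      ≤ (∫ x, (hessianMatrix g x).det * (k' x - k x + 2 * δ))
        + (2 * R + 4 * δ) * (volume.real (L + K).base - volume.real L.base) := by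
    refine (hf.shadowVolume_sub_le hf' hbase').trans ?_
    have hint : Integrable fun x =>
        (2 * R + 4 * δ) * ((hessianMatrix (g + k) x).det - (hessianMatrix g x).det) :=
      (hf.integrable_det_hessianMatrix.sub hg.integrable_det_hessianMatrix).const_mul _
    rw [← hg.integral_det_hessianMatrix, ← hf.integral_det_hessianMatrix,
      ← integral_sub hf.integrable_det_hessianMatrix hg.integrable_det_hessianMatrix,
      ← integral_const_mul, ← integral_add hgw hint]
    simp only [Pi.add_apply, add_sub_add_left_eq_sub]
    refine integral_mono (hf.integrable_det_hessianMatrix_mul hw hwa) (hgw.add hint)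
      fun x => ?_
    have := mul_le_mul_of_nonneg_left (hwC x) (sub_nonneg.2 (hdet hk x))
    simp only
    linarith
  have hlower : (∫ x, (hessianMatrix g x).det * (k' x - k x + 2 * δ))
        - 4 * δ * volume.real (L + K).base
      ≤ shadowVolume m ((L + K' : ConvexBody _) : Set (ℝ × (Fin m → ℝ)))
        - shadowVolume m ((L + K : ConvexBody _) : Set (ℝ × (Fin m → ℝ))) := by
    have h1 := hf'.shadowVolume_sub_le hf hbase'.symm
    simp only [Pi.add_apply, add_sub_add_left_eq_sub] at h1
    have h2 : ∫ x, (hessianMatrix (g + k') x).det * (k x - k' x + 2 * δ)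
        = 4 * δ * volume.real (L + K).base
          - ∫ x, (hessianMatrix (g + k') x).det * (k' x - k x + 2 * δ) := by
      rw [hbase', ← hf'.integral_det_hessianMatrix, ← integral_const_mul, ← integral_sub
        (hf'.integrable_det_hessianMatrix.const_mul _)
        (hf'.integrable_det_hessianMatrix_mul hw hwa)]
      congr with x
      ring
    have h3 : ∫ x, (hessianMatrix g x).det * (k' x - k x + 2 * δ)
        ≤ ∫ x, (hessianMatrix (g + k') x).det * (k' x - k x + 2 * δ) :=
      integral_mono hgw (hf'.integrable_det_hessianMatrix_mul hw hwa)
        fun x => mul_le_mul_of_nonneg_right (hdet hk' x) (hw0 x)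
    linarith
  have hV0 : 0 ≤ 4 * δ * volume.real (L + K).base :=
    mul_nonneg (by linarith) measureReal_nonneg
  have hV1 : 0 ≤ (2 * R + 4 * δ) * (volume.real (L + K).base - volume.real L.base) :=
    mul_nonneg (by linarith) (by linarith)
  rw [abs_le]
  constructor <;> linarith

end IsSmoothApprox

theorem neg_sum_le_sum_neg_one_pow_mul_shadowVolume {K K' : ConvexBody (ℝ × (Fin m → ℝ))} {R : ℝ}
    (hsub : (K : Set (ℝ × (Fin m → ℝ))) ⊆ K') (hbase : K.base = K'.base)
    (hR : ∀ p ∈ K', |p.1| ≤ R) (L : Fin m → ConvexBody (ℝ × (Fin m → ℝ))) :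
    -(2 * R * ∑ s : Finset (Fin m),
        (volume.real (∑ i ∈ s, L i + K).base - volume.real (∑ i ∈ s, L i).base))
      ≤ ∑ s : Finset (Fin m), (-1 : ℝ) ^ sᶜ.card *
        (shadowVolume m ((∑ i ∈ s, L i + K' : ConvexBody _) : Set (ℝ × (Fin m → ℝ)))
          - shadowVolume m ((∑ i ∈ s, L i + K : ConvexBody _) : Set (ℝ × (Fin m → ℝ)))) := by
  set X := ∑ s : Finset (Fin m), (-1 : ℝ) ^ sᶜ.card *
        (shadowVolume m ((∑ i ∈ s, L i + K' : ConvexBody _) : Set (ℝ × (Fin m → ℝ)))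
          - shadowVolume m ((∑ i ∈ s, L i + K : ConvexBody _) : Set (ℝ × (Fin m → ℝ)))) with hX
  set V : Finset (Fin m) → ℝ := fun s => volume.real (∑ i ∈ s, L i + K).base with hV
  set W : Finset (Fin m) → ℝ := fun s => volume.real (∑ i ∈ s, L i).base with hW
  have key : ∀ δ > 0, -∑ s, (4 * δ * V s + (2 * R + 4 * δ) * (V s - W s)) ≤ X := by
    intro δ hδ
    obtain ⟨ε, hε, hεδ⟩ : ∃ ε > 0, (m + 1) * ε = δ :=
      ⟨δ / (m + 1), by positivity, by field_simp⟩
    choose g hg using fun i => (L i).exists_isSmoothApprox hε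
    obtain ⟨k, hk⟩ := K.exists_isSmoothApprox hε
    obtain ⟨k', hk'⟩ := K'.exists_isSmoothApprox hε
    have hb := fun s : Finset (Fin m) => (IsSmoothApprox.sum s hg).shadowVolume_add_sub_bounds
      (δ := δ) hk hk' (by
        have : (s.card : ℝ) ≤ m := by exact_mod_cast card_finset_fin_le s
        nlinarith) (by positivity) hε.le hsub hbase hR
    have hw : Continuous fun x => k' x - k x + 2 * δ :=
      (hk'.contDiff.continuous.sub hk.contDiff.continuous).add continuous_const
    have hw0 : ∀ x, 0 ≤ k' x - k x + 2 * δ := fun x => by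
      have h1 := upperSupport_mono hsub x
      have h2 := abs_le.1 (hk.abs_sub_le x)
      have h3 := abs_le.1 (hk'.abs_sub_le x)
      nlinarith [mul_nonneg (Nat.cast_nonneg (α := ℝ) m) hε.le]
    have hwa : ∀ x, |k' x - k x + 2 * δ| ≤ 2 * R + 2 * ε + |2 * δ| := fun x =>
      (abs_add_le _ _).trans (add_le_add (hk.abs_sub_le_of_base_eq hk' hbase
        (fun p hp => hR p (hsub hp)) hR x) le_rfl)
    have hpos : 0 ≤ ∑ s : Finset (Fin m), (-1 : ℝ) ^ sᶜ.card *
        ∫ x, (hessianMatrix (∑ i ∈ s, g i) x).det * (k' x - k x + 2 * δ) := by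
      simp_rw [← integral_const_mul]
      rw [← integral_finsetSum _ fun s _ =>
        ((IsSmoothApprox.sum s hg).integrable_det_hessianMatrix_mul hw hwa).const_mul _]
      refine integral_nonneg fun x => ?_
      simp_rw [← mul_assoc, ← Finset.sum_mul, hessianMatrix_sum _ fun i => (hg i).contDiff]
      exact mul_nonneg (Matrix.sum_neg_one_pow_card_compl_mul_det_sum_nonneg fun i =>
        (hg i).convexOn.hessianMatrix_posSemidef (hg i).contDiff x) (hw0 x)
    refine le_trans ?_ (sub_le_self X hpos)
    rw [hX, ← Finset.sum_sub_distrib, ← Finset.sum_neg_distrib]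
    refine Finset.sum_le_sum fun s _ => ?_
    rw [← mul_sub]
    refine (neg_le_neg (hb s)).trans ?_
    refine le_trans (le_of_eq ?_) (neg_abs_le _)
    rw [abs_mul, abs_pow, abs_neg, abs_one, one_pow, one_mul]
  have hlim : Tendsto (fun δ : ℝ => -∑ s, (4 * δ * V s + (2 * R + 4 * δ) * (V s - W s)))
      (𝓝[>] 0) (𝓝 (-∑ s, (4 * 0 * V s + (2 * R + 4 * 0) * (V s - W s)))) := by
    refine Tendsto.mono_left (Continuous.tendsto ?_ 0) nhdsWithin_le_nhds
    fun_prop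
  have := le_of_tendsto hlim (eventually_mem_nhdsWithin.mono fun δ hδ => key δ hδ)
  simpa only [mul_zero, zero_mul, add_zero, zero_add, Finset.mul_sum] using this

theorem exists_tendsto_volume_base_nsmul_add (L K : ConvexBody (ℝ × (Fin m → ℝ))) :
    ∃ e : ℕ → ℝ, Tendsto e atTop (𝓝 0) ∧ ∀ N : ℕ, 0 < N →
      volume.real (N • L + K).base - volume.real (N • L).base ≤ (N : ℝ) ^ m * e N := by
  obtain ⟨R, hR, hK⟩ := K.isCompact_base.isBounded.exists_pos_norm_le
  have hlim : Tendsto (fun N : ℕ => R / N) atTop (𝓝 0) := tendsto_const_div_atTop_nhds_zero_nat R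
  refine ⟨fun N => volume.real (Metric.cthickening (R / N) L.base) - volume.real L.base, ?_, ?_⟩
  · rw [← sub_self (volume.real L.base)]
    exact ((ENNReal.tendsto_toReal L.isCompact_base.measure_lt_top.ne).comp
      ((tendsto_measure_cthickening_of_isCompact L.isCompact_base).comp hlim)).sub_const _
  · intro N hN
    have hN' : (N : ℝ) ≠ 0 := by positivity
    have hscale : ∀ s : Set (Fin m → ℝ), volume.real ((N : ℝ) • s) = (N : ℝ) ^ m * volume.real s := by
      intro s
      rw [measureReal_def, Measure.addHaar_smul, ENNReal.toReal_mul, Module.finrank_fin_fun,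
        ENNReal.toReal_ofReal (abs_nonneg _), abs_of_nonneg (by positivity), measureReal_def]
    rw [mul_sub, ← hscale, ← hscale, base_add, base_nsmul]
    refine sub_le_sub_right (measureReal_mono ?_ ?_) _
    · rintro _ ⟨_, ⟨a, ha, rfl⟩, b, hb, rfl⟩
      refine ⟨a + (N : ℝ)⁻¹ • b, ?_, ?_⟩
      · refine Metric.mem_cthickening_of_dist_le _ a _ _ ha ?_
        rw [dist_self_add_left, norm_smul, norm_inv, Real.norm_natCast, inv_mul_eq_div]
        gcongr
        exact hK b hb
      · simp [smul_smul, hN']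
    · exact (L.isCompact_base.cthickening.smul (N : ℝ)).measure_lt_top.ne

theorem factorial_smul_sub_eq_sum_shadowVolume
    {F : MultilinearMap ℕ (fun _ : Fin (m + 1) => ConvexBody (ℝ × (Fin m → ℝ))) ℝ}
    (hsymm : ∀ Δ (σ : Equiv.Perm (Fin (m + 1))), F (Δ ∘ σ) = F Δ)
    (hdiag : ∀ B : ConvexBody (ℝ × (Fin m → ℝ)),
      F (fun _ => B) = shadowVolume m (B : Set (ℝ × (Fin m → ℝ))))
    (K K' : ConvexBody (ℝ × (Fin m → ℝ))) (L : Fin m → ConvexBody (ℝ × (Fin m → ℝ))) :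
    ((m + 1).factorial : ℝ) * (F (Fin.cons K' L) - F (Fin.cons K L))
      = ∑ s : Finset (Fin m), (-1 : ℝ) ^ sᶜ.card *
        (shadowVolume m ((∑ i ∈ s, L i + K' : ConvexBody _) : Set (ℝ × (Fin m → ℝ)))
          - shadowVolume m ((∑ i ∈ s, L i + K : ConvexBody _) : Set (ℝ × (Fin m → ℝ)))) := by
  have hpol : ∀ M : ConvexBody (ℝ × (Fin m → ℝ)),
      ((m + 1).factorial : ℝ) * F (Fin.cons M L) = ∑ s : Finset (Fin (m + 1)),
        (-1 : ℝ) ^ sᶜ.card * F (fun _ => ∑ i ∈ s, (Fin.cons M L : Fin (m + 1) → _) i) := by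
    intro M
    have := F.sum_neg_one_pow_card_compl_smul_map_sum (Fin.cons M L)
    simp only [hsymm, Finset.sum_const, Finset.card_univ, Fintype.card_perm, Fintype.card_fin,
      zsmul_eq_mul, nsmul_eq_mul] at this
    push_cast at this
    exact this.symm
  have hsum : ∀ (M : ConvexBody (ℝ × (Fin m → ℝ))) (s : Finset (Fin m)),
      ∑ i ∈ insert 0 (s.map (Fin.succEmb m)), (Fin.cons M L : Fin (m + 1) → _) i
        = ∑ i ∈ s, L i + M := by
    intro M s
    rw [Finset.sum_insert (by simp [Fin.succ_ne_zero]), Finset.sum_map, add_comm (∑ i ∈ s, L i)]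
    simp
  rw [mul_sub, hpol, hpol, ← Finset.sum_sub_distrib, Finset.sum_finset_fin_succ_of_zero_mem]
  · refine Finset.sum_congr rfl fun s _ => ?_
    have hcard : (insert 0 (s.map (Fin.succEmb m)))ᶜ.card = sᶜ.card := by
      rw [Finset.card_compl, Finset.card_compl,
        Finset.card_insert_of_notMem (by simp [Fin.succ_ne_zero]), Finset.card_map,
        Fintype.card_fin, Fintype.card_fin]
      omega
    rw [hsum, hsum, hdiag, hdiag, hcard, mul_sub]
  · intro s hs
    rw [sub_eq_zero]
    congr 2 with _ : 1
    refine Finset.sum_congr rfl fun i hi => ?_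
    obtain ⟨j, rfl⟩ := Fin.exists_succ_eq_of_ne_zero (x := i) (fun h => hs (h ▸ hi))
    simp

theorem map_cons_le_map_cons
    {F : MultilinearMap ℕ (fun _ : Fin (m + 1) => ConvexBody (ℝ × (Fin m → ℝ))) ℝ}
    (hsymm : ∀ Δ (σ : Equiv.Perm (Fin (m + 1))), F (Δ ∘ σ) = F Δ)
    (hdiag : ∀ B : ConvexBody (ℝ × (Fin m → ℝ)),
      F (fun _ => B) = shadowVolume m (B : Set (ℝ × (Fin m → ℝ))))
    {K K' : ConvexBody (ℝ × (Fin m → ℝ))} (hsub : (K : Set (ℝ × (Fin m → ℝ))) ⊆ K')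
    (hbase : K.base = K'.base) (L : Fin m → ConvexBody (ℝ × (Fin m → ℝ))) :
    F (Fin.cons K L) ≤ F (Fin.cons K' L) := by
  obtain ⟨R, hR0, hR⟩ := K'.exists_abs_fst_le
  choose e he0 he using fun s : Finset (Fin m) =>
    exists_tendsto_volume_base_nsmul_add (∑ i ∈ s, L i) K
  have hscale : ∀ (N : ℕ) M, F (Fin.cons M fun i => N • L i) = (N : ℝ) ^ m * F (Fin.cons M L) := by
    intro N M
    have h1 : (Fin.cons M fun i => N • L i : Fin (m + 1) → ConvexBody (ℝ × (Fin m → ℝ)))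
        = fun i => (Fin.cons 1 fun _ => N : Fin (m + 1) → ℕ) i
          • (Fin.cons M L : Fin (m + 1) → ConvexBody (ℝ × (Fin m → ℝ))) i := by
      ext1 i
      refine Fin.cases (one_nsmul M).symm (fun i => ?_) i
      simp
    rw [h1, F.map_smul_univ, Fin.prod_cons]
    simp
  have key : ∀ N : ℕ, 0 < N → -(2 * R * ∑ s, e s N)
      ≤ ((m + 1).factorial : ℝ) * (F (Fin.cons K' L) - F (Fin.cons K L)) := by
    intro N hN
    have h1 := neg_sum_le_sum_neg_one_pow_mul_shadowVolume hsub hbase hR fun i => N • L i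
    rw [← factorial_smul_sub_eq_sum_shadowVolume hsymm hdiag, hscale, hscale] at h1
    simp_rw [← Finset.smul_sum] at h1
    have h2 := mul_le_mul_of_nonneg_left
      (Finset.sum_le_sum fun s (_ : s ∈ Finset.univ) => he s N hN) (mul_nonneg zero_le_two hR0)
    rw [← Finset.mul_sum] at h2
    have hNm : (0 : ℝ) < (N : ℝ) ^ m := by positivity
    refine le_of_mul_le_mul_left ?_ hNm
    linarith
  have hlim : Tendsto (fun N => -(2 * R * ∑ s, e s N)) atTop (𝓝 0) := by
    have := ((tendsto_finsetSum Finset.univ fun s _ => he0 s).const_mul (2 * R)).neg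
    simpa using this
  have h0 := le_of_tendsto hlim ((eventually_gt_atTop 0).mono key)
  exact sub_nonneg.1 (nonneg_of_mul_nonneg_right h0 (by positivity))

theorem map_update_le_map_update
    {F : MultilinearMap ℕ (fun _ : Fin (m + 1) => ConvexBody (ℝ × (Fin m → ℝ))) ℝ}
    (hsymm : ∀ Δ (σ : Equiv.Perm (Fin (m + 1))), F (Δ ∘ σ) = F Δ)
    (hdiag : ∀ B : ConvexBody (ℝ × (Fin m → ℝ)),
      F (fun _ => B) = shadowVolume m (B : Set (ℝ × (Fin m → ℝ))))
    {K K' : ConvexBody (ℝ × (Fin m → ℝ))} (hsub : (K : Set (ℝ × (Fin m → ℝ))) ⊆ K')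
    (hbase : K.base = K'.base) (Δ : Fin (m + 1) → ConvexBody (ℝ × (Fin m → ℝ)))
    (j : Fin (m + 1)) :
    F (Function.update Δ j K) ≤ F (Function.update Δ j K') := by
  have h : ∀ M, F (Function.update Δ j M) = F (Fin.cons M (Fin.tail (Δ ∘ Equiv.swap 0 j))) := by
    intro M
    rw [← hsymm _ (Equiv.swap 0 j), Function.update_comp_equiv, Equiv.symm_swap,
      Equiv.swap_apply_right, ← Fin.cons_self_tail (Δ ∘ Equiv.swap 0 j), Fin.update_cons_zero,
      Fin.tail_cons]
  rw [h, h]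
  exact map_cons_le_map_cons hsymm hdiag hsub hbase _

end ConvexBody

/-- Monotonicity of the mixed shadow volume: if `Δ⁰_j ⊆ Δ¹_j` and the projections of `Δ⁰_j`
and `Δ¹_j` to `ℝ^m` coincide for every `j`, then `MS(Δ⁰₀,…,Δ⁰_m) ≤ MS(Δ¹₀,…,Δ¹_m)`. -/
theorem mixed_shadow_volume_monotone (m : ℕ)
    (MS : (Fin (m + 1) → ConvexBody (ℝ × (Fin m → ℝ))) → ℝ)
    (MS_symm : ∀ (Δ : Fin (m + 1) → ConvexBody (ℝ × (Fin m → ℝ)))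
      (σ : Equiv.Perm (Fin (m + 1))), MS (Δ ∘ σ) = MS Δ)
    (MS_add : ∀ (Δ : Fin (m + 1) → ConvexBody (ℝ × (Fin m → ℝ))) (i : Fin (m + 1))
      (K K' : ConvexBody (ℝ × (Fin m → ℝ))),
      MS (Function.update Δ i (K + K'))
        = MS (Function.update Δ i K) + MS (Function.update Δ i K'))
    (MS_diag : ∀ B : ConvexBody (ℝ × (Fin m → ℝ)),
      MS (fun _ => B) = shadowVolume m (B : Set (ℝ × (Fin m → ℝ))))
    (Δ₀ Δ₁ : Fin (m + 1) → ConvexBody (ℝ × (Fin m → ℝ)))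
    (hsub : ∀ j, (Δ₀ j : Set (ℝ × (Fin m → ℝ))) ⊆ (Δ₁ j : Set (ℝ × (Fin m → ℝ))))
    (hproj : ∀ j, Prod.snd '' (Δ₀ j : Set (ℝ × (Fin m → ℝ)))
      = Prod.snd '' (Δ₁ j : Set (ℝ × (Fin m → ℝ)))) :
    MS Δ₀ ≤ MS Δ₁ := by
  have h : ∀ s : Finset (Fin (m + 1)), MS Δ₀ ≤ MS (s.piecewise Δ₁ Δ₀) := by
    intro s
    induction s using Finset.induction_on with
    | empty => simp
    | insert j s hj ih =>
      rw [Finset.piecewise_insert]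
      refine ih.trans ?_
      conv_lhs => rw [← Function.update_eq_self j (s.piecewise Δ₁ Δ₀),
        Finset.piecewise_eq_of_notMem _ _ _ hj]
      exact ConvexBody.map_update_le_map_update (F := .ofMapUpdateAdd MS MS_add) MS_symm MS_diag
        (hsub j) (hproj j) _ j
  simpa using h Finset.univ
end

section
/- Let Δ₁, …, Δ_m ⊂ ℝ^m be bounded convex polytopes (convex hulls of finite sets). Then MV(Δ₁, …, Δ_m) = 0 if and only if there exist indices 1 ≤ i₁ < … < i_J ≤ m such that dim(Δ_{i₁} + … + Δ_{i_J}) < J, where the sum is the Minkowski sum. -/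
open MeasureTheory Pointwise

section Polarization

variable {n : Type*} [Fintype n] [DecidableEq n]

/-- Inclusion–exclusion over the set of values of a self-map detects surjectivity. -/
theorem sum_neg_one_pow_card_compl_of_range_subset (r : n → n) :
    ∑ I : Finset n, (if ∀ k, r k ∈ I then (-1 : ℝ) ^ Iᶜ.card else 0) =
      if Function.Surjective r then 1 else 0 := by
  rw [← Finset.sum_filter]
  have key : ∑ J ∈ (Finset.univ.image r)ᶜ.powerset, (-1 : ℝ) ^ J.card =
      if Function.Surjective r then 1 else 0 := by
    have h := congrArg (Int.cast : ℤ → ℝ)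
      (Finset.sum_powerset_neg_one_pow_card (x := (Finset.univ.image r)ᶜ))
    push_cast at h
    rw [h]
    have : (Finset.univ.image r)ᶜ = ∅ ↔ Function.Surjective r := by
      simp [Finset.eq_univ_iff_forall, Function.Surjective]
    simp only [this]
  rw [← key]
  refine Finset.sum_bij' (fun I _ => Iᶜ) (fun J _ => Jᶜ) ?_ ?_ ?_ ?_ ?_
  · intro I hI
    simp only [Finset.mem_filter, Finset.mem_univ, true_and] at hI
    simp only [Finset.mem_powerset, Finset.compl_subset_compl]
    intro y hy
    obtain ⟨k, -, rfl⟩ := Finset.mem_image.1 hy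
    exact hI k
  · intro J hJ
    simp only [Finset.mem_filter, Finset.mem_univ, true_and, Finset.mem_compl]
    intro k hk
    have := Finset.mem_powerset.1 hJ hk
    simp at this
  · intro I _
    simp
  · intro J _
    simp
  · intro I _
    rfl

/-- Polarization: the alternating sum of a multilinear map over partial sums of its arguments
is the sum of its values over all permutations. -/
theorem MultilinearMap.sum_neg_one_pow_mul_map_sum {R M : Type*} [CommSemiring R]
    [AddCommMonoid M] [Module R M] [Module R ℝ]
    (f : MultilinearMap R (fun _ : n => M) ℝ) (x : n → n → M) :
    ∑ I : Finset n, (-1 : ℝ) ^ Iᶜ.card * f (fun r => ∑ i ∈ I, x r i) =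
      ∑ σ : Equiv.Perm n, f (fun r => x r (σ r)) := by
  have expand : ∀ I : Finset n, (-1 : ℝ) ^ Iᶜ.card * f (fun r => ∑ i ∈ I, x r i) =
      ∑ r : n → n, (if ∀ k, r k ∈ I then (-1 : ℝ) ^ Iᶜ.card else 0) * f (fun k => x k (r k)) := by
    intro I
    rw [f.map_sum_finset x (fun _ => I), Finset.mul_sum]
    simp only [ite_mul, zero_mul]
    rw [← Finset.sum_filter]
    refine Finset.sum_congr ?_ fun _ _ => rfl
    ext r
    simp
  simp_rw [expand]
  rw [Finset.sum_comm]
  simp_rw [← Finset.sum_mul, sum_neg_one_pow_card_compl_of_range_subset, ite_mul, zero_mul, one_mul]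
  rw [← Finset.sum_filter]
  symm
  refine Finset.sum_bij (fun σ _ => (σ : n → n)) ?_ ?_ ?_ ?_
  · intro σ _
    rw [Finset.mem_filter]
    exact ⟨Finset.mem_univ _, σ.surjective⟩
  · intro σ _ τ _ h
    exact DFunLike.coe_injective h
  · intro r hr
    have hs : Function.Surjective r := by simpa using hr
    exact ⟨Equiv.ofBijective r (Finite.surjective_iff_bijective.1 hs), Finset.mem_univ _, rfl⟩
  · intro σ _
    rfl

/-- The mixed discriminant of matrices that are combinations of rank-one squares
is the corresponding combination of squared determinants. -/
theorem sum_perm_det_sum_smul_vecMulVec {κ : Type*} (A : n → Finset κ) (w : n → κ → ℝ)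
    (u : κ → n → ℝ) :
    ∑ σ : Equiv.Perm n,
        (Matrix.of fun r => (∑ k ∈ A (σ r), w (σ r) k • Matrix.vecMulVec (u k) (u k)) r).det =
      ∑ c ∈ Fintype.piFinset A, (∏ i, w i (c i)) * (Matrix.of fun i => u (c i)).det ^ 2 := by
  have expand : ∀ σ : Equiv.Perm n,
      (Matrix.of fun r => (∑ k ∈ A (σ r), w (σ r) k • Matrix.vecMulVec (u k) (u k)) r).det =
      ∑ c ∈ Fintype.piFinset A, (∏ i, w i (c i)) * (Matrix.of fun i => u (c i)).det *
        (((Equiv.Perm.sign σ : ℤ) : ℝ) * ∏ r, (Matrix.of fun i => u (c i)) (σ r) r) := by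
    intro σ
    have h1 : (Matrix.of fun r => (∑ k ∈ A (σ r), w (σ r) k • Matrix.vecMulVec (u k) (u k)) r) =
        (fun r => ∑ k ∈ A (σ r), (w (σ r) k * u k r) • u k) := by
      ext r s
      simp [Matrix.sum_apply, Matrix.vecMulVec_apply, mul_assoc]
    have h2 := (Matrix.detRowAlternating (n := n) (R := ℝ)).toMultilinearMap.map_sum_finset
      (fun r k => (w (σ r) k * u k r) • u k) (fun r => A (σ r))
    rw [h1]
    refine h2.trans ?_
    refine Finset.sum_bij' (fun c _ => fun i => c (σ.symm i)) (fun c _ => fun i => c (σ i))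
      ?_ ?_ ?_ ?_ ?_
    · intro c hc
      rw [Fintype.mem_piFinset] at hc ⊢
      intro i
      simpa using hc (σ.symm i)
    · intro c hc
      rw [Fintype.mem_piFinset] at hc ⊢
      intro i
      exact hc (σ i)
    · intro c _
      simp
    · intro c _
      simp
    · intro c _
      rw [MultilinearMap.map_smul_univ]
      have h3 : (Matrix.of fun r => u (c r)).det =
          ((Equiv.Perm.sign σ : ℤ) : ℝ) * (Matrix.of fun i => u (c (σ.symm i))).det := by
        rw [← Matrix.det_permute]
        congr 1
        ext i j
        simp
      have h4 : ∏ i, w i (c (σ.symm i)) = ∏ r, w (σ r) (c r) := by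
        rw [← Equiv.prod_comp σ]
        simp
      have h5 : Matrix.detRowAlternating.toMultilinearMap (fun i => u (c i)) =
        (Matrix.of fun r => u (c r)).det := rfl
      rw [h5, h3, h4, Finset.prod_mul_distrib]
      simp only [Matrix.of_apply, Equiv.symm_apply_apply, smul_eq_mul]
      ring
  simp_rw [expand]
  rw [Finset.sum_comm]
  refine Finset.sum_congr rfl fun c _ => ?_
  rw [← Finset.mul_sum, ← Matrix.det_apply']
  ring

end Polarization

/-- **Rado's theorem** for vector spaces: a family of finite sets of vectors has a linearly
independent transversal as soon as any `k` of the sets together span a space of dimension `≥ k`. -/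
theorem exists_linearIndependent_transversal {n K V : Type*} [Fintype n] [DecidableEq n]
    [Field K] [AddCommGroup V] [Module K V] [DecidableEq V] (D : n → Finset V)
    (h : ∀ J : Finset n, J.card ≤ Module.finrank K (Submodule.span K (J.biUnion D : Set V))) :
    ∃ v : n → V, (∀ i, v i ∈ D i) ∧ LinearIndependent K v := by
  induction hN : ∑ i, (D i).card using Nat.strong_induction_on generalizing D with
  | _ N ih =>
  by_cases hD : ∃ i, ∃ a ∈ D i, ∃ b ∈ D i, a ≠ b
  · obtain ⟨i, a, ha, b, hb, hab⟩ := hD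
    let D' : V → n → Finset V := fun c => Function.update D i ((D i).erase c)
    have hD'sub : ∀ c j, D' c j ⊆ D j := by
      intro c j
      by_cases hj : j = i
      · subst hj
        simp [D', Finset.erase_subset]
      · simp [D', hj]
    have step : ∀ c ∈ D i,
        (∀ J : Finset n, J.card ≤ Module.finrank K (Submodule.span K (J.biUnion (D' c) : Set V))) →
        ∃ v : n → V, (∀ i, v i ∈ D i) ∧ LinearIndependent K v := by
      intro c hc hJ
      have hlt : ∑ j, (D' c j).card < N := by
        rw [← hN]
        refine Finset.sum_lt_sum (fun j _ => Finset.card_le_card (hD'sub c j))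
          ⟨i, Finset.mem_univ _, ?_⟩
        simpa [D'] using Finset.card_erase_lt_of_mem hc
      obtain ⟨v, hv, hli⟩ := ih _ hlt (D' c) hJ rfl
      exact ⟨v, fun j => hD'sub c j (hv j), hli⟩
    by_contra hno
    have hbad : ∀ c ∈ D i, ∃ J : Finset n, i ∈ J ∧
        Module.finrank K (Submodule.span K (J.biUnion (D' c) : Set V)) < J.card := by
      intro c hc
      have h1 := mt (step c hc) hno
      push Not at h1
      obtain ⟨J, hJ⟩ := h1
      refine ⟨J, ?_, hJ⟩
      by_contra hi
      refine absurd (h J) (not_le.2 ?_)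
      have : J.biUnion D = J.biUnion (D' c) := by
        refine Finset.biUnion_congr rfl fun j hj => ?_
        have : j ≠ i := fun hji => hi (hji ▸ hj)
        simp [D', this]
      rwa [this]
    obtain ⟨Ja, hia, hJa⟩ := hbad a ha
    obtain ⟨Jb, hib, hJb⟩ := hbad b hb
    set A := Submodule.span K (Ja.biUnion (D' a) : Set V) with hA
    set B := Submodule.span K (Jb.biUnion (D' b) : Set V) with hB
    have : FiniteDimensional K A := FiniteDimensional.span_finset K _
    have : FiniteDimensional K B := FiniteDimensional.span_finset K _
    have memA : ∀ j ∈ Ja, ∀ x ∈ D j, (j ≠ i ∨ x ≠ a) → x ∈ A := by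
      intro j hj x hx hor
      refine Submodule.subset_span (Finset.mem_coe.2 (Finset.mem_biUnion.2 ⟨j, hj, ?_⟩))
      by_cases hji : j = i
      · subst hji
        have : x ≠ a := by simpa using hor
        simp [D', this, hx]
      · simpa [D', hji] using hx
    have memB : ∀ j ∈ Jb, ∀ x ∈ D j, (j ≠ i ∨ x ≠ b) → x ∈ B := by
      intro j hj x hx hor
      refine Submodule.subset_span (Finset.mem_coe.2 (Finset.mem_biUnion.2 ⟨j, hj, ?_⟩))
      by_cases hji : j = i
      · subst hji
        have : x ≠ b := by simpa using hor
        simp [D', this, hx]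
      · simpa [D', hji] using hx
    have hsup : Submodule.span K ((Ja ∪ Jb).biUnion D : Set V) ≤ A ⊔ B := by
      rw [Submodule.span_le]
      intro x hx
      obtain ⟨j, hj, hx⟩ := Finset.mem_biUnion.1 (Finset.mem_coe.1 hx)
      by_cases hji : j = i
      · subst hji
        by_cases hxa : x = a
        · exact Submodule.mem_sup_right (memB j hib x hx (Or.inr (hxa ▸ hab)))
        · exact Submodule.mem_sup_left (memA j hia x hx (Or.inr hxa))
      · rcases Finset.mem_union.1 hj with hj | hj
        · exact Submodule.mem_sup_left (memA j hj x hx (Or.inl hji))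
        · exact Submodule.mem_sup_right (memB j hj x hx (Or.inl hji))
    have hinf : Submodule.span K (((Ja ∩ Jb).erase i).biUnion D : Set V) ≤ A ⊓ B := by
      rw [Submodule.span_le]
      intro x hx
      obtain ⟨j, hj, hx⟩ := Finset.mem_biUnion.1 (Finset.mem_coe.1 hx)
      obtain ⟨hji, hj⟩ := Finset.mem_erase.1 hj
      obtain ⟨hja, hjb⟩ := Finset.mem_inter.1 hj
      exact ⟨memA j hja x hx (Or.inl hji), memB j hjb x hx (Or.inl hji)⟩
    have h1 := (h (Ja ∪ Jb)).trans (Submodule.finrank_mono hsup)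
    have h2 := (h ((Ja ∩ Jb).erase i)).trans (Submodule.finrank_mono hinf)
    have h3 := Submodule.finrank_sup_add_finrank_inf_eq A B
    have h4 := Finset.card_union_add_card_inter Ja Jb
    have h5 := Finset.card_erase_add_one (Finset.mem_inter.2 ⟨hia, hib⟩)
    omega
  · push Not at hD
    have hne : ∀ i, (D i).Nonempty := by
      intro i
      rw [Finset.nonempty_iff_ne_empty]
      intro he
      have := h {i}
      simp [he] at this
    choose v hv using hne
    refine ⟨v, hv, ?_⟩
    rw [linearIndependent_iff_card_le_finrank_span]
    have : ((Finset.univ.biUnion D : Finset V) : Set V) = Set.range v := by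
      ext x
      simp only [Finset.coe_biUnion, Set.mem_iUnion, Set.mem_range, Finset.mem_coe]
      constructor
      · rintro ⟨i, -, hx⟩
        exact ⟨i, hD i _ (hv i) _ hx⟩
      · rintro ⟨i, rfl⟩
        exact ⟨i, Finset.mem_univ _, hv i⟩
    have h1 := h Finset.univ
    rw [this] at h1
    exact h1

section VectorSpan

variable {V : Type*} [AddCommGroup V] [Module ℝ V]

theorem vectorSpan_add_eq_sup {A B : Set V} (hA : A.Nonempty) (hB : B.Nonempty) :
    vectorSpan ℝ (A + B) = vectorSpan ℝ A ⊔ vectorSpan ℝ B := by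
  apply le_antisymm
  · rw [vectorSpan_def, Submodule.span_le]
    rintro _ ⟨_, ⟨a, ha, b, hb, rfl⟩, _, ⟨a', ha', b', hb', rfl⟩, rfl⟩
    have h : (a + b) -ᵥ (a' + b') = (a -ᵥ a') + (b -ᵥ b') := by
      simp only [vsub_eq_sub]
      abel
    simp only [h]
    exact Submodule.add_mem_sup (vsub_mem_vectorSpan ℝ ha ha') (vsub_mem_vectorSpan ℝ hb hb')
  · obtain ⟨a₀, ha₀⟩ := hA
    obtain ⟨b₀, hb₀⟩ := hB
    refine sup_le ?_ ?_
    · rw [vectorSpan_def, Submodule.span_le]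
      rintro _ ⟨a, ha, a', ha', rfl⟩
      have := vsub_mem_vectorSpan ℝ (Set.add_mem_add ha hb₀) (Set.add_mem_add ha' hb₀)
      simpa using this
    · rw [vectorSpan_def, Submodule.span_le]
      rintro _ ⟨b, hb, b', hb', rfl⟩
      have := vsub_mem_vectorSpan ℝ (Set.add_mem_add ha₀ hb) (Set.add_mem_add ha₀ hb')
      simpa using this

theorem vectorSpan_sum_eq_iSup {ι : Type*} (I : Finset ι) (s : ι → Set V)
    (hs : ∀ i, (s i).Nonempty) :
    vectorSpan ℝ (∑ i ∈ I, s i) = ⨆ i ∈ I, vectorSpan ℝ (s i) := by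
  classical
  induction I using Finset.induction_on with
  | empty => simp [← Set.singleton_zero]
  | insert i I hi ih =>
    have hne : (∑ i ∈ I, s i).Nonempty :=
      ⟨∑ i ∈ I, (hs i).choose, Set.finsetSum_mem_finsetSum _ _ _ fun i _ => (hs i).choose_spec⟩
    rw [Finset.sum_insert hi, vectorSpan_add_eq_sup (hs i) hne, ih, Finset.iSup_insert]

theorem vectorSpan_sum_convexHull [DecidableEq V] {ι : Type*} (I : Finset ι) (S : ι → Finset V)
    (hS : ∀ i, (S i).Nonempty) :
    vectorSpan ℝ (∑ i ∈ I, convexHull ℝ (S i : Set V)) =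
      Submodule.span ℝ (I.biUnion fun i => S i - S i : Finset V) := by
  rw [vectorSpan_sum_eq_iSup _ _ fun i => (hS i).to_set.convexHull]
  simp_rw [← direction_affineSpan, affineSpan_convexHull, direction_affineSpan, vectorSpan_def,
    Finset.coe_biUnion, Submodule.span_iUnion]
  simp only [Finset.coe_sub]
  rfl

theorem convex_sum_convexHull {ι : Type*} (I : Finset ι) (S : ι → Finset V) :
    Convex ℝ (∑ i ∈ I, convexHull ℝ (S i : Set V)) := by
  rw [← convexHull_sum]
  exact convex_convexHull ℝ _

end VectorSpan

section LogSumExp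

open Matrix

variable {n : Type*} [Fintype n]

/-- The log-sum-exp function `x ↦ log ∑ exp ⟨a, x⟩`, a smooth substitute for the support function
of the convex hull of `S`. -/
noncomputable def logSumExp (S : Finset (n → ℝ)) (x : n → ℝ) : ℝ :=
  Real.log (∑ a ∈ S, Real.exp (a ⬝ᵥ x))

/-- The Gibbs weight of `a`, for the probability measure on `S` proportional to `exp ⟨a, x⟩`. -/
noncomputable def gibbsWeight (S : Finset (n → ℝ)) (x a : n → ℝ) : ℝ :=
  Real.exp (a ⬝ᵥ x - logSumExp S x)

/-- The mean of the Gibbs measure: the gradient of `logSumExp S`. -/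
noncomputable def gibbsMean (S : Finset (n → ℝ)) (x : n → ℝ) : n → ℝ :=
  ∑ a ∈ S, gibbsWeight S x a • a

/-- The covariance matrix of the Gibbs measure: the Hessian of `logSumExp S`. -/
noncomputable def gibbsCov (S : Finset (n → ℝ)) (x : n → ℝ) : Matrix n n ℝ :=
  ∑ k ∈ S ×ˢ S, (2⁻¹ * (gibbsWeight S x k.1 * gibbsWeight S x k.2)) •
    vecMulVec (k.1 - k.2) (k.1 - k.2)

variable {S : Finset (n → ℝ)}

theorem gibbsWeight_pos (x a : n → ℝ) : 0 < gibbsWeight S x a :=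
  Real.exp_pos _

theorem sum_exp_pos (hS : S.Nonempty) (x : n → ℝ) : 0 < ∑ a ∈ S, Real.exp (a ⬝ᵥ x) :=
  Finset.sum_pos (fun _ _ => Real.exp_pos _) hS

theorem gibbsWeight_eq_div (hS : S.Nonempty) (x a : n → ℝ) :
    gibbsWeight S x a = Real.exp (a ⬝ᵥ x) / ∑ b ∈ S, Real.exp (b ⬝ᵥ x) := by
  rw [gibbsWeight, Real.exp_sub, logSumExp, Real.exp_log (sum_exp_pos hS x)]

theorem sum_gibbsWeight (hS : S.Nonempty) (x : n → ℝ) : ∑ a ∈ S, gibbsWeight S x a = 1 := by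
  simp_rw [gibbsWeight_eq_div hS]
  rw [← Finset.sum_div, div_self (sum_exp_pos hS x).ne']

theorem gibbsMean_mem_convexHull (hS : S.Nonempty) (x : n → ℝ) :
    gibbsMean S x ∈ convexHull ℝ (S : Set (n → ℝ)) :=
  (convex_convexHull ℝ _).sum_mem (fun a _ => (gibbsWeight_pos x a).le) (sum_gibbsWeight hS x)
    fun _ ha => subset_convexHull ℝ _ ha

theorem dotProduct_le_logSumExp (x : n → ℝ) {q : n → ℝ}
    (hq : q ∈ convexHull ℝ (S : Set (n → ℝ))) : q ⬝ᵥ x ≤ logSumExp S x := by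
  have hconv : Convex ℝ {q : n → ℝ | q ⬝ᵥ x ≤ logSumExp S x} := by
    refine convex_halfSpace_le (f := fun q => q ⬝ᵥ x) ⟨?_, ?_⟩ _
    · intro a b
      exact add_dotProduct _ _ _
    · intro c a
      exact smul_dotProduct _ _ _
  refine convexHull_min ?_ hconv hq
  intro a ha
  change a ⬝ᵥ x ≤ Real.log _
  rw [Real.le_log_iff_exp_le (sum_exp_pos ⟨a, ha⟩ x)]
  exact Finset.single_le_sum (f := fun b => Real.exp (b ⬝ᵥ x)) (fun _ _ => (Real.exp_pos _).le) ha

theorem hasFDerivAt_dotProduct (a x : n → ℝ) :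
    HasFDerivAt (fun y => a ⬝ᵥ y) (dotProductBilin ℝ ℝ a).toContinuousLinearMap x :=
  (dotProductBilin ℝ ℝ a).toContinuousLinearMap.hasFDerivAt

theorem hasFDerivAt_logSumExp (hS : S.Nonempty) (x : n → ℝ) :
    HasFDerivAt (logSumExp S) (dotProductBilin ℝ ℝ (gibbsMean S x)).toContinuousLinearMap x := by
  have h := (HasFDerivAt.fun_sum (u := S) fun a _ => (hasFDerivAt_dotProduct a x).exp).log
    (sum_exp_pos hS x).ne'
  refine h.congr_fderiv ?_
  ext1 y
  simp [gibbsMean, gibbsWeight_eq_div hS, Finset.mul_sum, div_eq_inv_mul,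
    mul_assoc]

theorem continuous_logSumExp (hS : S.Nonempty) : Continuous (logSumExp S) :=
  continuous_iff_continuousAt.2 fun x => (hasFDerivAt_logSumExp hS x).continuousAt

theorem continuous_gibbsWeight (hS : S.Nonempty) (a : n → ℝ) :
    Continuous fun x => gibbsWeight S x a :=
  Real.continuous_exp.comp
    ((continuous_const.dotProduct continuous_id).sub (continuous_logSumExp hS))

theorem gibbsCov_mulVec (x y : n → ℝ) (hS : S.Nonempty) :
    gibbsCov S x *ᵥ y =
      ∑ a ∈ S, (gibbsWeight S x a * (a ⬝ᵥ y - gibbsMean S x ⬝ᵥ y)) • a := by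
  set p := gibbsWeight S x with hp
  have hsum : ∑ a ∈ S, p a = 1 := sum_gibbsWeight hS x
  have hmean : gibbsMean S x ⬝ᵥ y = ∑ a ∈ S, p a * (a ⬝ᵥ y) := by
    simp [gibbsMean, sum_dotProduct, hp]
  have hcov : ∀ f g : (n → ℝ) → ℝ,
      ∑ a ∈ S, ∑ b ∈ S, 2⁻¹ * (p a * p b) * ((f a - f b) * (g a - g b)) =
        ∑ a ∈ S, p a * (f a - ∑ b ∈ S, p b * f b) * g a := by
    intro f g
    have e1 : ∀ a b, 2⁻¹ * (p a * p b) * ((f a - f b) * (g a - g b)) =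
        2⁻¹ * (p a * (f a * g a)) * p b - 2⁻¹ * (p a * f a) * (p b * g b)
          - 2⁻¹ * (p a * g a) * (p b * f b) + 2⁻¹ * p a * (p b * (f b * g b)) := by
      intro a b
      ring
    have e2 : ∀ a, p a * (f a - ∑ b ∈ S, p b * f b) * g a =
        p a * (f a * g a) - p a * g a * ∑ b ∈ S, p b * f b := by
      intro a
      ring
    simp_rw [e1, e2, Finset.sum_add_distrib, Finset.sum_sub_distrib, ← Finset.mul_sum,
      ← Finset.sum_mul, ← Finset.mul_sum, hsum]
    ring
  ext j
  have h := hcov (fun a => a ⬝ᵥ y) (fun a => a j)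
  rw [← Finset.sum_product'] at h
  simp only [gibbsCov, hmean, Matrix.sum_mulVec, Finset.sum_apply, Pi.smul_apply, smul_eq_mul,
    Matrix.smul_mulVec, Matrix.vecMulVec_mulVec, ← hp]
  rw [← h]
  refine Finset.sum_congr rfl fun k _ => ?_
  simp only [sub_dotProduct, Pi.sub_apply, MulOpposite.smul_eq_mul_unop, MulOpposite.unop_op]
  ring

theorem hasFDerivAt_gibbsMean (hS : S.Nonempty) (x : n → ℝ) :
    HasFDerivAt (gibbsMean S) (gibbsCov S x).mulVecLin.toContinuousLinearMap x := by
  have h := HasFDerivAt.fun_sum (u := S) fun a _ =>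
    (((hasFDerivAt_dotProduct a x).sub (hasFDerivAt_logSumExp hS x)).exp).smul_const a
  refine h.congr_fderiv ?_
  ext1 y
  simp [gibbsCov_mulVec x y hS, gibbsWeight]

theorem continuous_gibbsCov (hS : S.Nonempty) : Continuous (gibbsCov S) :=
  continuous_finsetSum _ fun k _ =>
    (continuous_const.mul ((continuous_gibbsWeight hS k.1).mul
      (continuous_gibbsWeight hS k.2))).smul continuous_const

theorem posSemidef_gibbsCov (x : n → ℝ) : (gibbsCov S x).PosSemidef := by
  refine posSemidef_sum _ fun k _ => ?_
  refine PosSemidef.smul ?_ (mul_nonneg (by norm_num)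
    (mul_nonneg (gibbsWeight_pos x k.1).le (gibbsWeight_pos x k.2).le))
  simpa using posSemidef_vecMulVec_self_star (k.1 - k.2)

/-- The gradient of `logSumExp S` is monotone. -/
theorem dotProduct_gibbsMean_sub_nonneg (hS : S.Nonempty) (x y : n → ℝ) :
    0 ≤ (gibbsMean S x - gibbsMean S y) ⬝ᵥ (x - y) ∧
      ((gibbsMean S x - gibbsMean S y) ⬝ᵥ (x - y) = 0 →
        ∀ a ∈ S, a ⬝ᵥ (x - y) = logSumExp S x - logSumExp S y) := by
  set c := logSumExp S x - logSumExp S y with hc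
  have key : (gibbsMean S x - gibbsMean S y) ⬝ᵥ (x - y) =
      ∑ a ∈ S, (gibbsWeight S x a - gibbsWeight S y a) * (a ⬝ᵥ (x - y) - c) := by
    simp_rw [mul_sub, Finset.sum_sub_distrib, ← Finset.sum_mul, Finset.sum_sub_distrib,
      sum_gibbsWeight hS, sub_self, zero_mul, sub_zero]
    simp [gibbsMean, ← Finset.sum_sub_distrib, sum_dotProduct, sub_mul, mul_sub]
  have harg : ∀ a, a ⬝ᵥ (x - y) - c =
      (a ⬝ᵥ x - logSumExp S x) - (a ⬝ᵥ y - logSumExp S y) := by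
    intro a
    rw [dotProduct_sub, hc]
    ring
  have hnonneg : ∀ a ∈ S,
      0 ≤ (gibbsWeight S x a - gibbsWeight S y a) * (a ⬝ᵥ (x - y) - c) := by
    intro a _
    rw [harg]
    rcases le_total (a ⬝ᵥ x - logSumExp S x) (a ⬝ᵥ y - logSumExp S y) with h | h
    · exact mul_nonneg_of_nonpos_of_nonpos (sub_nonpos.2 (Real.exp_le_exp.2 h)) (sub_nonpos.2 h)
    · exact mul_nonneg (sub_nonneg.2 (Real.exp_le_exp.2 h)) (sub_nonneg.2 h)
  rw [key]
  refine ⟨Finset.sum_nonneg hnonneg, fun h0 a ha => ?_⟩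
  rcases mul_eq_zero.1 ((Finset.sum_eq_zero_iff_of_nonneg hnonneg).1 h0 a ha) with h | h
  · have := Real.exp_injective (sub_eq_zero.1 h)
    linarith [harg a]
  · linarith

end LogSumExp

section VolumeFormula

open Matrix

variable {n ι : Type*} [Fintype n] {I : Finset ι} {S : ι → Finset (n → ℝ)}

theorem isCompact_sum_convexHull : IsCompact (∑ i ∈ I, convexHull ℝ (S i : Set (n → ℝ))) := by
  classical
  rw [← convexHull_sum, ← Finset.coe_sum]
  exact (Finset.finite_toSet _).isCompact_convexHull ℝ

theorem sum_gibbsMean_mem (hS : ∀ i, (S i).Nonempty) (x : n → ℝ) :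
    ∑ i ∈ I, gibbsMean (S i) x ∈ ∑ i ∈ I, convexHull ℝ (S i : Set (n → ℝ)) :=
  Set.finsetSum_mem_finsetSum _ _ _ fun i _ => gibbsMean_mem_convexHull (hS i) x

theorem dotProduct_le_sum_logSumExp (x : n → ℝ) {q : n → ℝ}
    (hq : q ∈ ∑ i ∈ I, convexHull ℝ (S i : Set (n → ℝ))) :
    q ⬝ᵥ x ≤ ∑ i ∈ I, logSumExp (S i) x := by
  obtain ⟨f, hf, rfl⟩ := (Set.mem_finsetSum _ _ _).1 hq
  rw [sum_dotProduct]
  exact Finset.sum_le_sum fun i hi => dotProduct_le_logSumExp x (hf hi)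

/-- Every interior point of a sum of polytopes is a gradient of the sum of the
log-sum-exp functions. -/
theorem exists_sum_gibbsMean_eq (hS : ∀ i, (S i).Nonempty) {p : n → ℝ}
    (hp : p ∈ interior (∑ i ∈ I, convexHull ℝ (S i : Set (n → ℝ)))) :
    ∃ x, ∑ i ∈ I, gibbsMean (S i) x = p := by
  classical
  obtain ⟨ε, hε, hball⟩ := Metric.isOpen_iff.1 isOpen_interior p hp
  let F : (n → ℝ) → ℝ := fun x => ∑ i ∈ I, logSumExp (S i) x - p ⬝ᵥ x
  have hF : Continuous F :=
    (continuous_finsetSum _ fun i _ => continuous_logSumExp (hS i)).sub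
      (continuous_const.dotProduct continuous_id)
  have hlow : ∀ x, ε / 2 * ‖x‖ ≤ F x := by
    intro x
    have hdir : ∀ j, ∀ s : ℝ, |s| ≤ 1 → ε / 2 * (s * x j) ≤ F x := by
      intro j s hs
      have hmem : p + Pi.single j (ε / 2 * s) ∈ Metric.ball p ε := by
        rw [mem_ball_iff_norm, add_sub_cancel_left, Pi.norm_single, Real.norm_eq_abs, abs_mul,
          abs_of_pos (half_pos hε)]
        nlinarith
      have h := dotProduct_le_sum_logSumExp x (interior_subset (hball hmem))
      rw [add_dotProduct, single_dotProduct] at h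
      simp only [F]
      linarith
    have hnorm : ‖x‖ ≤ F x / (ε / 2) := by
      have h0 : 0 ≤ F x := by
        have h := dotProduct_le_sum_logSumExp x (interior_subset hp)
        simp only [F]
        linarith
      refine (pi_norm_le_iff_of_nonneg (by positivity)).2 fun j => ?_
      rw [le_div_iff₀ (half_pos hε), mul_comm]
      rcases abs_cases (x j) with ⟨h, -⟩ | ⟨h, -⟩
      · rw [Real.norm_eq_abs, h]
        simpa using hdir j 1 (by simp)
      · rw [Real.norm_eq_abs, h]
        simpa using hdir j (-1) (by simp)
    rwa [le_div_iff₀ (half_pos hε), mul_comm] at hnorm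
  have hlim : Filter.Tendsto F (Filter.cocompact _) Filter.atTop :=
    Filter.tendsto_atTop_mono hlow
      ((tendsto_norm_cocompact_atTop).const_mul_atTop (half_pos hε))
  obtain ⟨x, hx⟩ := hF.exists_forall_le hlim
  refine ⟨x, ?_⟩
  have hder : HasFDerivAt F (∑ i ∈ I, (dotProductBilin ℝ ℝ (gibbsMean (S i) x)).toContinuousLinearMap
      - (dotProductBilin ℝ ℝ p).toContinuousLinearMap) x :=
    (HasFDerivAt.fun_sum fun i _ => hasFDerivAt_logSumExp (hS i) x).sub (hasFDerivAt_dotProduct p x)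
  have hzero := IsLocalMin.hasFDerivAt_eq_zero (Filter.Eventually.of_forall hx) hder
  refine dotProduct_eq _ _ fun y => ?_
  have := DFunLike.congr_fun hzero y
  simpa [sub_eq_zero, sum_dotProduct] using this

theorem hasFDerivAt_sum_gibbsMean (hS : ∀ i, (S i).Nonempty) (x : n → ℝ) :
    HasFDerivAt (fun x => ∑ i ∈ I, gibbsMean (S i) x)
      (∑ i ∈ I, gibbsCov (S i) x).mulVecLin.toContinuousLinearMap x := by
  refine (HasFDerivAt.fun_sum fun i _ => hasFDerivAt_gibbsMean (hS i) x).congr_fderiv ?_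
  ext1 y
  simp

theorem exists_dotProduct_const_of_not_injective (hS : ∀ i, (S i).Nonempty)
    (h : ¬ Function.Injective fun x => ∑ i ∈ I, gibbsMean (S i) x) :
    ∃ z : n → ℝ, z ≠ 0 ∧ ∀ i ∈ I, ∀ a ∈ S i, ∀ b ∈ S i, (a - b) ⬝ᵥ z = 0 := by
  simp only [Function.Injective, not_forall] at h
  obtain ⟨x, y, hxy, hne⟩ := h
  refine ⟨x - y, sub_ne_zero.2 hne, fun i hi a ha b hb => ?_⟩
  have h0 : ∑ i ∈ I, (gibbsMean (S i) x - gibbsMean (S i) y) ⬝ᵥ (x - y) = 0 := by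
    rw [← sum_dotProduct, Finset.sum_sub_distrib, hxy, sub_self, zero_dotProduct]
  have h1 := (Finset.sum_eq_zero_iff_of_nonneg
    fun i _ => (dotProduct_gibbsMean_sub_nonneg (hS i) x y).1).1 h0 i hi
  have h2 := (dotProduct_gibbsMean_sub_nonneg (hS i) x y).2 h1
  rw [sub_dotProduct, h2 a ha, h2 b hb, sub_self]

theorem volume_sum_convexHull_eq_zero (hS : ∀ i, (S i).Nonempty) {z : n → ℝ} (hz : z ≠ 0)
    (h : ∀ i ∈ I, ∀ a ∈ S i, ∀ b ∈ S i, (a - b) ⬝ᵥ z = 0) :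
    volume (∑ i ∈ I, convexHull ℝ (S i : Set (n → ℝ))) = 0 := by
  classical
  set P := ∑ i ∈ I, convexHull ℝ (S i : Set (n → ℝ)) with hP
  refine measure_mono_null (subset_affineSpan ℝ P) (Measure.addHaar_affineSubspace _ _ ?_)
  intro htop
  have hdir : vectorSpan ℝ P = ⊤ := by
    rw [← direction_affineSpan, htop, AffineSubspace.direction_top]
  rw [hP, vectorSpan_sum_convexHull I S hS] at hdir
  have hle : Submodule.span ℝ (I.biUnion fun i => S i - S i : Finset (n → ℝ)) ≤
      LinearMap.ker ((dotProductBilin ℝ ℝ).flip z) := by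
    rw [Submodule.span_le]
    intro v hv
    obtain ⟨i, hi, hv⟩ := Finset.mem_biUnion.1 (Finset.mem_coe.1 hv)
    obtain ⟨a, ha, b, hb, rfl⟩ := Finset.mem_sub.1 hv
    exact h i hi a ha b hb
  rw [hdir] at hle
  have hzz : z ⬝ᵥ z = 0 := hle (Submodule.mem_top (x := z))
  exact hz (dotProduct_self_eq_zero.1 hzz)

variable [DecidableEq n]

theorem det_sum_gibbsCov_eq_zero {z : n → ℝ} (hz : z ≠ 0)
    (h : ∀ i ∈ I, ∀ a ∈ S i, ∀ b ∈ S i, (a - b) ⬝ᵥ z = 0) (x : n → ℝ) :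
    (∑ i ∈ I, gibbsCov (S i) x).det = 0 := by
  refine exists_mulVec_eq_zero_iff.1 ⟨z, hz, ?_⟩
  rw [Matrix.sum_mulVec]
  refine Finset.sum_eq_zero fun i hi => ?_
  rw [gibbsCov, Matrix.sum_mulVec]
  refine Finset.sum_eq_zero fun k hk => ?_
  obtain ⟨ha, hb⟩ := Finset.mem_product.1 hk
  rw [Matrix.smul_mulVec, vecMulVec_mulVec, h i hi _ ha _ hb]
  simp

/-- The volume of a sum of polytopes is the integral of the Hessian determinant of the
corresponding sum of log-sum-exp functions. -/
theorem lintegral_det_sum_gibbsCov (hS : ∀ i, (S i).Nonempty) :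
    ∫⁻ x, ENNReal.ofReal (∑ i ∈ I, gibbsCov (S i) x).det =
      volume (∑ i ∈ I, convexHull ℝ (S i : Set (n → ℝ))) := by
  by_cases hinj : Function.Injective fun x => ∑ i ∈ I, gibbsMean (S i) x
  · have h := lintegral_abs_det_fderiv_eq_addHaar_image volume MeasurableSet.univ
      (fun x _ => (hasFDerivAt_sum_gibbsMean (I := I) hS x).hasFDerivWithinAt) hinj.injOn
    have hdet : ∀ x, |(∑ i ∈ I, gibbsCov (S i) x).mulVecLin.toContinuousLinearMap.det| =
        (∑ i ∈ I, gibbsCov (S i) x).det := by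
      intro x
      have : (∑ i ∈ I, gibbsCov (S i) x).mulVecLin.toContinuousLinearMap.det =
          (∑ i ∈ I, gibbsCov (S i) x).det := LinearMap.det_toLin' _
      rw [this, abs_of_nonneg (posSemidef_sum _ fun i _ => posSemidef_gibbsCov x).det_nonneg]
    simp_rw [hdet, Measure.restrict_univ, Set.image_univ] at h
    rw [h]
    refine le_antisymm (measure_mono ?_) ?_
    · rintro _ ⟨x, rfl⟩
      exact sum_gibbsMean_mem hS x
    · rw [← measure_sdiff_null ((convex_sum_convexHull I S).addHaar_frontier volume)]
      refine measure_mono fun p hp => exists_sum_gibbsMean_eq hS ?_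
      rw [← self_sdiff_frontier]
      exact hp
  · obtain ⟨z, hz, h⟩ := exists_dotProduct_const_of_not_injective hS hinj
    simp [volume_sum_convexHull_eq_zero hS hz h, det_sum_gibbsCov_eq_zero hz h]

theorem continuous_det_sum_gibbsCov (hS : ∀ i, (S i).Nonempty) :
    Continuous fun x => (∑ i ∈ I, gibbsCov (S i) x).det :=
  (continuous_finsetSum _ fun i _ => continuous_gibbsCov (hS i)).matrix_det

theorem integrable_det_sum_gibbsCov (hS : ∀ i, (S i).Nonempty) :
    Integrable fun x => (∑ i ∈ I, gibbsCov (S i) x).det := by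
  refine ⟨(continuous_det_sum_gibbsCov hS).aestronglyMeasurable, ?_⟩
  rw [hasFiniteIntegral_iff_ofReal (Filter.Eventually.of_forall fun x =>
    (posSemidef_sum _ fun i _ => posSemidef_gibbsCov x).det_nonneg), lintegral_det_sum_gibbsCov hS]
  exact isCompact_sum_convexHull.measure_lt_top

theorem integral_det_sum_gibbsCov (hS : ∀ i, (S i).Nonempty) :
    ∫ x, (∑ i ∈ I, gibbsCov (S i) x).det =
      (volume (∑ i ∈ I, convexHull ℝ (S i : Set (n → ℝ)))).toReal := by
  rw [integral_eq_lintegral_of_nonneg_ae (Filter.Eventually.of_forall fun x =>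
    (posSemidef_sum _ fun i _ => posSemidef_gibbsCov x).det_nonneg)
    (continuous_det_sum_gibbsCov hS).aestronglyMeasurable, lintegral_det_sum_gibbsCov hS]

end VolumeFormula

section MixedVolume

variable {n : Type*} [Fintype n] [DecidableEq n]

theorem sum_neg_one_pow_mul_det_sum_gibbsCov (S : n → Finset (n → ℝ)) (x : n → ℝ) :
    ∑ I : Finset n, (-1 : ℝ) ^ Iᶜ.card * (∑ i ∈ I, gibbsCov (S i) x).det =
      ∑ c ∈ Fintype.piFinset fun i => S i ×ˢ S i,
        (∏ i, 2⁻¹ * (gibbsWeight (S i) x (c i).1 * gibbsWeight (S i) x (c i).2)) *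
          (Matrix.of fun i => (c i).1 - (c i).2).det ^ 2 := by
  rw [← sum_perm_det_sum_smul_vecMulVec (fun i => S i ×ˢ S i)
    (fun i k => 2⁻¹ * (gibbsWeight (S i) x k.1 * gibbsWeight (S i) x k.2)) fun k => k.1 - k.2]
  have h := (Matrix.detRowAlternating (n := n) (R := ℝ)).toMultilinearMap.sum_neg_one_pow_mul_map_sum
    fun r i => gibbsCov (S i) x r
  refine Eq.trans (Finset.sum_congr rfl fun I _ => ?_) h
  congr 1
  change Matrix.det _ = Matrix.det _
  congr 1
  ext r s
  simp [Matrix.sum_apply]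

/-- The mixed volume of polytopes, given by polarization of the volume, vanishes iff no choice of
one segment with vertices in each polytope spans a nondegenerate parallelepiped. -/
theorem sum_neg_one_pow_mul_volume_eq_zero_iff (S : n → Finset (n → ℝ))
    (hS : ∀ i, (S i).Nonempty) :
    ∑ I : Finset n, (-1 : ℝ) ^ Iᶜ.card *
        (volume (∑ i ∈ I, convexHull ℝ (S i : Set (n → ℝ)))).toReal = 0 ↔
      ∀ c ∈ Fintype.piFinset fun i => S i ×ˢ S i,
        (Matrix.of fun i => (c i).1 - (c i).2).det = 0 := by
  set D : (n → ℝ) → ℝ := fun x => ∑ c ∈ Fintype.piFinset fun i => S i ×ˢ S i,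
    (∏ i, 2⁻¹ * (gibbsWeight (S i) x (c i).1 * gibbsWeight (S i) x (c i).2)) *
      (Matrix.of fun i => (c i).1 - (c i).2).det ^ 2 with hD
  have hDeq : ∀ x, ∑ I : Finset n, (-1 : ℝ) ^ Iᶜ.card * (∑ i ∈ I, gibbsCov (S i) x).det = D x :=
    sum_neg_one_pow_mul_det_sum_gibbsCov S
  have hint : ∀ I ∈ (Finset.univ : Finset (Finset n)),
      Integrable fun x => (-1 : ℝ) ^ Iᶜ.card * (∑ i ∈ I, gibbsCov (S i) x).det :=
    fun I _ => (integrable_det_sum_gibbsCov hS).const_mul _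
  have hvol : ∑ I : Finset n, (-1 : ℝ) ^ Iᶜ.card *
      (volume (∑ i ∈ I, convexHull ℝ (S i : Set (n → ℝ)))).toReal = ∫ x, D x := by
    simp_rw [← hDeq]
    rw [integral_finsetSum _ hint]
    refine Finset.sum_congr rfl fun I _ => ?_
    rw [integral_const_mul, integral_det_sum_gibbsCov hS]
  have hDint : Integrable D := by
    have h := integrable_finsetSum _ hint
    simpa only [hDeq] using h
  have hw : ∀ x (c : n → (n → ℝ) × (n → ℝ)),
      0 < ∏ i, 2⁻¹ * (gibbsWeight (S i) x (c i).1 * gibbsWeight (S i) x (c i).2) :=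
    fun x c => Finset.prod_pos fun i _ =>
      mul_pos (by norm_num) (mul_pos (gibbsWeight_pos _ _) (gibbsWeight_pos _ _))
  rw [hvol]
  constructor
  · intro h0 c hc
    by_contra hdet
    have hpos : ∀ x, 0 < D x := fun x =>
      Finset.sum_pos' (fun c _ => mul_nonneg (hw x c).le (sq_nonneg _))
        ⟨c, hc, mul_pos (hw x c) (by positivity)⟩
    refine absurd h0 (ne_of_gt ((integral_pos_iff_support_of_nonneg (fun x => (hpos x).le)
      hDint).2 ?_))
    rw [Function.support_eq_univ fun x => (hpos x).ne']
    exact isOpen_univ.measure_pos _ Set.univ_nonempty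
  · intro h
    have hzero : ∀ x, D x = 0 := fun x => Finset.sum_eq_zero fun c hc => by simp [h c hc]
    simp [hzero]

/-- A choice of vertices spanning a nondegenerate parallelepiped exists iff no subfamily
has dimension smaller than its cardinality. -/
theorem forall_det_eq_zero_iff_exists_finrank_lt (S : n → Finset (n → ℝ)) :
    (∀ c ∈ Fintype.piFinset fun i => S i ×ˢ S i,
        (Matrix.of fun i => (c i).1 - (c i).2).det = 0) ↔
      ∃ J : Finset n, Module.finrank ℝ
        (Submodule.span ℝ (J.biUnion fun i => S i - S i : Finset (n → ℝ)) :
          Submodule ℝ (n → ℝ)) < J.card := by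
  have hli : ∀ v : n → n → ℝ, LinearIndependent ℝ v ↔ (Matrix.of v).det ≠ 0 := by
    intro v
    rw [← isUnit_iff_ne_zero, ← Matrix.isUnit_iff_isUnit_det, ← Matrix.linearIndependent_rows_iff_isUnit]
    rfl
  constructor
  · intro h
    by_contra hno
    push Not at hno
    obtain ⟨v, hv, hind⟩ := exists_linearIndependent_transversal (K := ℝ) (fun i => S i - S i) hno
    choose a ha b hb hab using fun i => Finset.mem_sub.1 (hv i)
    refine (hli v).1 hind ?_
    have h1 := h (fun i => (a i, b i)) (by simp [ha, hb])
    simpa only [hab] using h1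
  · rintro ⟨J, hJ⟩ c hc
    by_contra hdet
    refine absurd hJ (not_lt.2 ?_)
    have hind := ((hli fun i => (c i).1 - (c i).2).2 hdet).comp
      (Subtype.val : J → n) Subtype.val_injective
    have hcard := finrank_span_eq_card hind
    rw [Fintype.card_coe] at hcard
    rw [← hcard]
    refine Submodule.finrank_mono (Submodule.span_mono ?_)
    rintro _ ⟨⟨j, hj⟩, rfl⟩
    have hcj := Finset.mem_product.1 (Fintype.mem_piFinset.1 hc j)
    exact Finset.mem_coe.2 (Finset.mem_biUnion.2 ⟨j, hj, Finset.sub_mem_sub hcj.1 hcj.2⟩)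

end MixedVolume

theorem ConvexBody.coe_finset_sum {V ι : Type*} [AddCommGroup V] [Module ℝ V] [TopologicalSpace V]
    [ContinuousAdd V] (I : Finset ι) (K : ι → ConvexBody V) :
    ((∑ i ∈ I, K i : ConvexBody V) : Set V) = ∑ i ∈ I, (K i : Set V) := by
  classical
  induction I using Finset.induction_on with
  | empty => rfl
  | insert i I hi ih => rw [Finset.sum_insert hi, Finset.sum_insert hi, ConvexBody.coe_add, ih]

/-- A function on tuples in a commutative monoid that is additive in each argument
is `ℕ`-multilinear. -/
theorem exists_multilinearMap_of_map_update_add {n M : Type*} [DecidableEq n] [AddCommMonoid M]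
    (F : (n → M) → ℝ)
    (hF : ∀ (P : n → M) (i : n) (K K' : M), F (Function.update P i (K + K')) =
      F (Function.update P i K) + F (Function.update P i K')) :
    ∃ f : MultilinearMap ℕ (fun _ : n => M) ℝ, ∀ P, f P = F P := by
  have hsmul : ∀ (P : n → M) (i : n) (c : ℕ) (K : M),
      F (Function.update P i (c • K)) = c • F (Function.update P i K) := by
    intro P i c K
    induction c with
    | zero => simpa using hF P i 0 0
    | succ c ih => rw [succ_nsmul, hF, ih, succ_nsmul]
  exact ⟨⟨F, fun P i K K' => by convert hF P i K K', fun P i c K => by convert hsmul P i c K⟩,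
    fun _ => rfl⟩


/-- Vanishing criterion for the mixed volume of polytopes: `MV(Δ₁, …, Δ_m) = 0` iff
some nonempty collection `Δ_{i₁}, …, Δ_{i_J}` has Minkowski sum of affine dimension `< J`. -/
theorem mixed_volume_eq_zero_iff (m : ℕ)
    (MV : (Fin m → ConvexBody (Fin m → ℝ)) → ℝ)
    (MV_symm : ∀ (P : Fin m → ConvexBody (Fin m → ℝ)) (σ : Equiv.Perm (Fin m)),
      MV (P ∘ σ) = MV P)
    (MV_add : ∀ (P : Fin m → ConvexBody (Fin m → ℝ)) (i : Fin m)
      (K K' : ConvexBody (Fin m → ℝ)),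
      MV (Function.update P i (K + K'))
        = MV (Function.update P i K) + MV (Function.update P i K'))
    (MV_diag : ∀ P : ConvexBody (Fin m → ℝ),
      MV (fun _ => P) = (volume (P : Set (Fin m → ℝ))).toReal)
    (Δ : Fin m → ConvexBody (Fin m → ℝ))
    (hpoly : ∀ i, ∃ S : Finset (Fin m → ℝ),
      (Δ i : Set (Fin m → ℝ)) = convexHull ℝ (S : Set (Fin m → ℝ))) :
    MV Δ = 0 ↔ ∃ J : Finset (Fin m), J.Nonempty ∧
      Module.finrank ℝ
        (affineSpan ℝ (∑ i ∈ J, (Δ i : Set (Fin m → ℝ)))).direction < J.card := by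
  choose S hΔ using hpoly
  have hS : ∀ i, (S i).Nonempty := by
    intro i
    have h := (Δ i).nonempty
    rwa [hΔ i, convexHull_nonempty_iff, Finset.coe_nonempty] at h
  obtain ⟨f, hf⟩ := exists_multilinearMap_of_map_update_add MV MV_add
  have hpol := f.sum_neg_one_pow_mul_map_sum fun _ i => Δ i
  have hperm : ∀ σ : Equiv.Perm (Fin m), MV (fun r => Δ (σ r)) = MV Δ := MV_symm Δ
  simp only [hf, MV_diag, ConvexBody.coe_finset_sum, hΔ, hperm, Finset.sum_const,
    Finset.card_univ, Fintype.card_perm, Fintype.card_fin, nsmul_eq_mul] at hpol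
  have hfact : (m.factorial : ℝ) ≠ 0 := Nat.cast_ne_zero.2 m.factorial_ne_zero
  rw [← mul_eq_zero_iff_left hfact, ← hpol, sum_neg_one_pow_mul_volume_eq_zero_iff S hS,
    forall_det_eq_zero_iff_exists_finrank_lt]
  refine exists_congr fun J => ?_
  rw [direction_affineSpan, Finset.sum_congr rfl fun i _ => hΔ i, vectorSpan_sum_convexHull J S hS]
  exact ⟨fun h => ⟨Finset.card_pos.1 (Nat.zero_lt_of_lt h), h⟩, And.right⟩
end

section
/- Let R be a commutative ring, let m ≥ 1 and l ≥ 0 be integers, and let t₀, t̃₀, t₁, …, t_l ∈ R. Then σ_m(t₀ + t̃₀, t₁, …, t_l) = Σ_{μ=1}^{m} [ σ_m(t₀, …, t₀ (μ times), t̃₀, …, t̃₀ (μ−1 times), t₁, …, t_l) + σ_m(t₀, …, t₀ (μ−1 times), t̃₀, …, t̃₀ (μ times), t₁, …, t_l) + 2·σ_m(t₀, …, t₀ (μ times), t̃₀, …, t̃₀ (μ times), t₁, …, t_l) ], where all terms with μ large enough vanish, so the upper limit m may be replaced by ∞. (Higher additivity of the functions σ_m.) -/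
/-- `σ_m(x₁, …, x_N) = Σ x₁^{a₁} ⋯ x_N^{a_N}` over all `N`-tuples of positive integers
`(a₁, …, a_N)` with `a₁ + … + a_N = m` (an empty sum, equal to `0`, if no such tuple
exists). -/
def sigmaFn {R : Type*} [CommRing R] (m : ℕ) {N : ℕ} (x : Fin N → R) : R :=
  ∑ a ∈ Finset.univ.filter
      (fun a : Fin N → Fin (m + 1) => (∀ i, 0 < (a i : ℕ)) ∧ ∑ i, (a i : ℕ) = m),
    ∏ i, x i ^ (a i : ℕ)

/-- `σ_m` of the entries of a list. -/
def sigmaList {R : Type*} [CommRing R] (m : ℕ) (xs : List R) : R :=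
  sigmaFn m (fun i : Fin xs.length => xs.get i)

/-- The power series `∑_{n ≥ 1} xⁿ Xⁿ = xX / (1 - xX)`. -/
noncomputable def positiveGeomSeries {R : Type*} [CommRing R] (x : R) : PowerSeries R :=
  PowerSeries.mk fun n => if n = 0 then 0 else x ^ n

theorem positiveGeomSeries_mul_one_sub {R : Type*} [CommRing R] (x : R) :
    positiveGeomSeries x * (1 - PowerSeries.C x * PowerSeries.X)
      = PowerSeries.C x * PowerSeries.X := by
  ext n
  rw [mul_sub, mul_one, mul_left_comm]
  rcases n with _ | n
  · simp [positiveGeomSeries]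
  · rw [map_sub, PowerSeries.coeff_C_mul, PowerSeries.coeff_C_mul,
      PowerSeries.coeff_succ_mul_X, PowerSeries.coeff_X]
    rcases n with _ | n
    · simp [positiveGeomSeries]
    · simp [positiveGeomSeries, pow_succ' x (n + 1)]

theorem X_dvd_positiveGeomSeries {R : Type*} [CommRing R] (x : R) :
    PowerSeries.X ∣ positiveGeomSeries x := by
  rw [PowerSeries.X_dvd_iff]
  simp [positiveGeomSeries]

/-- `σ_m(x₁, …, x_N)` is the `m`-th coefficient of `∏ xᵢX / (1 - xᵢX)`. -/
theorem sigmaFn_eq_coeff {R : Type*} [CommRing R] (m : ℕ) {N : ℕ} (x : Fin N → R) :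
    sigmaFn m x = PowerSeries.coeff m (∏ i, positiveGeomSeries (x i)) := by
  classical
  rw [PowerSeries.coeff_prod, sigmaFn]
  refine Finset.sum_of_injOn
    (fun a => Finsupp.equivFunOnFinite.symm fun i => (a i : ℕ)) ?_ ?_ ?_ ?_
  · intro a _ b _ hab
    funext i
    exact Fin.ext (congrFun (Finsupp.equivFunOnFinite.symm.injective hab) i)
  · intro a ha
    simp only [Finset.coe_filter, Finset.mem_univ, true_and, Set.mem_ofPred_eq] at ha
    simp [ha.2]
  · intro l hl hnot
    rw [Finset.mem_finsuppAntidiag] at hl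
    by_contra hne
    have hpos : ∀ i, 0 < l i := by
      intro i
      by_contra hi
      refine hne (Finset.prod_eq_zero (Finset.mem_univ i) ?_)
      simp [positiveGeomSeries, Nat.eq_zero_of_not_pos hi]
    have hle : ∀ i, l i < m + 1 := fun i => Nat.lt_succ_of_le <|
      hl.1 ▸ Finset.single_le_sum (f := l) (fun _ _ => Nat.zero_le _) (Finset.mem_univ i)
    refine hnot ⟨fun i => ⟨l i, hle i⟩, ?_, ?_⟩
    · simpa using ⟨hpos, hl.1⟩
    · ext i
      simp
  · intro a ha
    rw [Finset.mem_filter] at ha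
    refine Finset.prod_congr rfl fun i _ => ?_
    simp only [positiveGeomSeries, PowerSeries.coeff_mk, Finsupp.equivFunOnFinite_symm_apply_apply]
    rw [if_neg (ha.2.1 i).ne']

theorem sigmaList_eq_coeff {R : Type*} [CommRing R] (m : ℕ) (xs : List R) :
    sigmaList m xs = PowerSeries.coeff m (xs.map positiveGeomSeries).prod := by
  rw [sigmaList, sigmaFn_eq_coeff]
  simp only [List.get_eq_getElem, Fin.prod_univ_fun_getElem]

/-- The telescoping identity behind the additivity formula. -/
theorem one_sub_mul_mul_sum_Icc {S : Type*} [CommRing S] (A B : S) (m : ℕ) :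
    (1 - A * B) * ∑ μ ∈ Finset.Icc 1 m,
        (A ^ μ * B ^ (μ - 1) + A ^ (μ - 1) * B ^ μ + 2 * (A ^ μ * B ^ μ))
      = (A + B + 2 * (A * B)) * (1 - (A * B) ^ m) := by
  induction m with
  | zero => simp
  | succ m ih =>
    rw [Finset.sum_Icc_succ_top (by omega), mul_add, ih, Nat.add_sub_cancel]
    ring

/-- `(a + b)X / (1 - (a + b)X)` agrees with the truncated expansion of `(A + B + 2AB) / (1 - AB)`,
where `A = aX / (1 - aX)` and `B = bX / (1 - bX)`, up to a multiple of `(AB)ᵐ`. -/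
theorem positiveGeomSeries_add {R : Type*} [CommRing R] (a b : R) (m : ℕ) :
    positiveGeomSeries (a + b)
      = ∑ μ ∈ Finset.Icc 1 m,
          (positiveGeomSeries a ^ μ * positiveGeomSeries b ^ (μ - 1)
            + positiveGeomSeries a ^ (μ - 1) * positiveGeomSeries b ^ μ
            + 2 * (positiveGeomSeries a ^ μ * positiveGeomSeries b ^ μ))
        + positiveGeomSeries (a + b) * (positiveGeomSeries a * positiveGeomSeries b) ^ m := by
  have hsum := one_sub_mul_mul_sum_Icc (positiveGeomSeries a) (positiveGeomSeries b) m
  have ha := positiveGeomSeries_mul_one_sub a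
  have hb := positiveGeomSeries_mul_one_sub b
  have hab := positiveGeomSeries_mul_one_sub (a + b)
  rw [map_add] at hab
  generalize positiveGeomSeries (a + b) = C at *
  generalize (∑ μ ∈ Finset.Icc 1 m, _ : PowerSeries R) = S at *
  generalize hu : (PowerSeries.C a * PowerSeries.X : PowerSeries R) = u at *
  generalize hv : (PowerSeries.C b * PowerSeries.X : PowerSeries R) = v at *
  rw [add_mul, hu, hv] at hab
  have hunit : IsUnit (1 - (u + v)) := by
    rw [PowerSeries.isUnit_iff_constantCoeff, ← hu, ← hv]
    simp
  generalize positiveGeomSeries a = A at *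
  generalize positiveGeomSeries b = B at *
  have hden : (1 - A * B) * ((1 - u) * (1 - v)) = 1 - (u + v) := by
    linear_combination (-B * (1 - v)) * ha - u * hb
  have hnum : (A + B + 2 * (A * B)) * ((1 - u) * (1 - v)) = u + v := by
    linear_combination ((1 - v) + 2 * B * (1 - v)) * ha + ((1 - u) + 2 * u) * hb
  refine hunit.mul_left_cancel ?_
  linear_combination (1 - (A * B) ^ m) * hab - (1 - u) * (1 - v) * hsum
    + S * hden - (1 - (A * B) ^ m) * hnum

/-- Higher additivity of the functions `σ_m`:
`σ_m(t₀ + t̃₀, t₁, …, t_l)` equals the sum over `μ = 1, …, m` of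
`σ_m(t₀^{×μ}, t̃₀^{×(μ−1)}, t₁, …, t_l) + σ_m(t₀^{×(μ−1)}, t̃₀^{×μ}, t₁, …, t_l)
 + 2 σ_m(t₀^{×μ}, t̃₀^{×μ}, t₁, …, t_l)`. -/
theorem sigma_higher_additivity {R : Type*} [CommRing R] (m : ℕ) (hm : 1 ≤ m)
    (t₀ t₀' : R) (ts : List R) :
    sigmaList m ((t₀ + t₀') :: ts)
      = ∑ μ ∈ Finset.Icc 1 m,
          (sigmaList m (List.replicate μ t₀ ++ List.replicate (μ - 1) t₀' ++ ts)
            + sigmaList m (List.replicate (μ - 1) t₀ ++ List.replicate μ t₀' ++ ts)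
            + 2 * sigmaList m (List.replicate μ t₀ ++ List.replicate μ t₀' ++ ts)) := by
  simp only [sigmaList_eq_coeff, List.map_cons, List.map_append, List.map_replicate,
    List.prod_cons, List.prod_append, List.prod_replicate]
  generalize (ts.map positiveGeomSeries).prod = T
  have hdvd : (PowerSeries.X : PowerSeries R) ^ (m + 1) ∣
      positiveGeomSeries (t₀ + t₀') * (positiveGeomSeries t₀ * positiveGeomSeries t₀') ^ m * T := by
    rw [pow_succ']
    exact ((mul_dvd_mul (X_dvd_positiveGeomSeries _)
      (pow_dvd_pow_of_dvd ((X_dvd_positiveGeomSeries _).mul_right _) m)).mul_right _)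
  have htail := PowerSeries.X_pow_dvd_iff.mp hdvd m (Nat.lt_succ_self m)
  rw [positiveGeomSeries_add t₀ t₀' m, add_mul, map_add, htail, add_zero, Finset.sum_mul, map_sum]
  refine Finset.sum_congr rfl fun μ _ => ?_
  simp only [two_mul, add_mul, map_add]
end

section
/- Let M be a commutative monoid (written additively), let n ≥ 1, and let f : M^n → ℝ be a function that is symmetric and additive in each argument (f(x + y, a₂, …, a_n) = f(x, a₂, …, a_n) + f(y, a₂, …, a_n), and likewise in every argument). Then for all a₁, …, a_n ∈ M, n! · f(a₁, …, a_n) = Σ_{∅ ≠ S ⊆ {1, …, n}} (−1)^{n − |S|} f(b_S, …, b_S), where b_S = Σ_{i ∈ S} a_i. (Polarization identity for symmetric Minkowski-multilinear functions.) -/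
/-- The signs `(-1) ^ |Sᶜ|` summed over the finsets `S` containing `t` cancel unless `t` is
everything. -/
theorem sum_superset_neg_one_pow_card_compl {ι A : Type*} [Fintype ι] [DecidableEq ι]
    [CommRing A] (t : Finset ι) :
    ∑ S : Finset ι, (if t ⊆ S then (-1 : A) ^ Sᶜ.card else 0)
      = if t = Finset.univ then 1 else 0 := by
  have h := congrArg (Int.cast : ℤ → A) (Finset.sum_powerset_neg_one_pow_card (x := tᶜ))
  push_cast at h
  simp_rw [← Finset.compl_eq_empty_iff t]
  rw [← h, ← Finset.sum_filter]
  refine Finset.sum_bij' (fun S _ => Sᶜ) (fun T _ => Tᶜ) ?_ ?_ ?_ ?_ ?_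
  · simp
  · intro T hT
    simpa [Finset.subset_compl_comm] using hT
  all_goals simp

/-- Polarization identity for symmetric multilinear maps with values in a commutative ring. -/
theorem MultilinearMap.factorial_mul_eq_sum_of_symmetric {R ι M A : Type*} [Fintype ι]
    [DecidableEq ι] [Semiring R] [AddCommMonoid M] [Module R M] [CommRing A] [Module R A]
    (f : MultilinearMap R (fun _ : ι => M) A)
    (f_symm : ∀ (a : ι → M) (σ : Equiv.Perm ι), f (a ∘ σ) = f a) (a : ι → M) :
    ((Fintype.card ι).factorial : A) * f a
      = ∑ S : Finset ι, (-1 : A) ^ Sᶜ.card * f (fun _ => ∑ i ∈ S, a i) := by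
  have expand (S : Finset ι) : (-1 : A) ^ Sᶜ.card * f (fun _ => ∑ i ∈ S, a i)
      = ∑ φ : ι → ι, (if Finset.univ.image φ ⊆ S then (-1 : A) ^ Sᶜ.card else 0) * f (a ∘ φ) := by
    rw [f.map_sum_finset (fun _ => a) (fun _ => S), Finset.mul_sum]
    simp_rw [ite_mul, zero_mul]
    rw [← Finset.sum_filter]
    refine Finset.sum_congr ?_ fun _ _ => rfl
    ext φ
    simp [Finset.image_subset_iff]
  simp_rw [expand]
  rw [Finset.sum_comm]
  simp_rw [← Finset.sum_mul, sum_superset_neg_one_pow_card_compl, ite_mul, one_mul, zero_mul]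
  rw [← Finset.sum_filter, ← Fintype.card_perm, ← nsmul_eq_mul, ← Finset.card_univ,
    ← Finset.sum_const]
  refine Finset.sum_bij (fun σ _ => ⇑σ) ?_ (fun _ _ _ _ h => DFunLike.coe_injective h) ?_
    fun σ _ => (f_symm a σ).symm
  · intro σ _
    simp [Finset.image_univ_of_surjective σ.surjective]
  · intro φ hφ
    have hsurj : Function.Surjective φ := by
      simpa [Finset.ext_iff, Function.Surjective] using hφ
    exact ⟨Equiv.ofBijective φ (Finite.surjective_iff_bijective.1 hsurj), Finset.mem_univ _, rfl⟩

/-- Polarization identity for symmetric Minkowski-multilinear functions: if `f : M^n → ℝ` is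
symmetric and additive in each argument on a commutative monoid `M`, then
`n! · f(a₁, …, a_n) = Σ_{∅ ≠ S ⊆ {1,…,n}} (−1)^{n−|S|} f(b_S, …, b_S)`, `b_S = Σ_{i ∈ S} a_i`. -/
theorem polarization_of_symmetric_multiadditive {M : Type*} [AddCommMonoid M]
    (n : ℕ) (hn : 1 ≤ n) (f : (Fin n → M) → ℝ)
    (f_symm : ∀ (a : Fin n → M) (σ : Equiv.Perm (Fin n)), f (a ∘ σ) = f a)
    (f_add : ∀ (a : Fin n → M) (i : Fin n) (x y : M),
      f (Function.update a i (x + y)) = f (Function.update a i x) + f (Function.update a i y))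
    (a : Fin n → M) :
    (Nat.factorial n : ℝ) * f a
      = ∑ S ∈ Finset.univ.filter (fun S : Finset (Fin n) => S ≠ ∅),
          (-1 : ℝ) ^ (n - S.card) * f (fun _ => ∑ i ∈ S, a i) := by
  have map_zero (m : Fin n → M) (i : Fin n) : f (Function.update m i 0) = 0 := by
    simpa using f_add m i 0 0
  have map_nsmul (m : Fin n → M) (i : Fin n) (c : ℕ) (x : M) :
      f (Function.update m i (c • x)) = c • f (Function.update m i x) := by
    induction c with
    | zero => simp [map_zero]
    | succ c ih => rw [succ_nsmul, f_add, ih, succ_nsmul]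
  let F : MultilinearMap ℕ (fun _ : Fin n => M) ℝ :=
    { toFun := f
      map_update_add' := by
        intro inst m i x y
        convert f_add m i x y
      map_update_smul' := by
        intro inst m i c x
        convert map_nsmul m i c x }
  have h := F.factorial_mul_eq_sum_of_symmetric f_symm a
  simp only [Finset.card_compl, Fintype.card_fin] at h
  refine h.trans (Finset.sum_subset (Finset.filter_subset _ _) ?_).symm
  intro S _ hS
  obtain rfl : S = ∅ := by simpa using hS
  have h_zero : F (fun _ => 0) = 0 := F.map_coord_zero ⟨0, hn⟩ rfl
  simp [h_zero]
end

section
/- Let A₀, …, A_k be nonempty finite subsets of ℤ^k. For a nonempty subset J ⊆ {0, …, k}, define codim J = dim( Σ_{j ∈ J} A_j ) − |J|, where Σ_{j ∈ J} A_j is the Minkowski sum and dim denotes the dimension of the affine span in ℝ^k. If codim J ≥ −1 for every nonempty J ⊆ {0, …, k}, then there exists a (unique) minimal nonempty set J₀ ⊆ {0, …, k} with codim J₀ = −1; that is, codim J₀ = −1 and J₀ ⊆ J for every nonempty J ⊆ {0, …, k} with codim J = −1. -/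
open Pointwise

/-- The codimension of the subcollection `{A_j}_{j ∈ J}` of finite subsets of `ℤ^k`:
the dimension of the affine span (in `ℝ^k`) of the Minkowski sum `Σ_{j ∈ J} A_j`
minus the cardinality of `J`. -/
noncomputable def codimOf (k : ℕ) (A : Fin (k + 1) → Finset (Fin k → ℤ))
    (J : Finset (Fin (k + 1))) : ℤ :=
  (Module.finrank ℝ
      (affineSpan ℝ
        (∑ j ∈ J, ((fun a : Fin k → ℤ => fun i => (a i : ℝ)) ''
          ((A j : Set (Fin k → ℤ)))))).direction : ℤ) - J.card

theorem vectorSpan_add_eq_sup_s17 {R M : Type*} [Ring R] [AddCommGroup M] [Module R M]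
    {s t : Set M} (hs : s.Nonempty) (ht : t.Nonempty) :
    vectorSpan R (s + t) = vectorSpan R s ⊔ vectorSpan R t := by
  apply le_antisymm
  · refine Submodule.span_le.2 ?_
    rintro _ ⟨_, ⟨a, ha, b, hb, rfl⟩, _, ⟨a', ha', b', hb', rfl⟩, rfl⟩
    have h := Submodule.add_mem_sup (vsub_mem_vectorSpan R ha ha') (vsub_mem_vectorSpan R hb hb')
    simpa only [vsub_eq_sub, add_sub_add_comm, SetLike.mem_coe] using h
  · refine sup_le (Submodule.span_le.2 ?_) (Submodule.span_le.2 ?_)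
    · rintro _ ⟨a, ha, a', ha', rfl⟩
      obtain ⟨b, hb⟩ := ht
      simpa using vsub_mem_vectorSpan R (Set.add_mem_add ha hb) (Set.add_mem_add ha' hb)
    · rintro _ ⟨b, hb, b', hb', rfl⟩
      obtain ⟨a, ha⟩ := hs
      simpa using vsub_mem_vectorSpan R (Set.add_mem_add ha hb) (Set.add_mem_add ha hb')

theorem vectorSpan_finset_sum_eq_sup {R M ι : Type*} [Ring R] [AddCommGroup M] [Module R M]
    (s : ι → Set M) (hs : ∀ i, (s i).Nonempty) (J : Finset ι) :
    (∑ j ∈ J, s j).Nonempty ∧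
      vectorSpan R (∑ j ∈ J, s j) = J.sup fun j => vectorSpan R (s j) := by
  classical
  induction J using Finset.induction_on with
  | empty => simp [← Set.singleton_zero]
  | insert a J ha ih =>
    rw [Finset.sum_insert ha, Finset.sup_insert, vectorSpan_add_eq_sup_s17 (hs a) ih.1, ih.2]
    exact ⟨(hs a).add ih.1, rfl⟩

theorem finrank_finset_sup_union_add_inter_le {K V ι : Type*} [DivisionRing K] [AddCommGroup V]
    [Module K V] [FiniteDimensional K V] [DecidableEq ι] (L : ι → Submodule K V)
    (I J : Finset ι) :
    Module.finrank K ↥((I ∪ J).sup L) + Module.finrank K ↥((I ∩ J).sup L) ≤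
      Module.finrank K ↥(I.sup L) + Module.finrank K ↥(J.sup L) := by
  rw [Finset.sup_union, ← Submodule.finrank_sup_add_finrank_inf_eq (I.sup L) (J.sup L)]
  gcongr
  exact Submodule.finrank_mono
    (le_inf (Finset.sup_mono Finset.inter_subset_left) (Finset.sup_mono Finset.inter_subset_right))

theorem codimOf_eq_finrank_sup_sub_card {k : ℕ} {A : Fin (k + 1) → Finset (Fin k → ℤ)}
    (hne : ∀ j, (A j).Nonempty) (J : Finset (Fin (k + 1))) :
    codimOf k A J = (Module.finrank ℝ ↥(J.sup fun j =>
      vectorSpan ℝ ((fun a : Fin k → ℤ => fun i => (a i : ℝ)) ''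
        (A j : Set (Fin k → ℤ)))) : ℤ) - J.card := by
  rw [codimOf, direction_affineSpan, (vectorSpan_finset_sum_eq_sup _
    (fun j => (Finset.coe_nonempty.2 (hne j)).image _) _).2]

theorem codimOf_union_add_inter_le {k : ℕ} {A : Fin (k + 1) → Finset (Fin k → ℤ)}
    (hne : ∀ j, (A j).Nonempty) (I J : Finset (Fin (k + 1))) :
    codimOf k A (I ∪ J) + codimOf k A (I ∩ J) ≤ codimOf k A I + codimOf k A J := by
  simp only [codimOf_eq_finrank_sup_sub_card hne]
  have hrank := finrank_finset_sup_union_add_inter_le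
    (fun j => vectorSpan ℝ ((fun a : Fin k → ℤ => fun i => (a i : ℝ)) ''
      (A j : Set (Fin k → ℤ)))) I J
  have hcard := Finset.card_union_add_card_inter I J
  lia

theorem codimOf_empty (k : ℕ) (A : Fin (k + 1) → Finset (Fin k → ℤ)) : codimOf k A ∅ = 0 := by
  rw [codimOf, direction_affineSpan, Finset.sum_empty, ← Set.singleton_zero, vectorSpan_singleton]
  simp

theorem codimOf_univ_le (k : ℕ) (A : Fin (k + 1) → Finset (Fin k → ℤ)) :
    codimOf k A Finset.univ ≤ -1 := by
  have h := Submodule.finrank_le (affineSpan ℝ (∑ j, ((fun a : Fin k → ℤ => fun i => (a i : ℝ)) ''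
    (A j : Set (Fin k → ℤ))))).direction
  rw [Module.finrank_fin_fun] at h
  rw [codimOf, Finset.card_univ, Fintype.card_fin]
  lia

/-- If `codim J ≥ −1` for every nonempty `J ⊆ {0, …, k}`, then there is a minimal nonempty
`J₀` with `codim J₀ = −1`: `codim J₀ = −1` and `J₀ ⊆ J` for every nonempty `J` with
`codim J = −1`. -/
theorem exists_minimal_codim_neg_one (k : ℕ) (A : Fin (k + 1) → Finset (Fin k → ℤ))
    (hne : ∀ j, (A j).Nonempty)
    (hcodim : ∀ J : Finset (Fin (k + 1)), J.Nonempty → -1 ≤ codimOf k A J) :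
    ∃ J₀ : Finset (Fin (k + 1)), J₀.Nonempty ∧ codimOf k A J₀ = -1 ∧
      ∀ J : Finset (Fin (k + 1)), J.Nonempty → codimOf k A J = -1 → J₀ ⊆ J := by
  obtain ⟨J₀, ⟨hJ₀, hJ₀'⟩, hmin⟩ :=
    (Set.toFinite {J : Finset (Fin (k + 1)) | J.Nonempty ∧ codimOf k A J = -1}).exists_minimal
      ⟨Finset.univ, Finset.univ_nonempty,
        (codimOf_univ_le k A).antisymm (hcodim _ Finset.univ_nonempty)⟩
  refine ⟨J₀, hJ₀, hJ₀', fun J hJ hJ' => ?_⟩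
  have hsub := codimOf_union_add_inter_le hne J₀ J
  have hunion := hcodim (J₀ ∪ J) (hJ₀.mono Finset.subset_union_left)
  have hinter : (J₀ ∩ J).Nonempty := by
    by_contra h
    rw [Finset.not_nonempty_iff_eq_empty.1 h, codimOf_empty] at hsub
    lia
  have heq : codimOf k A (J₀ ∩ J) = -1 := by
    have := hcodim _ hinter
    lia
  exact (hmin ⟨hinter, heq⟩ Finset.inter_subset_left).trans Finset.inter_subset_right
end

section
/- There exists a unique real-valued function MV of m-tuples of convex bodies in ℝ^m that is symmetric, additive in each argument with respect to Minkowski sum, and satisfies MV(P, …, P) = vol(P) (Lebesgue volume) for every convex body P ⊂ ℝ^m. (Existence and uniqueness of the mixed volume.) -/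
open MeasureTheory

namespace MultilinearMap

variable {ι M A : Type*} [Fintype ι] [DecidableEq ι] [AddCommMonoid M] [AddCommGroup A]

/-- The polarization identity for multiadditive maps. -/
theorem sum_neg_one_pow_smul_map_sum_compl (f : MultilinearMap ℕ (fun _ : ι => M) A) (a : ι → M) :
    ∑ U : Finset ι, (-1 : ℤ) ^ U.card • f (fun _ => ∑ i ∈ Uᶜ, a i)
      = ∑ σ : Equiv.Perm ι, f (a ∘ σ) := by
  have key (r : ι → ι) : ∑ U : Finset ι, (if ∀ i, r i ∈ Uᶜ then (-1 : ℤ) ^ U.card else 0)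
      = if Function.Surjective r then 1 else 0 := by
    rw [← Finset.sum_filter]
    have h1 : (Finset.univ.filter fun U : Finset ι => ∀ i, r i ∈ Uᶜ)
        = (Finset.univ.image r)ᶜ.powerset := by
      ext U
      simp only [Finset.mem_compl, Finset.mem_filter, Finset.mem_univ, true_and,
        Finset.mem_powerset, Finset.subset_iff, Finset.mem_image, not_exists]
      exact ⟨fun h x hx i hi => h i (hi ▸ hx), fun h i hi => h hi i rfl⟩
    rw [h1, Finset.sum_powerset_neg_one_pow_card]
    simp [Finset.compl_eq_empty_iff, Finset.eq_univ_iff_forall, Function.Surjective]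
    congr
  calc ∑ U : Finset ι, (-1 : ℤ) ^ U.card • f (fun _ => ∑ i ∈ Uᶜ, a i)
      = ∑ U : Finset ι, ∑ r : ι → ι,
          (if ∀ i, r i ∈ Uᶜ then (-1 : ℤ) ^ U.card else 0) • f (a ∘ r) := by
        refine Finset.sum_congr rfl fun U _ => ?_
        rw [f.map_sum_finset (fun _ => a) (fun _ => Uᶜ), Finset.smul_sum]
        simp_rw [ite_smul, zero_smul]
        rw [← Finset.sum_filter]
        refine Finset.sum_congr ?_ fun r _ => rfl
        ext r
        simp
    _ = ∑ r : ι → ι, if Function.Surjective r then f (a ∘ r) else 0 := by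
        rw [Finset.sum_comm]
        refine Finset.sum_congr rfl fun r _ => ?_
        rw [← Finset.sum_smul, key]
        split_ifs <;> simp
    _ = ∑ σ : Equiv.Perm ι, f (a ∘ σ) := by
        rw [← Finset.sum_filter]
        symm
        refine Finset.sum_bij (fun σ _ => ⇑σ) (fun σ _ => by simpa using σ.surjective)
          (fun σ _ τ _ h => DFunLike.coe_injective h) (fun r hr => ?_) (fun _ _ => rfl)
        have hr' := (Finset.mem_filter.1 hr).2
        exact ⟨Equiv.ofBijective r ⟨Finite.injective_iff_surjective.2 hr', hr'⟩,
          Finset.mem_univ _, rfl⟩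

end MultilinearMap

section Gradient

variable {ι : Type*} [Fintype ι] [DecidableEq ι] {φ : (ι → ℝ) → ℝ}

/-- The gradient of a function on `ι → ℝ`. -/
noncomputable def coordGradient (φ : (ι → ℝ) → ℝ) (x : ι → ℝ) : ι → ℝ :=
  fun j => fderiv ℝ φ x (Pi.single j 1)

/-- The Hessian matrix of a function on `ι → ℝ`. -/
noncomputable def coordHessian (φ : (ι → ℝ) → ℝ) (x : ι → ℝ) : Matrix ι ι ℝ :=
  LinearMap.toMatrix' (fderiv ℝ (coordGradient φ) x : (ι → ℝ) →ₗ[ℝ] ι → ℝ)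

theorem coordGradient_dotProduct (φ : (ι → ℝ) → ℝ) (x u : ι → ℝ) :
    coordGradient φ x ⬝ᵥ u = fderiv ℝ φ x u := by
  conv_rhs => rw [pi_eq_sum_univ' u]
  simp [coordGradient, dotProduct, mul_comm]

theorem ContDiff.coordGradient (h : ContDiff ℝ 2 φ) : ContDiff ℝ 1 (coordGradient φ) :=
  contDiff_pi.2 fun _ => (h.fderiv_right (m := 1) (by norm_num)).clm_apply contDiff_const

theorem coordHessian_mulVec (φ : (ι → ℝ) → ℝ) (x u : ι → ℝ) :
    (coordHessian φ x).mulVec u = fderiv ℝ (coordGradient φ) x u := by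
  simp [coordHessian, LinearMap.toMatrix'_mulVec]

theorem det_coordHessian (φ : (ι → ℝ) → ℝ) (x : ι → ℝ) :
    (coordHessian φ x).det = (fderiv ℝ (coordGradient φ) x).det := by
  rw [coordHessian, LinearMap.det_toMatrix', ContinuousLinearMap.det]

theorem ContDiff.continuous_coordHessian (h : ContDiff ℝ 2 φ) : Continuous (coordHessian φ) := by
  have h1 : Continuous (fderiv ℝ (_root_.coordGradient φ)) :=
    h.coordGradient.continuous_fderiv (by norm_num)
  refine continuous_matrix fun i j => ?_
  simp only [coordHessian, LinearMap.toMatrix'_apply]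
  exact (continuous_apply i).comp (h1.clm_apply continuous_const)

theorem coordHessian_apply (h : ContDiff ℝ 2 φ) (x : ι → ℝ) (i j : ι) :
    coordHessian φ x i j = fderiv ℝ (fderiv ℝ φ) x (Pi.single j 1) (Pi.single i 1) := by
  have h1 : DifferentiableAt ℝ (fderiv ℝ φ) x :=
    ((h.fderiv_right (m := 1) (by norm_num)).differentiable (by norm_num)) x
  have h2 : HasFDerivAt (coordGradient φ)
      (ContinuousLinearMap.pi fun i => (fderiv ℝ (fderiv ℝ φ) x).flip (Pi.single i 1)) x := by
    rw [hasFDerivAt_pi]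
    intro i
    simpa [coordGradient] using
      h1.hasFDerivAt.clm_apply (hasFDerivAt_const (Pi.single i (1 : ℝ)) x)
  simp only [coordHessian, LinearMap.toMatrix'_apply]
  rw [h2.fderiv]
  rfl

/-- The derivative of a function on a line is monotone if the function is convex. -/
theorem ConvexOn.monotone_coordGradient_line (hc : ConvexOn ℝ Set.univ φ)
    (h : ContDiff ℝ 2 φ) (x e : ι → ℝ) :
    Monotone fun t : ℝ => coordGradient φ (x + t • e) ⬝ᵥ e := by
  have hd : Differentiable ℝ φ := h.differentiable (by norm_num)
  have hline (t : ℝ) : HasDerivAt (fun t : ℝ => x + t • e) e t := by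
    simpa using ((hasDerivAt_id t).smul_const e).const_add x
  have hg (t : ℝ) : HasDerivAt (fun t : ℝ => φ (x + t • e))
      (coordGradient φ (x + t • e) ⬝ᵥ e) t := by
    rw [coordGradient_dotProduct]
    exact (hd _).hasFDerivAt.comp_hasDerivAt t (hline t)
  have hconv : ConvexOn ℝ Set.univ (fun t : ℝ => φ (x + t • e)) := by
    have := hc.comp_affineMap (AffineMap.lineMap x (x + e))
    simpa [Function.comp_def, AffineMap.lineMap_apply, add_comm] using this
  have := hconv.monotoneOn_deriv fun t _ => (hg t).differentiableAt
  rw [monotoneOn_univ] at this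
  convert this using 2 with t
  exact (hg t).deriv.symm

theorem ContDiff.hasDerivAt_coordGradient_line (h : ContDiff ℝ 2 φ) (x e : ι → ℝ) :
    HasDerivAt (fun t : ℝ => _root_.coordGradient φ (x + t • e) ⬝ᵥ e)
      (e ⬝ᵥ (coordHessian φ x).mulVec e) 0 := by
  have hline : HasDerivAt (fun t : ℝ => x + t • e) e 0 := by
    simpa using ((hasDerivAt_id (0 : ℝ)).smul_const e).const_add x
  have hG : HasFDerivAt (_root_.coordGradient φ) (fderiv ℝ (_root_.coordGradient φ) x)
      (x + (0 : ℝ) • e) := by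
    simpa using (h.coordGradient.differentiable (by norm_num) x).hasFDerivAt
  have h1 := hG.comp_hasDerivAt (0 : ℝ) hline
  rw [← coordHessian_mulVec] at h1
  rw [hasDerivAt_pi] at h1
  have h2 := HasDerivAt.fun_sum fun i (_ : i ∈ Finset.univ) => (h1 i).mul_const (e i)
  simpa [dotProduct, mul_comm] using h2

theorem ConvexOn.posSemidef_coordHessian (hc : ConvexOn ℝ Set.univ φ) (h : ContDiff ℝ 2 φ)
    (x : ι → ℝ) : (coordHessian φ x).PosSemidef := by
  refine Matrix.PosSemidef.of_dotProduct_mulVec_nonneg ?_ fun e => ?_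
  · ext i j
    have hs : IsSymmSndFDerivAt ℝ φ x := h.contDiffAt.isSymmSndFDerivAt (by simp)
    rw [Matrix.conjTranspose_apply, coordHessian_apply h, coordHessian_apply h]
    simpa using hs _ _
  · have h1 := (h.hasDerivAt_coordGradient_line x e).deriv
    simpa [← h1] using (hc.monotone_coordGradient_line h x e).deriv_nonneg

theorem ConvexOn.injOn_coordGradient (hc : ConvexOn ℝ Set.univ φ) (h : ContDiff ℝ 2 φ) :
    Set.InjOn (coordGradient φ) {x | (coordHessian φ x).det ≠ 0} := by
  intro x hx y _ hxy
  by_contra hne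
  have hmono := hc.monotone_coordGradient_line h x (y - x)
  have hconst : Set.EqOn (fun t : ℝ => coordGradient φ (x + t • (y - x)) ⬝ᵥ (y - x))
      (fun _ => coordGradient φ x ⬝ᵥ (y - x)) (Set.Icc 0 1) := by
    intro t ht
    refine le_antisymm ?_ ?_
    · simpa [← hxy] using hmono ht.2
    · simpa using hmono ht.1
  have hd := (h.hasDerivAt_coordGradient_line x (y - x)).hasDerivWithinAt (s := Set.Icc 0 1)
  have hd' := (hasDerivWithinAt_const (0 : ℝ) (Set.Icc 0 1)
    (coordGradient φ x ⬝ᵥ (y - x))).congr hconst (hconst (by simp))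
  have hz : (y - x) ⬝ᵥ (coordHessian φ x).mulVec (y - x) = 0 :=
    (uniqueDiffOn_Icc zero_lt_one 0 (by simp)).eq_deriv _ hd hd'
  have hz' := ((hc.posSemidef_coordHessian h x).dotProduct_mulVec_zero_iff (y - x)).1
    (by simpa using hz)
  exact hne (sub_eq_zero.1 (Matrix.eq_zero_of_mulVec_eq_zero hx hz')).symm

/-- The Lebesgue measure of the range of the gradient of a smooth convex function is the integral
of its Monge-Ampère density. -/
theorem ConvexOn.lintegral_det_coordHessian (hc : ConvexOn ℝ Set.univ φ) (h : ContDiff ℝ 2 φ) :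
    ∫⁻ x, ENNReal.ofReal (coordHessian φ x).det = volume (Set.range (coordGradient φ)) := by
  set s : Set (ι → ℝ) := {x | (coordHessian φ x).det ≠ 0} with hs_def
  have hcont : Continuous fun x => (coordHessian φ x).det := h.continuous_coordHessian.matrix_det
  have hs : MeasurableSet s := (isOpen_ne.preimage hcont).measurableSet
  have hder (x) (t : Set (ι → ℝ)) :
      HasFDerivWithinAt (coordGradient φ) (fderiv ℝ (coordGradient φ) x) t x :=
    (h.coordGradient.differentiable (by norm_num) x).hasFDerivAt.hasFDerivWithinAt
  have h1 := lintegral_abs_det_fderiv_eq_addHaar_image volume hs (fun x _ => hder x s)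
    (hc.injOn_coordGradient h)
  have h2 : volume (coordGradient φ '' sᶜ) = 0 :=
    addHaar_image_eq_zero_of_det_fderivWithin_eq_zero volume (fun x _ => hder x sᶜ) fun x hx => by
      simpa [hs_def, det_coordHessian] using hx
  have h3 : volume (Set.range (coordGradient φ)) = volume (coordGradient φ '' s) := by
    rw [← Set.image_univ, ← Set.union_compl_self s, Set.image_union]
    exact le_antisymm ((measure_union_le _ _).trans (by rw [h2, add_zero]))
      (measure_mono Set.subset_union_left)
  rw [h3, ← h1, ← lintegral_indicator hs]
  refine lintegral_congr fun x => ?_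
  by_cases hx : x ∈ s
  · rw [Set.indicator_of_mem hx, ← det_coordHessian,
      abs_of_nonneg (hc.posSemidef_coordHessian h x).det_nonneg]
  · rw [Set.indicator_of_notMem hx]
    simp [show (coordHessian φ x).det = 0 by simpa [hs_def] using hx]

end Gradient

namespace ConvexBody

open scoped Pointwise
open Filter

variable {ι : Type*} [Fintype ι]

/-- The support function of a convex body in `ι → ℝ`. -/
noncomputable def supp (K : ConvexBody (ι → ℝ)) (x : ι → ℝ) : ℝ :=
  sSup ((fun y => x ⬝ᵥ y) '' (K : Set (ι → ℝ)))

theorem bddAbove_dotProduct_image (K : ConvexBody (ι → ℝ)) (x : ι → ℝ) :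
    BddAbove ((fun y => x ⬝ᵥ y) '' (K : Set (ι → ℝ))) :=
  (K.isCompact.image (by fun_prop)).bddAbove

theorem dotProduct_le_supp (K : ConvexBody (ι → ℝ)) (x : ι → ℝ) {y : ι → ℝ} (hy : y ∈ K) :
    x ⬝ᵥ y ≤ K.supp x :=
  le_csSup (K.bddAbove_dotProduct_image x) ⟨y, hy, rfl⟩

theorem supp_le (K : ConvexBody (ι → ℝ)) (x : ι → ℝ) {c : ℝ} (h : ∀ y ∈ K, x ⬝ᵥ y ≤ c) :
    K.supp x ≤ c :=
  csSup_le (K.nonempty.image _) (by rintro _ ⟨y, hy, rfl⟩; exact h y hy)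

theorem supp_add_le (K : ConvexBody (ι → ℝ)) (x u : ι → ℝ) :
    K.supp (x + u) ≤ K.supp x + K.supp u :=
  K.supp_le _ fun y hy => by
    rw [add_dotProduct]
    exact add_le_add (K.dotProduct_le_supp x hy) (K.dotProduct_le_supp u hy)

theorem supp_smul_le (K : ConvexBody (ι → ℝ)) (x : ι → ℝ) {c : ℝ} (hc : 0 ≤ c) :
    K.supp (c • x) ≤ c * K.supp x :=
  K.supp_le _ fun y hy => by
    rw [smul_dotProduct, smul_eq_mul]
    exact mul_le_mul_of_nonneg_left (K.dotProduct_le_supp x hy) hc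

theorem convexOn_supp (K : ConvexBody (ι → ℝ)) : ConvexOn ℝ Set.univ K.supp :=
  ⟨convex_univ, fun x _ y _ _ _ ha hb _ => (K.supp_add_le _ _).trans
    (add_le_add (K.supp_smul_le x ha) (K.supp_smul_le y hb))⟩

theorem continuous_supp (K : ConvexBody (ι → ℝ)) : Continuous K.supp :=
  continuousOn_univ.1 (K.convexOn_supp.continuousOn isOpen_univ)

theorem supp_body_add (K L : ConvexBody (ι → ℝ)) (x : ι → ℝ) :
    (K + L).supp x = K.supp x + L.supp x := by
  have h : (fun y => x ⬝ᵥ y) '' ((K + L : ConvexBody (ι → ℝ)) : Set (ι → ℝ))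
      = (fun y => x ⬝ᵥ y) '' (K : Set (ι → ℝ)) + (fun y => x ⬝ᵥ y) '' (L : Set (ι → ℝ)) := by
    rw [coe_add]
    exact Set.image_add (AddMonoidHom.mk' (fun y => x ⬝ᵥ y) (dotProduct_add x))
  rw [supp, h, csSup_add (K.nonempty.image _) (K.bddAbove_dotProduct_image x)
    (L.nonempty.image _) (L.bddAbove_dotProduct_image x), supp, supp]

/-- A fixed smooth compactly supported probability density on `ι → ℝ`. -/
noncomputable def mollifier (ι : Type*) [Fintype ι] : (ι → ℝ) → ℝ :=
  (⟨1, 2, one_pos, one_lt_two⟩ : ContDiffBump (0 : ι → ℝ)).normed volume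

theorem continuous_mollifier : Continuous (mollifier ι) := ContDiffBump.continuous_normed _

theorem hasCompactSupport_mollifier : HasCompactSupport (mollifier ι) :=
  ContDiffBump.hasCompactSupport_normed _

theorem mollifier_nonneg (t : ι → ℝ) : 0 ≤ mollifier ι t := ContDiffBump.nonneg_normed _ t

theorem integral_mollifier : ∫ t, mollifier ι t = 1 := ContDiffBump.integral_normed _

theorem integrable_mollifier_mul {g : (ι → ℝ) → ℝ} (hg : Continuous g) :
    Integrable fun t => mollifier ι t * g t :=
  (continuous_mollifier.mul hg).integrable_of_hasCompactSupport
    hasCompactSupport_mollifier.mul_right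

/-- A smooth convex function approximating the support function of `K`. -/
noncomputable def smoothSupp (K : ConvexBody (ι → ℝ)) (x : ι → ℝ) : ℝ :=
  ∫ t, mollifier ι t * K.supp (x - t)

theorem integrable_mollifier_mul_supp (K : ConvexBody (ι → ℝ)) (x : ι → ℝ) :
    Integrable fun t => mollifier ι t * K.supp (x - t) :=
  integrable_mollifier_mul (K.continuous_supp.comp (by fun_prop))

theorem contDiff_smoothSupp (K : ConvexBody (ι → ℝ)) : ContDiff ℝ 2 K.smoothSupp :=
  hasCompactSupport_mollifier.contDiff_convolution_left (n := 2) (ContinuousLinearMap.lsmul ℝ ℝ)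
    (ContDiffBump.contDiff_normed _) K.continuous_supp.locallyIntegrable

theorem convexOn_smoothSupp (K : ConvexBody (ι → ℝ)) : ConvexOn ℝ Set.univ K.smoothSupp := by
  refine ⟨convex_univ, fun x _ y _ a b ha hb hab => ?_⟩
  simp only [smoothSupp, smul_eq_mul]
  rw [← integral_const_mul, ← integral_const_mul, ← integral_add
    ((K.integrable_mollifier_mul_supp x).const_mul a)
    ((K.integrable_mollifier_mul_supp y).const_mul b)]
  refine integral_mono (K.integrable_mollifier_mul_supp _)
    (((K.integrable_mollifier_mul_supp x).const_mul a).add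
      ((K.integrable_mollifier_mul_supp y).const_mul b)) fun t => ?_
  have h := K.convexOn_supp.2 (Set.mem_univ (x - t)) (Set.mem_univ (y - t)) ha hb hab
  have e : a • (x - t) + b • (y - t) = a • x + b • y - t := by
    rw [smul_sub, smul_sub, sub_add_sub_comm, ← add_smul, hab, one_smul]
  rw [e] at h
  have := mul_le_mul_of_nonneg_left h (mollifier_nonneg t)
  simp only [smul_eq_mul] at this ⊢
  linarith

theorem smoothSupp_body_add (K L : ConvexBody (ι → ℝ)) :
    (K + L).smoothSupp = K.smoothSupp + L.smoothSupp := by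
  ext x
  simp only [smoothSupp, Pi.add_apply, supp_body_add, mul_add]
  exact integral_add (K.integrable_mollifier_mul_supp x) (L.integrable_mollifier_mul_supp x)

theorem smoothSupp_add_le (K : ConvexBody (ι → ℝ)) (x u : ι → ℝ) :
    K.smoothSupp (x + u) ≤ K.smoothSupp x + K.supp u := by
  have h1 : K.supp u = ∫ t, mollifier ι t * K.supp u := by
    rw [integral_mul_const, integral_mollifier, one_mul]
  have h2 : Integrable fun t => mollifier ι t * K.supp u :=
    integrable_mollifier_mul continuous_const
  rw [h1, smoothSupp, smoothSupp, ← integral_add (K.integrable_mollifier_mul_supp x) h2]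
  refine integral_mono (K.integrable_mollifier_mul_supp _)
    ((K.integrable_mollifier_mul_supp x).add h2) fun t => ?_
  simp only [← mul_add]
  refine mul_le_mul_of_nonneg_left ?_ (mollifier_nonneg t)
  rw [add_sub_right_comm]
  exact K.supp_add_le _ _

theorem supp_le_smoothSupp_add (K : ConvexBody (ι → ℝ)) (x : ι → ℝ) :
    K.supp x ≤ K.smoothSupp x + ∫ t, mollifier ι t * K.supp t := by
  have h1 : K.supp x = ∫ t, mollifier ι t * K.supp x := by
    rw [integral_mul_const, integral_mollifier, one_mul]
  have h2 := integrable_mollifier_mul K.continuous_supp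
  rw [smoothSupp, ← integral_add (K.integrable_mollifier_mul_supp x) h2, h1]
  refine integral_mono (integrable_mollifier_mul continuous_const)
    ((K.integrable_mollifier_mul_supp x).add h2) fun t => ?_
  simp only [← mul_add]
  refine mul_le_mul_of_nonneg_left ?_ (mollifier_nonneg t)
  simpa using K.supp_add_le (x - t) t

variable [DecidableEq ι]

theorem mem_of_forall_dotProduct_le_supp (K : ConvexBody (ι → ℝ)) {y : ι → ℝ}
    (h : ∀ u, y ⬝ᵥ u ≤ K.supp u) : y ∈ K := by
  by_contra hy
  obtain ⟨f, c, hf, hc⟩ := geometric_hahn_banach_closed_point K.convex K.isClosed hy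
  have hfu (z : ι → ℝ) : (fun i => f (Pi.single i 1)) ⬝ᵥ z = f z := by
    conv_rhs => rw [pi_eq_sum_univ' z]
    simp [dotProduct, mul_comm]
  have h1 := h fun i => f (Pi.single i 1)
  rw [dotProduct_comm, hfu] at h1
  have h2 := K.supp_le (fun i => f (Pi.single i 1)) (c := c) fun z hz => by
    rw [hfu]; exact (hf z hz).le
  linarith

theorem coordGradient_smoothSupp_mem (K : ConvexBody (ι → ℝ)) (x : ι → ℝ) :
    coordGradient K.smoothSupp x ∈ K := by
  refine K.mem_of_forall_dotProduct_le_supp fun u => ?_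
  rw [coordGradient_dotProduct]
  have hd := (K.contDiff_smoothSupp.differentiable (by norm_num) x).hasFDerivAt
  have hlim := hd.hasLineDerivAt u |>.tendsto_slope_zero_right
  refine le_of_tendsto hlim ?_
  filter_upwards [self_mem_nhdsWithin] with t (ht : 0 < t)
  rw [smul_eq_mul, inv_mul_le_iff₀ ht]
  linarith [K.smoothSupp_add_le x (t • u), K.supp_smul_le u ht.le]

theorem interior_subset_range_coordGradient (K : ConvexBody (ι → ℝ)) :
    interior (K : Set (ι → ℝ)) ⊆ Set.range (coordGradient K.smoothSupp) := by
  intro y hy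
  obtain ⟨δ, hδ, hball⟩ := Metric.nhds_basis_closedBall.mem_iff.1 (mem_interior_iff_mem_nhds.1 hy)
  have hcoer (x : ι → ℝ) : x ⬝ᵥ y + δ * ‖x‖ ≤ K.supp x := by
    have hz : (y + fun i => δ * SignType.sign (x i)) ∈ (K : Set (ι → ℝ)) := by
      apply hball
      rw [mem_closedBall_iff_norm, add_sub_cancel_left, pi_norm_le_iff_of_nonneg hδ.le]
      intro i
      rw [norm_mul, Real.norm_of_nonneg hδ.le]
      refine mul_le_of_le_one_right hδ.le ?_
      rcases lt_trichotomy (x i) 0 with h | h | h <;> simp [h]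
    refine le_trans ?_ (K.dotProduct_le_supp x hz)
    rw [dotProduct_add]
    have e : (x ⬝ᵥ fun i => δ * SignType.sign (x i)) = δ * ∑ i, ‖x i‖ := by
      rw [dotProduct, Finset.mul_sum]
      refine Finset.sum_congr rfl fun i _ => ?_
      rw [Real.norm_eq_abs, ← self_mul_sign]
      ring
    rw [e]
    gcongr
    refine (pi_norm_le_iff_of_nonneg (by positivity)).2 fun i => ?_
    exact Finset.single_le_sum (f := fun i => ‖x i‖) (fun _ _ => norm_nonneg _) (Finset.mem_univ i)
  set C := ∫ t, mollifier ι t * K.supp t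
  have hψ : Differentiable ℝ K.smoothSupp := K.contDiff_smoothSupp.differentiable (by norm_num)
  have htend : Tendsto (fun x => K.smoothSupp x - y ⬝ᵥ x) (cocompact (ι → ℝ)) atTop := by
    refine tendsto_atTop_mono (f := fun x : ι → ℝ => δ * ‖x‖ + -C) (fun x => ?_)
      (tendsto_atTop_add_const_right _ _
        ((tendsto_norm_cocompact_atTop (E := ι → ℝ)).const_mul_atTop hδ))
    have := K.supp_le_smoothSupp_add x
    have := hcoer x
    rw [dotProduct_comm y x]
    linarith
  obtain ⟨x, hx⟩ := Continuous.exists_forall_le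
    (hψ.continuous.sub (continuous_const.dotProduct continuous_id)) htend
  refine ⟨x, funext fun j => ?_⟩
  have hmin : IsMinOn (fun t : ℝ => K.smoothSupp (x + t • Pi.single j 1)
      - y ⬝ᵥ (x + t • Pi.single j 1)) Set.univ 0 := fun t _ => by
    change K.smoothSupp (x + (0 : ℝ) • Pi.single j 1) - y ⬝ᵥ (x + (0 : ℝ) • Pi.single j 1) ≤ _
    rw [zero_smul, add_zero]
    exact hx (x + t • Pi.single j 1)
  have h1 : HasDerivAt (fun t : ℝ => K.smoothSupp (x + t • Pi.single j 1))
      (coordGradient K.smoothSupp x j) 0 := (hψ x).hasFDerivAt.hasLineDerivAt _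
  have h2 : HasDerivAt (fun t : ℝ => y ⬝ᵥ (x + t • Pi.single j 1)) (y j) 0 := by
    simp only [dotProduct_add, dotProduct_smul, dotProduct_single, mul_one, smul_eq_mul]
    simpa using ((hasDerivAt_id (0 : ℝ)).mul_const (y j)).const_add (y ⬝ᵥ x)
  have := (hmin.isLocalMin univ_mem).hasDerivAt_eq_zero (h1.sub h2)
  linarith

theorem lintegral_det_coordHessian_smoothSupp (K : ConvexBody (ι → ℝ)) :
    ∫⁻ x, ENNReal.ofReal (coordHessian K.smoothSupp x).det = volume (K : Set (ι → ℝ)) := by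
  rw [K.convexOn_smoothSupp.lintegral_det_coordHessian K.contDiff_smoothSupp]
  refine le_antisymm (measure_mono ?_) ?_
  · rintro _ ⟨x, rfl⟩
    exact K.coordGradient_smoothSupp_mem x
  · rw [← measure_congr (interior_ae_eq_of_null_frontier (K.convex.addHaar_frontier volume))]
    exact measure_mono K.interior_subset_range_coordGradient

theorem integrable_det_coordHessian_smoothSupp (K : ConvexBody (ι → ℝ)) :
    Integrable fun x => (coordHessian K.smoothSupp x).det := by
  have h0 (x) : 0 ≤ (coordHessian K.smoothSupp x).det :=
    (K.convexOn_smoothSupp.posSemidef_coordHessian K.contDiff_smoothSupp x).det_nonneg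
  refine ⟨K.contDiff_smoothSupp.continuous_coordHessian.matrix_det.aestronglyMeasurable, ?_⟩
  rw [hasFiniteIntegral_iff_ofReal (ae_of_all _ h0), lintegral_det_coordHessian_smoothSupp]
  exact K.isCompact.measure_lt_top

theorem integral_det_coordHessian_smoothSupp (K : ConvexBody (ι → ℝ)) :
    ∫ x, (coordHessian K.smoothSupp x).det = (volume (K : Set (ι → ℝ))).toReal := by
  rw [integral_eq_lintegral_of_nonneg_ae (ae_of_all _ fun x =>
      (K.convexOn_smoothSupp.posSemidef_coordHessian K.contDiff_smoothSupp x).det_nonneg)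
    K.integrable_det_coordHessian_smoothSupp.aestronglyMeasurable,
    lintegral_det_coordHessian_smoothSupp]

theorem coordHessian_smoothSupp_body_add (K L : ConvexBody (ι → ℝ)) (x : ι → ℝ) :
    coordHessian (K + L).smoothSupp x
      = coordHessian K.smoothSupp x + coordHessian L.smoothSupp x := by
  have hK := K.contDiff_smoothSupp
  have hL := L.contDiff_smoothSupp
  have h : coordGradient (K + L).smoothSupp
      = coordGradient K.smoothSupp + coordGradient L.smoothSupp := by
    ext z j
    simp only [coordGradient, smoothSupp_body_add, Pi.add_apply]
    rw [fderiv_add (hK.differentiable (by norm_num) z) (hL.differentiable (by norm_num) z)]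
    rfl
  rw [coordHessian, h, fderiv_add (hK.coordGradient.differentiable (by norm_num) x)
    (hL.coordGradient.differentiable (by norm_num) x)]
  simp [coordHessian]

/-- The Hessian of the smoothed support function at a point, as an additive function of the
convex body. -/
noncomputable def hessianHom (x : ι → ℝ) : ConvexBody (ι → ℝ) →+ Matrix ι ι ℝ where
  toFun K := coordHessian K.smoothSupp x
  map_zero' := by simpa using coordHessian_smoothSupp_body_add 0 0 x
  map_add' K L := coordHessian_smoothSupp_body_add K L x

/-- The multiadditive function sending a tuple of convex bodies to the determinant whose `i`-th row
is taken from the Hessian of the smoothed support function of the `i`-th body. -/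
noncomputable def detHessian (x : ι → ℝ) :
    MultilinearMap ℕ (fun _ : ι => ConvexBody (ι → ℝ)) ℝ :=
  ((Matrix.detRowAlternating (n := ι) (R := ℝ)).toMultilinearMap.restrictScalars ℕ).compLinearMap
    fun i => (LinearMap.proj (R := ℕ) (φ := fun _ : ι => ι → ℝ) i).comp
      (hessianHom x).toNatLinearMap

theorem detHessian_diag (x : ι → ℝ) (K : ConvexBody (ι → ℝ)) :
    detHessian x (fun _ => K) = (coordHessian K.smoothSupp x).det := rfl

/-- The mixed discriminant of the Hessians of the smoothed support functions, up to the factor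
`(Fintype.card ι)!`. -/
noncomputable def mixedDensity (x : ι → ℝ) :
    MultilinearMap ℕ (fun _ : ι => ConvexBody (ι → ℝ)) ℝ :=
  ∑ σ : Equiv.Perm ι, (detHessian x).domDomCongr σ

theorem mixedDensity_apply (x : ι → ℝ) (P : ι → ConvexBody (ι → ℝ)) :
    mixedDensity x P = ∑ σ : Equiv.Perm ι, detHessian x (P ∘ σ) := by
  simp [mixedDensity, Function.comp_def]

theorem mixedDensity_perm (x : ι → ℝ) (P : ι → ConvexBody (ι → ℝ)) (τ : Equiv.Perm ι) :
    mixedDensity x (P ∘ τ) = mixedDensity x P := by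
  rw [mixedDensity_apply, mixedDensity_apply]
  exact Fintype.sum_equiv (Equiv.mulLeft τ) _ _ fun σ => rfl

theorem integrable_mixedDensity (P : ι → ConvexBody (ι → ℝ)) :
    Integrable fun x => mixedDensity x P := by
  simp_rw [mixedDensity_apply, ← MultilinearMap.sum_neg_one_pow_smul_map_sum_compl,
    detHessian_diag]
  exact integrable_finsetSum _ fun U _ =>
    (integrable_det_coordHessian_smoothSupp _).smul ((-1 : ℤ) ^ U.card)

end ConvexBody

/-- A symmetric multiadditive function is determined by its values on the diagonal. -/
theorem eq_of_symm_of_update_add_of_diag {ι M : Type*} [Fintype ι] [DecidableEq ι]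
    [AddCommMonoid M] {f g : (ι → M) → ℝ}
    (hfs : ∀ P (σ : Equiv.Perm ι), f (P ∘ σ) = f P)
    (hfa : ∀ P i K K', f (Function.update P i (K + K'))
      = f (Function.update P i K) + f (Function.update P i K'))
    (hgs : ∀ P (σ : Equiv.Perm ι), g (P ∘ σ) = g P)
    (hga : ∀ P i K K', g (Function.update P i (K + K'))
      = g (Function.update P i K) + g (Function.update P i K'))
    (h : ∀ K, f (fun _ => K) = g (fun _ => K)) : f = g := by
  have polarization {f : (ι → M) → ℝ} (hfs : ∀ P (σ : Equiv.Perm ι), f (P ∘ σ) = f P)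
      (hfa : ∀ P i K K', f (Function.update P i (K + K'))
        = f (Function.update P i K) + f (Function.update P i K')) (P : ι → M) :
      ((Fintype.card ι).factorial : ℝ) * f P
        = ∑ U : Finset ι, (-1 : ℤ) ^ U.card • f (fun _ => ∑ i ∈ Uᶜ, P i) := by
    have h0 (P : ι → M) (i : ι) : f (Function.update P i 0) = 0 := by simpa using hfa P i 0 0
    let F : MultilinearMap ℕ (fun _ : ι => M) ℝ :=
      MultilinearMap.mk' f hfa fun P i n K => by
        induction n with
        | zero => simp [h0]
        | succ n ih => rw [succ_nsmul, hfa, ih, succ_nsmul]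
    have := F.sum_neg_one_pow_smul_map_sum_compl P
    change ∑ U : Finset ι, (-1 : ℤ) ^ U.card • f (fun _ => ∑ i ∈ Uᶜ, P i)
      = ∑ σ : Equiv.Perm ι, f (P ∘ σ) at this
    rw [this]
    simp [hfs, Fintype.card_perm]
  ext P
  have hne : ((Fintype.card ι).factorial : ℝ) ≠ 0 := by positivity
  refine mul_left_cancel₀ hne ?_
  rw [polarization hfs hfa, polarization hgs hga]
  simp only [h]

/-- Existence and uniqueness of the mixed volume: there is a unique symmetric,
Minkowski-multilinear real-valued function `MV` of `m`-tuples of convex bodies in `ℝ^m`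
whose diagonal values are the Lebesgue volumes. -/
theorem mixed_volume_exists_unique (m : ℕ) :
    ∃! MV : (Fin m → ConvexBody (Fin m → ℝ)) → ℝ,
      (∀ (P : Fin m → ConvexBody (Fin m → ℝ)) (σ : Equiv.Perm (Fin m)),
          MV (P ∘ σ) = MV P) ∧
      (∀ (P : Fin m → ConvexBody (Fin m → ℝ)) (i : Fin m) (K K' : ConvexBody (Fin m → ℝ)),
          MV (Function.update P i (K + K'))
            = MV (Function.update P i K) + MV (Function.update P i K')) ∧
      (∀ P : ConvexBody (Fin m → ℝ),
          MV (fun _ => P) = (volume (P : Set (Fin m → ℝ))).toReal) := by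
  refine existsUnique_of_exists_of_unique
    ⟨fun P => (m.factorial : ℝ)⁻¹ * ∫ x, ConvexBody.mixedDensity x P, fun P σ => ?_,
      fun P i K K' => ?_, fun K => ?_⟩
    fun f g hf hg => eq_of_symm_of_update_add_of_diag hf.1 hf.2.1 hg.1 hg.2.1 fun K =>
      (hf.2.2 K).trans (hg.2.2 K).symm
  · simp only [ConvexBody.mixedDensity_perm]
  · simp only [MultilinearMap.map_update_add]
    rw [integral_add (ConvexBody.integrable_mixedDensity _)
      (ConvexBody.integrable_mixedDensity _), mul_add]
  · have hm : (m.factorial : ℝ) ≠ 0 := by positivity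
    simp only [ConvexBody.mixedDensity_apply, Function.comp_def, ConvexBody.detHessian_diag,
      Finset.sum_const, Finset.card_univ, Fintype.card_perm, Fintype.card_fin, nsmul_eq_mul]
    rw [integral_const_mul, ConvexBody.integral_det_coordHessian_smoothSupp,
      inv_mul_cancel_left₀ hm]
end
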